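/- arXiv:1811.11904 — 3 statements merged into one kernel-verified Lean document; each statement's English description precedes it below -/
import Mathlib

section
/- Let α > 0, C₁ > 0, and let u : ℝ → ℝ be continuous and 2π-periodic with ω₁(δ,u) ≥ C₁ δ^{2α+3} for all δ ∈ (0,1). Let ν > 0 and let k be a nonzero integer with ν|k|^{−1} ≤ 1/2. Let T : [0,∞) → B(L²(𝕋;ℂ)) satisfy T(0) = Id, T(s+t) = T(s)T(t), ‖T(t)‖ ≤ 1, and for every twice continuously differentiable 2π-periodic f: T(t)f is in the domain and t ↦ T(t)f is differentiable with d/dt T(t)f = ν (T(t)f)'' − i k u · T(t)f (so T(t) = e^{−tR_{k,ν}} with R_{k,ν} = iku − ν∂_y²). Then ‖T(t)f‖_{L²} ≤ e^{π/2} e^{−ε \tilde{λ}_{ν,k} t} ‖f‖_{L²} for all t ≥ 0 and all f ∈ L²(𝕋), where \tilde{λ}_{ν,k} = ν^{α/(α+2)} |k|^{2/(α+2)} and ε = (φ^{−1}(C₁))² with φ(x) = 36 x tan x on [0,π/2). The same bound holds for the semigroup generated by −L_{k,ν} with L_{k,ν} = iku − ν(∂_y² − |k|²). -/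
/-- The `L²(0, 2π)` norm of a (`2π`-periodic) function `f : ℝ → ℂ`. -/
noncomputable def l2norm (f : ℝ → ℂ) : ℝ :=
  Real.sqrt (∫ y in (0 : ℝ)..(2 * Real.pi), ‖f y‖ ^ 2)

/-- `ω₁(δ, u) = inf_{x, c₁, c₂} ∫_{x-δ}^{x+δ} |ψ(y) - c₁ - c₂y|² dy`, `ψ' = u`. -/
noncomputable def omega1 (δ : ℝ) (ψ : ℝ → ℝ) : ℝ :=
  sInf {r : ℝ | ∃ x c₁ c₂ : ℝ, r = ∫ y in (x - δ)..(x + δ), (ψ y - c₁ - c₂ * y) ^ 2}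

/-- The inverse of the increasing bijection `φ : [0, π/2) → [0, ∞)`,
`φ(x) = 36 x tan x`. -/
noncomputable def phiInv (r : ℝ) : ℝ :=
  sSup {x : ℝ | x ∈ Set.Ico 0 (Real.pi / 2) ∧ 36 * x * Real.tan x ≤ r}

/-- Sturm comparison for `N = |p|²`, `D = Re (p' p̄)`. -/
lemma sturm_comparison {N D D2 K : ℝ → ℝ} {κ a b m : ℝ}
    (hN : ∀ t, HasDerivAt N (2 * D t) t) (hD : ∀ t, HasDerivAt D (D2 t) t)
    (hD2 : ∀ t, K t - κ ^ 2 * N t ≤ D2 t)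
    (hquad : ∀ t x : ℝ, 0 ≤ K t + 2 * x * D t + x ^ 2 * N t)
    (hcos : ∀ t ∈ Set.Icc a b, 0 < Real.cos (κ * (t - m)))
    (hinit : 0 ≤ D a + κ * Real.tan (κ * (a - m)) * N a) :
    ∀ t ∈ Set.Icc a b, 0 ≤ D t + κ * Real.tan (κ * (t - m)) * N t ∧
      N a * Real.cos (κ * (t - m)) ^ 2 ≤ N t * Real.cos (κ * (a - m)) ^ 2 := by
  intro t ht
  have hlin : ∀ y : ℝ, HasDerivAt (fun y => κ * (y - m)) κ y := fun y => by
    simpa using ((hasDerivAt_id y).sub_const m).const_mul κ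
  have hAder : ∀ y ∈ Set.Icc a b,
      HasDerivAt (fun y => D y + κ * Real.tan (κ * (y - m)) * N y)
      (D2 y + (κ * (1 / Real.cos (κ * (y - m)) ^ 2 * κ) * N y
        + κ * Real.tan (κ * (y - m)) * (2 * D y))) y := fun y hy => by
    have h := (Real.hasDerivAt_tan (hcos y hy).ne').comp y (hlin y)
    exact (hD y).fun_add ((h.const_mul κ).fun_mul (hN y))
  have hAmono : MonotoneOn (fun y => D y + κ * Real.tan (κ * (y - m)) * N y) (Set.Icc a b) := by
    apply monotoneOn_of_deriv_nonneg (convex_Icc a b)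
    · exact fun y hy => (hAder y hy).continuousAt.continuousWithinAt
    · exact fun y hy => (hAder y (interior_subset hy)).differentiableAt.differentiableWithinAt
    · intro y hy
      have hy' := interior_subset hy
      rw [(hAder y hy').deriv]
      have h1 : 1 / Real.cos (κ * (y - m)) ^ 2 = 1 + Real.tan (κ * (y - m)) ^ 2 := by
        rw [Real.tan_eq_sin_div_cos]
        have := (hcos y hy').ne'
        field_simp
        nlinarith [Real.sin_sq_add_cos_sq (κ * (y - m))]
      rw [h1]
      nlinarith [hD2 y, hquad y (κ * Real.tan (κ * (y - m)))]
  have ha : a ∈ Set.Icc a b := ⟨le_rfl, ht.1.trans ht.2⟩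
  have hA : ∀ y ∈ Set.Icc a b, 0 ≤ D y + κ * Real.tan (κ * (y - m)) * N y := fun y hy =>
    hinit.trans (hAmono ha hy hy.1)
  refine ⟨hA t ht, ?_⟩
  have hBder : ∀ y ∈ Set.Icc a b,
      HasDerivAt (fun y => N y / Real.cos (κ * (y - m)) ^ 2)
      ((2 * D y * Real.cos (κ * (y - m)) ^ 2
        - N y * (2 * Real.cos (κ * (y - m)) * (-Real.sin (κ * (y - m)) * κ)))
          / (Real.cos (κ * (y - m)) ^ 2) ^ 2) y := fun y hy => by
    have h := ((Real.hasDerivAt_cos _).comp y (hlin y)).pow 2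
    have h2 := (hN y).div h (pow_ne_zero 2 (hcos y hy).ne')
    refine h2.congr_deriv ?_
    simp
  have hBmono : MonotoneOn (fun y => N y / Real.cos (κ * (y - m)) ^ 2) (Set.Icc a b) := by
    apply monotoneOn_of_deriv_nonneg (convex_Icc a b)
    · exact fun y hy => (hBder y hy).continuousAt.continuousWithinAt
    · exact fun y hy => (hBder y (interior_subset hy)).differentiableAt.differentiableWithinAt
    · intro y hy
      have hy' := interior_subset hy
      rw [(hBder y hy').deriv]
      have hc := hcos y hy'
      have h1 := hA y hy'
      rw [Real.tan_eq_sin_div_cos] at h1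
      have h2 : 2 * D y * Real.cos (κ * (y - m)) ^ 2
        - N y * (2 * Real.cos (κ * (y - m)) * (-Real.sin (κ * (y - m)) * κ)) =
        2 * Real.cos (κ * (y - m)) ^ 2 *
          (D y + κ * (Real.sin (κ * (y - m)) / Real.cos (κ * (y - m))) * N y) := by
        field_simp
        ring
      rw [h2]
      positivity
  have h := hBmono ha ht ht.1
  simp only at h
  rwa [div_le_div_iff₀ (pow_pos (hcos a ha) 2) (pow_pos (hcos t ht) 2)] at h

/-- Two-sided bound of the logarithmic derivative to the right of a global maximum. -/
lemma abs_logDeriv_le_tan {N D D2 K : ℝ → ℝ} {κ δ : ℝ} (hκ : 0 < κ) (hz : κ * δ < Real.pi / 2)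
    (hN : ∀ t, HasDerivAt N (2 * D t) t) (hD : ∀ t, HasDerivAt D (D2 t) t)
    (hD2 : ∀ t, K t - κ ^ 2 * N t ≤ D2 t)
    (hquad : ∀ t x : ℝ, 0 ≤ K t + 2 * x * D t + x ^ 2 * N t)
    (hmax : ∀ t, N t ≤ N 0) (h0 : 0 < N 0) :
    ∀ t ∈ Set.Icc 0 δ, 0 < N t ∧ |D t| ≤ κ * Real.tan (κ * t) * N t := by
  have hD0 : D 0 = 0 := by
    have h : IsLocalMax N 0 := Filter.Eventually.of_forall hmax
    have := h.hasDerivAt_eq_zero (hN 0)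
    linarith
  have hcos : ∀ t ∈ Set.Icc 0 δ, 0 < Real.cos (κ * (t - 0)) := fun t ht => by
    apply Real.cos_pos_of_mem_Ioo
    have h1 : κ * t ≤ κ * δ := by gcongr; exact ht.2
    have h2 : 0 ≤ κ * t := mul_nonneg hκ.le ht.1
    constructor <;> simp <;> linarith [Real.pi_pos]
  have hlow := sturm_comparison (m := 0) hN hD hD2 hquad hcos (by simp [hD0])
  intro y hy
  obtain ⟨hy1, hy2⟩ := hlow y hy
  simp only [sub_zero, mul_zero, Real.cos_zero, one_pow, mul_one] at hy1 hy2
  have hcy := hcos y hy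
  rw [sub_zero] at hcy
  have hNy : 0 < N y := lt_of_lt_of_le (by positivity) hy2
  refine ⟨hNy, abs_le.2 ⟨by linarith, ?_⟩⟩
  by_contra! hcon
  set β := Real.arctan (D y / (κ * N y)) with hβ
  have htanβ : Real.tan β = D y / (κ * N y) := Real.tan_arctan _
  have hκy : 0 ≤ κ * y := mul_nonneg hκ.le hy.1
  have hκy2 : κ * y < Real.pi / 2 := lt_of_le_of_lt (by gcongr; exact hy.2) hz
  have hβy : κ * y < β := by
    rw [hβ, ← Real.arctan_tan (by linarith [Real.pi_pos]) hκy2]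
    apply Real.arctan_strictMono
    rw [lt_div_iff₀ (by positivity)]
    nlinarith
  have hβ2 : β < Real.pi / 2 := Real.arctan_lt_pi_div_two _
  have hβ0 : 0 < β := by linarith
  have hcosβ : 0 < Real.cos β := Real.cos_arctan_pos _
  have h := sturm_comparison (a := y) (b := y + β / κ) (m := y + β / κ) hN hD hD2 hquad
    (fun t ht => by
      apply Real.cos_pos_of_mem_Ioo
      have h1 : κ * (t - (y + β / κ)) = κ * (t - y) - β := by field_simp; ring
      have h2 : κ * (t - y) ≤ β := by
        have : t - y ≤ β / κ := by linarith [ht.2]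
        rwa [le_div_iff₀ hκ, mul_comm] at this
      have h3 : 0 ≤ κ * (t - y) := mul_nonneg hκ.le (by linarith [ht.1])
      rw [h1]
      constructor <;> linarith)
    (by
      have h1 : κ * (y - (y + β / κ)) = -β := by field_simp; ring
      rw [h1, Real.tan_neg, htanβ]
      field_simp
      linarith) (y + β / κ) ⟨by linarith [div_pos hβ0 hκ], le_rfl⟩
  have h1 : κ * (y - (y + β / κ)) = -β := by field_simp; ring
  have h2 := h.2
  rw [h1, sub_self, mul_zero, Real.cos_zero, Real.cos_neg, one_pow, mul_one] at h2
  have h3 : Real.cos β < Real.cos (κ * y) :=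
    Real.cos_lt_cos_of_nonneg_of_le_pi_div_two hκy hβ2.le hβy
  have h4 : Real.cos β ^ 2 < Real.cos (κ * y) ^ 2 := by gcongr
  nlinarith [hmax (y + β / κ), sq_nonneg (Real.cos β)]

open ComplexConjugate in
/-- Bound of the primitive `W` of `w` on a half window to the right of a global maximum of `|p|`,
where `p'' = (i w + c) p - κ² p̄`. -/
lemma half_window_bound {p p1 : ℝ → ℂ} {w W : ℝ → ℝ} {c κ δ : ℝ} (hc : 0 ≤ c) (hκ : 0 < κ)
    (hδ : 0 < δ) (hz : κ * δ < Real.pi / 2) (hW : ∀ t, HasDerivAt W (w t) t)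
    (hp : ∀ t, HasDerivAt p (p1 t) t)
    (hp1 : ∀ t, HasDerivAt p1 ((Complex.I * (w t : ℂ) + (c : ℂ)) * p t
      - (κ : ℂ) ^ 2 * conj (p t)) t)
    (hmax : ∀ t, ‖p t‖ ≤ ‖p 0‖) (h0 : p 0 ≠ 0) :
    ∫ t in (0 : ℝ)..δ, (W t - W 0 + (p1 0 / p 0).im) ^ 2 ≤ 18 * κ * Real.tan (κ * δ) := by
  have hre : ∀ t, HasDerivAt (fun t => (p t).re) (p1 t).re t := fun t =>
    (Complex.reCLM.hasFDerivAt.comp_hasDerivAt t (hp t))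
  have him : ∀ t, HasDerivAt (fun t => (p t).im) (p1 t).im t := fun t =>
    (Complex.imCLM.hasFDerivAt.comp_hasDerivAt t (hp t))
  have hre1 := fun t => Complex.reCLM.hasFDerivAt.comp_hasDerivAt t (hp1 t)
  have him1 := fun t => Complex.imCLM.hasFDerivAt.comp_hasDerivAt t (hp1 t)
  set N : ℝ → ℝ := fun t => (p t).re ^ 2 + (p t).im ^ 2 with hNdef
  set D : ℝ → ℝ := fun t => (p1 t).re * (p t).re + (p1 t).im * (p t).im with hDdef
  set K : ℝ → ℝ := fun t => (p1 t).re ^ 2 + (p1 t).im ^ 2 with hKdef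
  have hNnorm : ∀ t, N t = ‖p t‖ ^ 2 := fun t => by
    rw [Complex.sq_norm, Complex.normSq_apply]; simp only [hNdef]; ring
  have hN : ∀ t, HasDerivAt N (2 * D t) t := fun t => by
    refine (((hre t).pow 2).add ((him t).pow 2)).congr_deriv ?_
    simp [hDdef]; ring
  have hD : ∀ t, HasDerivAt D (K t + c * N t - κ ^ 2 * ((p t).re ^ 2 - (p t).im ^ 2)) t :=
    fun t => by
    refine (((hre1 t).mul (hre t)).add ((him1 t).mul (him t))).congr_deriv ?_
    simp [hKdef, hNdef, ← Complex.ofReal_pow]; ring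
  have hN0 : ∀ t, 0 ≤ N t := fun t => by positivity
  have hkey := abs_logDeriv_le_tan (K := K) hκ hz hN hD
    (fun t => by
      have : 0 ≤ c * N t := mul_nonneg hc (hN0 t)
      have h2 : 0 ≤ κ ^ 2 * (2 * (p t).im ^ 2) := by positivity
      simp only [hNdef] at *
      nlinarith)
    (fun t x => by
      simp only [hNdef, hDdef, hKdef]
      nlinarith [sq_nonneg ((p1 t).re + x * (p t).re), sq_nonneg ((p1 t).im + x * (p t).im)])
    (fun t => by rw [hNnorm, hNnorm]; gcongr; exact hmax t)
    (by rw [hNnorm]; have := norm_pos_iff.2 h0; positivity)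
  have hpne : ∀ t ∈ Set.Icc 0 δ, p t ≠ 0 := fun t ht h => by
    have := (hkey t ht).1
    rw [hNnorm, h] at this
    simp at this
  set v : ℝ → ℂ := fun t => p1 t / p t with hvdef
  set e : ℝ → ℂ := fun t => conj (p t) / p t with hedef
  have hv : ∀ t ∈ Set.Icc 0 δ, HasDerivAt v
      (Complex.I * (w t : ℂ) + (c : ℂ) - (κ : ℂ) ^ 2 * e t - v t ^ 2) t := fun t ht => by
    refine ((hp1 t).div (hp t) (hpne t ht)).congr_deriv ?_
    have := hpne t ht
    simp only [hvdef, hedef]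
    field_simp
  have he : ∀ t ∈ Set.Icc 0 δ, (e t).re ^ 2 + (e t).im ^ 2 = 1 := fun t ht => by
    have h1 : ‖e t‖ = 1 := by
      simp only [hedef, norm_div, RCLike.norm_conj]
      exact div_self (norm_ne_zero_iff.2 (hpne t ht))
    have := Complex.sq_norm (e t)
    rw [h1, Complex.normSq_apply] at this
    nlinarith
  set r : ℝ → ℝ := fun t => (v t).re with hrdef
  set τ : ℝ → ℝ := fun t => (v t).im with hτdef
  set η : ℝ → ℝ := fun t => κ * Real.tan (κ * t) with hηdef
  have hr : ∀ t ∈ Set.Icc 0 δ,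
      HasDerivAt r (c - κ ^ 2 * (e t).re - r t ^ 2 + τ t ^ 2) t := fun t ht => by
    refine (Complex.reCLM.hasFDerivAt.comp_hasDerivAt t (hv t ht)).congr_deriv ?_
    simp [hrdef, hτdef, ← Complex.ofReal_pow, pow_two (v t)]; ring
  have hτ : ∀ t ∈ Set.Icc 0 δ,
      HasDerivAt τ (w t - κ ^ 2 * (e t).im - 2 * r t * τ t) t := fun t ht => by
    refine (Complex.imCLM.hasFDerivAt.comp_hasDerivAt t (hv t ht)).congr_deriv ?_
    simp [hrdef, hτdef, ← Complex.ofReal_pow, pow_two (v t)]; ring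
  have hcos : ∀ t ∈ Set.Icc 0 δ, 0 < Real.cos (κ * t) := fun t ht => by
    apply Real.cos_pos_of_mem_Ioo
    have h1 : κ * t ≤ κ * δ := by gcongr; exact ht.2
    have h2 : 0 ≤ κ * t := mul_nonneg hκ.le ht.1
    constructor <;> linarith [Real.pi_pos]
  have hη : ∀ t ∈ Set.Icc 0 δ, HasDerivAt η (κ ^ 2 + η t ^ 2) t := fun t ht => by
    have h := ((Real.hasDerivAt_tan (hcos t ht).ne').comp t
      ((hasDerivAt_id t).const_mul κ)).const_mul κ
    refine h.congr_deriv ?_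
    simp only [hηdef, Real.tan_eq_sin_div_cos]
    have := (hcos t ht).ne'
    field_simp
    nlinarith [Real.sin_sq_add_cos_sq (κ * t)]
  have hrη : ∀ t ∈ Set.Icc 0 δ, |r t| ≤ η t := fun t ht => by
    obtain ⟨h1, h2⟩ := hkey t ht
    have h3 : r t = D t / N t := by
      simp only [hrdef, hvdef, Complex.div_re, hDdef, hNdef, Complex.normSq_apply]
      ring
    rw [h3, abs_div, abs_of_pos h1, div_le_iff₀ h1]
    exact h2
  have hzero : (0 : ℝ) ∈ Set.Icc 0 δ := ⟨le_rfl, hδ.le⟩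
  have hη0 : η 0 = 0 := by simp [hηdef]
  have hr0 : r 0 = 0 := by
    have := hrη 0 hzero
    rw [hη0] at this
    exact abs_nonpos_iff.1 this
  set P : ℝ → ℝ := fun t => W t - W 0 + τ 0 - τ t with hPdef
  have hP : ∀ t ∈ Set.Icc 0 δ, HasDerivAt P (κ ^ 2 * (e t).im + 2 * r t * τ t) t := fun t ht => by
    refine ((((hW t).sub_const (W 0)).add_const (τ 0)).sub (hτ t ht)).congr_deriv ?_
    ring
  have hs2 : Real.sqrt 2 ^ 2 = 2 := Real.sq_sqrt (by norm_num)
  have hs2p : 0 < Real.sqrt 2 := by positivity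
  have hPbound : ∀ σ : ℝ, σ ^ 2 = 1 → ∀ t ∈ Set.Icc 0 δ,
      Real.sqrt 2 * (σ * P t) ≤ 3 * η t + r t := by
    intro σ hσ t ht
    have hder : ∀ y ∈ Set.Icc 0 δ,
        HasDerivAt (fun y => 3 * η y + r y - Real.sqrt 2 * (σ * P y)) _ y := fun y hy =>
      (((hη y hy).const_mul 3).add (hr y hy)).sub (((hP y hy).const_mul σ).const_mul (Real.sqrt 2))
    have hmono : MonotoneOn (fun y => 3 * η y + r y - Real.sqrt 2 * (σ * P y)) (Set.Icc 0 δ) := by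
      apply monotoneOn_of_deriv_nonneg (convex_Icc _ _)
      · exact fun y hy => (hder y hy).continuousAt.continuousWithinAt
      · exact fun y hy => (hder y (interior_subset hy)).differentiableAt.differentiableWithinAt
      · intro y hy
        have hy' := interior_subset hy
        rw [(hder y hy').deriv]
        have h1 : r y ^ 2 ≤ η y ^ 2 := sq_le_sq' (by linarith [(abs_le.1 (hrη y hy')).1])
          (abs_le.1 (hrη y hy')).2
        have h2 := he y hy'
        set e1 := (e y).re
        set e2 := (e y).im
        have he1 : e1 ≤ 1 := by nlinarith
        have he1' : -1 ≤ e1 := by nlinarith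
        have h3 : Real.sqrt 2 * (σ * (2 * r y * τ y)) ≤ 2 * r y ^ 2 + τ y ^ 2 := by
          nlinarith [sq_nonneg (Real.sqrt 2 * r y - σ * τ y)]
        have h4 : Real.sqrt 2 * (σ * e2) ≤ 3 / 2 + e1 / 2 := by
          nlinarith [sq_nonneg (Real.sqrt 2 * σ * e2 - (1 + e1)), sq_nonneg (e1 - 1),
            abs_le_of_sq_le_sq' (a := Real.sqrt 2 * (σ * e2)) (b := 3 / 2 + e1 / 2)
              (by rw [mul_pow, mul_pow, hs2, hσ]; nlinarith [sq_nonneg (3 * e1 + 1)])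
              (by linarith)]
        have h5 := mul_le_mul_of_nonneg_left h4 (sq_nonneg κ)
        have h6 : κ ^ 2 * e1 ≤ κ ^ 2 := by nlinarith [sq_nonneg κ]
        nlinarith
    have := hmono hzero ht ht.1
    simp only [hη0, hr0, hPdef] at this ⊢
    linarith
  have hP2 : ∀ t ∈ Set.Icc 0 δ, P t ^ 2 ≤ 8 * η t ^ 2 := fun t ht => by
    have h1 := hPbound 1 (by norm_num) t ht
    have h2 := hPbound (-1) (by norm_num) t ht
    have h3 := (abs_le.1 (hrη t ht)).2
    have h4 : (Real.sqrt 2 * P t) ^ 2 ≤ (4 * η t) ^ 2 := sq_le_sq' (by linarith) (by linarith)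
    rw [mul_pow, hs2] at h4
    linarith
  have hfin := intervalIntegral.integral_le_sub_of_hasDeriv_right_of_le (a := 0) (b := δ)
    (g := fun t => 3 * r t + 15 * η t)
    (φ := fun t => (W t - W 0 + τ 0) ^ 2) hδ.le
    (fun t ht => (((hr t ht).const_mul 3).add
      ((hη t ht).const_mul 15)).continuousAt.continuousWithinAt)
    (fun t ht => (((hr t (Set.Ioo_subset_Icc_self ht)).const_mul 3).add
      ((hη t (Set.Ioo_subset_Icc_self ht)).const_mul 15)).hasDerivWithinAt)
    (by
      have hWc : Continuous W := continuous_iff_continuousAt.2 fun t => (hW t).continuousAt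
      exact (Continuous.continuousOn (by fun_prop)).integrableOn_Icc)
    (fun t ht => by
      have ht' := Set.Ioo_subset_Icc_self ht
      have h1 : W t - W 0 + τ 0 = τ t + P t := by simp only [hPdef]; ring
      have h2 := hP2 t ht'
      have h3 : r t ^ 2 ≤ η t ^ 2 := sq_le_sq' (by linarith [(abs_le.1 (hrη t ht')).1])
          (abs_le.1 (hrη t ht')).2
      have h4 := he t ht'
      have he1 : (e t).re ≤ 1 := by nlinarith
      have h6 : κ ^ 2 * (e t).re ≤ κ ^ 2 := by nlinarith [sq_nonneg κ]
      rw [h1]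
      nlinarith [sq_nonneg (2 * τ t - P t), sq_nonneg κ])
  simp only [hr0, hη0] at hfin
  have h18 := (abs_le.1 (hrη δ ⟨hδ.le, le_rfl⟩)).2
  have : 3 * r δ + 15 * η δ ≤ 18 * κ * Real.tan (κ * δ) := by
    simp only [hηdef] at *
    linarith
  linarith

open ComplexConjugate in
/-- A nonzero periodic solution of `p'' = (i w + c) p - κ² p̄` forces a primitive of `w` to be close
to a constant on some window of radius `δ`. -/
lemma exists_window_bound {p p1 : ℝ → ℂ} {w W : ℝ → ℝ} {c κ δ P : ℝ} (hc : 0 ≤ c) (hκ : 0 < κ)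
    (hδ : 0 < δ) (hz : κ * δ < Real.pi / 2) (hW : ∀ t, HasDerivAt W (w t) t)
    (hp : ∀ t, HasDerivAt p (p1 t) t)
    (hp1 : ∀ t, HasDerivAt p1 ((Complex.I * (w t : ℂ) + (c : ℂ)) * p t
      - (κ : ℂ) ^ 2 * conj (p t)) t)
    (hP : 0 < P) (hper : Function.Periodic p P) (hne : ∃ y, p y ≠ 0) :
    ∃ x c₁ : ℝ, ∫ t in (x - δ)..(x + δ), (W t - c₁) ^ 2 ≤ 36 * κ * Real.tan (κ * δ) := by
  have hpc : Continuous p := continuous_iff_continuousAt.2 fun t => (hp t).continuousAt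
  have hWc : Continuous W := continuous_iff_continuousAt.2 fun t => (hW t).continuousAt
  obtain ⟨x, -, hx⟩ := (isCompact_Icc (a := (0 : ℝ)) (b := P)).exists_isMaxOn
    ⟨0, le_rfl, hP.le⟩ hpc.norm.continuousOn
  have hmax : ∀ t, ‖p t‖ ≤ ‖p x‖ := fun t => by
    obtain ⟨y, hy, hyt⟩ := hper.exists_mem_Ico₀ hP t
    rw [hyt]
    exact hx (Set.Ico_subset_Icc_self hy)
  have hx0 : p x ≠ 0 := by
    obtain ⟨y, hy⟩ := hne
    exact norm_pos_iff.1 ((norm_pos_iff.2 hy).trans_le (hmax y))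
  have hright := half_window_bound (p := fun t => p (x + t)) (p1 := fun t => p1 (x + t))
    (w := fun t => w (x + t)) (W := fun t => W (x + t)) hc hκ hδ hz
    (fun t => (hW (x + t)).comp_const_add x t) (fun t => (hp (x + t)).comp_const_add x t)
    (fun t => (hp1 (x + t)).comp_const_add x t) (fun t => by simpa using hmax (x + t))
    (by simpa using hx0)
  have hleft := half_window_bound (p := fun t => p (x - t)) (p1 := fun t => -p1 (x - t))
    (w := fun t => w (x - t)) (W := fun t => -W (x - t)) hc hκ hδ hz
    (fun t => by simpa using ((hW (x - t)).comp_const_sub x t).fun_neg)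
    (fun t => (hp (x - t)).comp_const_sub x t)
    (fun t => by simpa using ((hp1 (x - t)).comp_const_sub x t).fun_neg)
    (fun t => by simpa using hmax (x - t)) (by simpa using hx0)
  refine ⟨x, W x - (p1 x / p x).im, ?_⟩
  have h_int : ∀ a b : ℝ, IntervalIntegrable (fun t => (W t - (W x - (p1 x / p x).im)) ^ 2)
      MeasureTheory.volume a b := fun a b =>
    ((hWc.sub continuous_const).pow 2).intervalIntegrable a b
  rw [← intervalIntegral.integral_add_adjacent_intervals (h_int (x - δ) x) (h_int x (x + δ))]
  have h1 : ∫ t in x..(x + δ), (W t - (W x - (p1 x / p x).im)) ^ 2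
      = ∫ t in (0 : ℝ)..δ, (W (x + t) - W (x + 0) + (p1 (x + 0) / p (x + 0)).im) ^ 2 := by
    have := intervalIntegral.integral_comp_add_left (a := 0) (b := δ)
      (fun t => (W t - (W x - (p1 x / p x).im)) ^ 2) x
    rw [add_zero] at this
    rw [← this]
    congr 1
    ext t
    simp only [add_zero]
    ring
  have h2 : ∫ t in (x - δ)..x, (W t - (W x - (p1 x / p x).im)) ^ 2
      = ∫ t in (0 : ℝ)..δ, (-W (x - t) - -W (x - 0) + (-p1 (x - 0) / p (x - 0)).im) ^ 2 := by
    have := intervalIntegral.integral_comp_sub_left (a := 0) (b := δ)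
      (fun t => (W t - (W x - (p1 x / p x).im)) ^ 2) x
    rw [sub_zero] at this
    rw [← this]
    congr 1
    ext t
    simp only [sub_zero, neg_div, Complex.neg_im]
    ring
  rw [h1, h2]
  linarith

lemma strictMonoOn_mul_tan : StrictMonoOn (fun x : ℝ => 36 * x * Real.tan x)
    (Set.Ico 0 (Real.pi / 2)) := by
  intro x hx y hy hxy
  have h1 : Real.tan x < Real.tan y := Real.tan_lt_tan_of_nonneg_of_lt_pi_div_two hx.1 hy.2 hxy
  have h2 : 0 ≤ Real.tan x := Real.tan_nonneg_of_nonneg_of_le_pi_div_two hx.1 hx.2.le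
  have h3 := hx.1
  dsimp only
  nlinarith

lemma phiInv_nonneg (r : ℝ) : 0 ≤ phiInv r :=
  Real.sSup_nonneg fun _ hx => hx.1.1

lemma phiInv_le {r z : ℝ} (hr : 0 ≤ r) (hz0 : 0 ≤ z)
    (hz : z < Real.pi / 2 → r ≤ 36 * z * Real.tan z) : phiInv r ≤ z := by
  refine csSup_le ⟨0, ⟨le_rfl, by positivity⟩, by simpa using hr⟩ fun x hx => ?_
  by_contra! hzx
  have h := strictMonoOn_mul_tan ⟨hz0, hzx.trans hx.1.2⟩ hx.1 hzx
  have := hz (hzx.trans hx.1.2)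
  have h2 := hx.2
  dsimp only at h
  linarith

lemma phiInv_pos {r : ℝ} (hr : 0 < r) : 0 < phiInv r := by
  have hcont : ContinuousAt (fun x : ℝ => 36 * x * Real.tan x) 0 := by
    have : ContinuousAt Real.tan 0 := Real.continuousAt_tan.2 (by simp)
    fun_prop
  have hev : ∀ᶠ x in nhdsWithin (0 : ℝ) (Set.Ioi 0), 36 * x * Real.tan x < r :=
    (hcont.eventually_lt continuousAt_const (by simpa using hr)).filter_mono nhdsWithin_le_nhds
  obtain ⟨x, hx, hx'⟩ := (hev.and
    (Ioo_mem_nhdsGT (show (0 : ℝ) < Real.pi / 2 by positivity))).exists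
  have hbdd : BddAbove {x : ℝ | x ∈ Set.Ico 0 (Real.pi / 2) ∧ 36 * x * Real.tan x ≤ r} :=
    ⟨Real.pi / 2, fun y hy => hy.1.2.le⟩
  exact hx'.1.trans_le (le_csSup hbdd ⟨⟨hx'.1.le, hx'.2⟩, hx.le⟩)

lemma omega1_le (δ x c₁ c₂ : ℝ) (hδ : 0 ≤ δ) (ψ : ℝ → ℝ) :
    omega1 δ ψ ≤ ∫ y in (x - δ)..(x + δ), (ψ y - c₁ - c₂ * y) ^ 2 := by
  refine csInf_le ⟨0, ?_⟩ ⟨x, c₁, c₂, rfl⟩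
  rintro r ⟨x, c₁, c₂, rfl⟩
  exact intervalIntegral.integral_nonneg (by linarith) fun _ _ => sq_nonneg _

open ComplexConjugate in
/-- Lower bound for the singular values of `∂² - (i (k u + l) / ν + c)`. -/
lemma phiInv_sq_div_le_of_eigenfunction {α C₁ : ℝ} (hα : 0 < α) (hC₁ : 0 < C₁) {u ψ : ℝ → ℝ}
    (hψ : ∀ y, HasDerivAt ψ (u y) y)
    (hlow : ∀ δ : ℝ, δ ∈ Set.Ioo (0 : ℝ) 1 → C₁ * δ ^ (2 * α + 3) ≤ omega1 δ ψ)
    {ν : ℝ} (hν : 0 < ν) {k : ℝ} (hk : k ≠ 0) (hνk : ν / |k| ≤ 1 / 2) {l c s : ℝ}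
    (hc : 0 ≤ c) (hs : 0 < s) {p p1 : ℝ → ℂ} (hp : ∀ t, HasDerivAt p (p1 t) t)
    (hp1 : ∀ t, HasDerivAt p1 ((Complex.I * (((k * u t + l) / ν : ℝ) : ℂ) + (c : ℂ)) * p t
      - (s : ℂ) * conj (p t)) t)
    (hper : Function.Periodic p (2 * Real.pi)) (hne : ∃ y, p y ≠ 0) :
    (phiInv C₁) ^ 2 * ν ^ (α / (α + 2)) * |k| ^ (2 / (α + 2)) ≤ ν * s := by
  have hk' : 0 < |k| := abs_pos.2 hk
  set r : ℝ := ν / |k| with hr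
  have hr0 : 0 < r := div_pos hν hk'
  have hr1 : r < 1 := by linarith
  set δ : ℝ := r ^ (1 / (α + 2)) with hδdef
  have hδ0 : 0 < δ := Real.rpow_pos_of_pos hr0 _
  have hδ1 : δ < 1 := Real.rpow_lt_one hr0.le hr1 (by positivity)
  have hδr : δ ^ (α + 2) = r := by
    rw [hδdef, ← Real.rpow_mul hr0.le, one_div_mul_cancel (by positivity), Real.rpow_one]
  set κ : ℝ := Real.sqrt s with hκdef
  have hκ : 0 < κ := Real.sqrt_pos.2 hs
  have hκs : κ ^ 2 = s := Real.sq_sqrt hs.le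
  have hz : phiInv C₁ ≤ κ * δ := by
    refine phiInv_le hC₁.le (by positivity) fun hz => ?_
    obtain ⟨x, c₁, hx⟩ := exists_window_bound (w := fun t => (k * u t + l) / ν)
      (W := fun t => (k * ψ t + l * t) / ν) hc hκ hδ0 hz
      (fun t => by
        simpa using (((hψ t).const_mul k).add ((hasDerivAt_id t).const_mul l)).div_const ν)
      hp (fun t => by
        convert hp1 t using 3
        rw [← hκs]; push_cast; rfl)
      (by positivity) hper hne
    have h1 := omega1_le δ x (ν / k * c₁) (-(l / k)) hδ0.le ψ
    have h2 : ∫ t in (x - δ)..(x + δ), ((k * ψ t + l * t) / ν - c₁) ^ 2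
        = (k / ν) ^ 2 * ∫ y in (x - δ)..(x + δ), (ψ y - ν / k * c₁ - -(l / k) * y) ^ 2 := by
      rw [← intervalIntegral.integral_const_mul]
      congr 1
      ext t
      field_simp
      ring
    have h3 := hlow δ ⟨hδ0, hδ1⟩
    have h4 : δ ^ (2 * α + 3) * δ = r ^ 2 := by
      rw [← hδr, ← Real.rpow_natCast, ← Real.rpow_mul hδ0.le]
      nth_rewrite 2 [← Real.rpow_one δ]
      rw [← Real.rpow_add hδ0]
      congr 1
      push_cast
      ring
    have h5 : (k / ν) ^ 2 * r ^ 2 = 1 := by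
      rw [hr, div_pow, div_pow, sq_abs]
      field_simp
    rw [h2] at hx
    calc C₁ = (k / ν) ^ 2 * (C₁ * δ ^ (2 * α + 3)) * δ := by
          linear_combination (-C₁) * h5 - C₁ * (k / ν) ^ 2 * h4
      _ ≤ (k / ν) ^ 2 * (∫ y in (x - δ)..(x + δ), (ψ y - ν / k * c₁ - -(l / k) * y) ^ 2) * δ := by
          gcongr
          exact h3.trans h1
      _ ≤ 36 * κ * Real.tan (κ * δ) * δ := by gcongr
      _ = 36 * (κ * δ) * Real.tan (κ * δ) := by ring
  have hscale : ν ^ (α / (α + 2)) * |k| ^ (2 / (α + 2)) * δ ^ 2 = ν := by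
    rw [hδdef, hr, ← Real.rpow_natCast, ← Real.rpow_mul (by positivity),
      Real.div_rpow hν.le hk'.le]
    have h1 : (1 / (α + 2) * ((2 : ℕ) : ℝ)) = 2 / (α + 2) := by push_cast; ring
    rw [h1]
    have h2 : |k| ^ (2 / (α + 2)) ≠ 0 := (Real.rpow_pos_of_pos hk' _).ne'
    have h3 : ν ^ (α / (α + 2)) * ν ^ (2 / (α + 2)) = ν := by
      rw [← Real.rpow_add hν, ← add_div, div_self (by positivity), Real.rpow_one]
    field_simp
    exact h3
  calc (phiInv C₁) ^ 2 * ν ^ (α / (α + 2)) * |k| ^ (2 / (α + 2))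
      ≤ (κ * δ) ^ 2 * ν ^ (α / (α + 2)) * |k| ^ (2 / (α + 2)) := by
        have := phiInv_nonneg C₁
        gcongr
    _ = ν * s := by rw [← hκs]; linear_combination κ ^ 2 * hscale

/-- `f` is a `P`-periodic solution of `f'' = q f + h`. -/
def IsPeriodicSol (P : ℝ) (q h f : ℝ → ℂ) : Prop :=
  Function.Periodic f P ∧ ∃ f1 : ℝ → ℂ, (∀ y, HasDerivAt f (f1 y) y) ∧
    ∀ y, HasDerivAt f1 (q y * f y + h y) y

namespace IsPeriodicSol

variable {P : ℝ} {q h h' f f' : ℝ → ℂ}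

lemma continuous (hf : IsPeriodicSol P q h f) : Continuous f := by
  obtain ⟨-, f1, h1, -⟩ := hf
  exact continuous_iff_continuousAt.2 fun t => (h1 t).continuousAt

lemma sub (hf : IsPeriodicSol P q h f) (hf' : IsPeriodicSol P q h' f') :
    IsPeriodicSol P q (h - h') (f - f') := by
  obtain ⟨hp, f1, h1, h2⟩ := hf
  obtain ⟨hp', f1', h1', h2'⟩ := hf'
  refine ⟨hp.sub hp', f1 - f1', fun y => (h1 y).sub (h1' y), fun y => ?_⟩
  refine ((h2 y).sub (h2' y)).congr_deriv ?_
  simp only [Pi.sub_apply]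
  ring

lemma add (hf : IsPeriodicSol P q h f) (hf' : IsPeriodicSol P q h' f') :
    IsPeriodicSol P q (h + h') (f + f') := by
  obtain ⟨hp, f1, h1, h2⟩ := hf
  obtain ⟨hp', f1', h1', h2'⟩ := hf'
  refine ⟨hp.add hp', f1 + f1', fun y => (h1 y).add (h1' y), fun y => ?_⟩
  refine ((h2 y).add (h2' y)).congr_deriv ?_
  simp only [Pi.add_apply]
  ring

lemma const_smul (hf : IsPeriodicSol P q h f) (a : ℂ) :
    IsPeriodicSol P q (a • h) (a • f) := by
  obtain ⟨hp, f1, h1, h2⟩ := hf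
  refine ⟨fun y => by simp [hp y], a • f1, fun y => (h1 y).const_smul a, fun y => ?_⟩
  refine ((h2 y).const_smul a).congr_deriv ?_
  simp only [Pi.smul_apply, smul_eq_mul]
  ring

lemma change_coeff (hf : IsPeriodicSol P q h f) (q' : ℝ → ℂ) :
    IsPeriodicSol P q' (fun y => h y + (q y - q' y) * f y) f := by
  obtain ⟨hp, f1, h1, h2⟩ := hf
  refine ⟨hp, f1, h1, fun y => ?_⟩
  refine (h2 y).congr_deriv ?_
  ring

end IsPeriodicSol

lemma periodic_of_hasDerivAt {P : ℝ} {f f1 : ℝ → ℂ} (hf : Function.Periodic f P)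
    (h1 : ∀ y, HasDerivAt f (f1 y) y) : Function.Periodic f1 P := fun y => by
  have h2 : HasDerivAt (fun t => f (t + P)) (f1 (y + P)) y := (h1 (y + P)).comp_add_const y P
  rw [show (fun t => f (t + P)) = f from funext hf] at h2
  exact h2.unique (h1 y)

lemma IsPeriodicSol.contDiff {P : ℝ} {q h f : ℝ → ℂ} (hf : IsPeriodicSol P q h f)
    (hq : Continuous q) (hh : Continuous h) : ContDiff ℝ 2 f := by
  have hfc := hf.continuous
  obtain ⟨-, f1, h1, h2⟩ := hf
  have hd : deriv f = f1 := funext fun y => (h1 y).deriv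
  have hd2 : deriv f1 = fun y => q y * f y + h y := funext fun y => (h2 y).deriv
  have hc1 : ContDiff ℝ 1 f1 := by
    rw [contDiff_one_iff_deriv, hd2]
    exact ⟨fun y => (h2 y).differentiableAt, by fun_prop⟩
  rw [show (2 : WithTop ℕ∞) = 1 + 1 by norm_num, contDiff_succ_iff_deriv]
  exact ⟨fun y => (h1 y).differentiableAt, by simp, by rwa [hd]⟩

/-- The function `f` solves its own equation. -/
lemma isPeriodicSol_of_contDiff {P : ℝ} {f : ℝ → ℂ} (q : ℝ → ℂ) (hf : ContDiff ℝ 2 f)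
    (hper : Function.Periodic f P) :
    IsPeriodicSol P q (fun y => deriv (deriv f) y - q y * f y) f := by
  have hf1 : ContDiff ℝ 1 (deriv f) := by
    rw [show (2 : WithTop ℕ∞) = 1 + 1 by norm_num, contDiff_succ_iff_deriv] at hf
    exact hf.2.2
  refine ⟨hper, deriv f, fun y => ((hf.differentiable (by norm_num)) y).hasDerivAt, fun y => ?_⟩
  refine ((hf1.differentiable (by norm_num)) y).hasDerivAt.congr_deriv ?_
  ring

open ComplexConjugate in
/-- Energy identity. -/
lemma energy_identity {P : ℝ} {w : ℝ → ℝ} {c : ℝ} {h f f1 : ℝ → ℂ}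
    (hh : Continuous h) (hper : Function.Periodic f P) (h1 : ∀ y, HasDerivAt f (f1 y) y)
    (h2 : ∀ y, HasDerivAt f1 ((Complex.I * (w y : ℂ) + (c : ℂ)) * f y + h y) y) :
    (∫ y in (0 : ℝ)..P, ‖f1 y‖ ^ 2) + c * (∫ y in (0 : ℝ)..P, ‖f y‖ ^ 2)
      + ∫ y in (0 : ℝ)..P, (conj (f y) * h y).re = 0 := by
  have hfc : Continuous f := continuous_iff_continuousAt.2 fun t => (h1 t).continuousAt
  have hf1c : Continuous f1 := continuous_iff_continuousAt.2 fun t => (h2 t).continuousAt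
  have hper1 := periodic_of_hasDerivAt hper h1
  have hder : ∀ y, HasDerivAt (fun y => (conj (f y) * f1 y).re)
      (‖f1 y‖ ^ 2 + c * ‖f y‖ ^ 2 + (conj (f y) * h y).re) y := fun y => by
    have h3 : HasDerivAt (fun y => conj (f y)) (conj (f1 y)) y :=
      (h1 y).star
    have h4 := Complex.reCLM.hasFDerivAt.comp_hasDerivAt y (h3.fun_mul (h2 y))
    refine h4.congr_deriv ?_
    simp only [Complex.sq_norm, Complex.normSq_apply, Complex.reCLM_apply]
    simp
    ring
  have h_int := intervalIntegral.integral_eq_sub_of_hasDerivAt (a := 0) (b := P)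
    (fun y _ => hder y) (by
      apply Continuous.intervalIntegrable
      fun_prop)
  rw [show f P = f 0 by simpa using hper 0, show f1 P = f1 0 by simpa using hper1 0, sub_self,
    intervalIntegral.integral_add, intervalIntegral.integral_add,
    intervalIntegral.integral_const_mul] at h_int
  · exact h_int
  all_goals
    apply Continuous.intervalIntegrable
    fun_prop

lemma eq_zero_of_integral_norm_sq_eq_zero {P : ℝ} (hP : 0 < P) {f : ℝ → ℂ} (hf : Continuous f)
    (hper : Function.Periodic f P) (h : ∫ y in (0 : ℝ)..P, ‖f y‖ ^ 2 = 0) : f = 0 := by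
  ext y
  obtain ⟨z, hz, hzy⟩ := hper.exists_mem_Ico₀ hP y
  rw [hzy]
  by_contra hne
  have hpos : 0 < ‖f z‖ ^ 2 := by
    have : 0 < ‖f z‖ := norm_pos_iff.2 hne
    positivity
  have := intervalIntegral.integral_pos hP (f := fun y => ‖f y‖ ^ 2) (by fun_prop)
    (fun _ _ => by positivity) ⟨z, Set.Ico_subset_Icc_self hz, hpos⟩
  linarith

lemma IsPeriodicSol.unique {P : ℝ} (hP : 0 < P) {w : ℝ → ℝ} {c : ℝ} {h f f' : ℝ → ℂ}
    (hc : 0 < c)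
    (hf : IsPeriodicSol P (fun y => Complex.I * (w y : ℂ) + (c : ℂ)) h f)
    (hf' : IsPeriodicSol P (fun y => Complex.I * (w y : ℂ) + (c : ℂ)) h f') : f = f' := by
  have hsub := hf.sub hf'
  have hcont := hsub.continuous
  rw [sub_self] at hsub
  obtain ⟨hper, f1, h1, h2⟩ := hsub
  have hE := energy_identity continuous_zero hper h1 h2
  have hn1 : 0 ≤ ∫ y in (0 : ℝ)..P, ‖f1 y‖ ^ 2 :=
    intervalIntegral.integral_nonneg hP.le fun _ _ => by positivity
  have hn2 : 0 ≤ ∫ y in (0 : ℝ)..P, ‖(f - f') y‖ ^ 2 :=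
    intervalIntegral.integral_nonneg hP.le fun _ _ => by positivity
  simp only [Pi.zero_apply, mul_zero, Complex.zero_re, intervalIntegral.integral_zero,
    add_zero] at hE
  have h0 : ∫ y in (0 : ℝ)..P, ‖(f - f') y‖ ^ 2 = 0 := by
    have : 0 ≤ c * ∫ y in (0 : ℝ)..P, ‖(f - f') y‖ ^ 2 := by positivity
    have h3 : c * ∫ y in (0 : ℝ)..P, ‖(f - f') y‖ ^ 2 = 0 := by linarith
    exact (mul_eq_zero.1 h3).resolve_left hc.ne'
  exact sub_eq_zero.1 (eq_zero_of_integral_norm_sq_eq_zero hP hcont hper h0)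

/-- Periodic solutions of `f' = h - a f`. -/
lemma exists_periodic_first_order {a P M : ℝ} (ha : a ≠ 0) (hP : 0 < P) {h : ℝ → ℂ}
    (hh : Continuous h) (hper : Function.Periodic h P) (hM : ∀ y, ‖h y‖ ≤ M) :
    ∃ f : ℝ → ℂ, Function.Periodic f P ∧ (∀ y, HasDerivAt f (h y - a * f y) y) ∧
      ∀ y, ‖f y‖ ≤ M / |a| := by
  set E : ℝ := 1 - Real.exp (-(a * P)) with hE
  have hE0 : E ≠ 0 := by
    rw [hE, sub_ne_zero, ne_comm, Ne, Real.exp_eq_one_iff, neg_eq_zero]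
    exact mul_ne_zero ha hP.ne'
  have hEa : 0 < E / a := by
    rcases lt_or_gt_of_ne ha with h0 | h0
    · refine div_pos_of_neg_of_neg ?_ h0
      have := Real.one_lt_exp_iff.2 (show 0 < -(a * P) by nlinarith)
      linarith
    · refine div_pos ?_ h0
      have := Real.exp_lt_one_iff.2 (show -(a * P) < 0 by nlinarith)
      linarith
  have hgc : Continuous fun z : ℝ => (Real.exp (a * z) : ℂ) * h z := by fun_prop
  set H : ℝ → ℂ := fun y => ∫ z in (0 : ℝ)..y, (Real.exp (a * z) : ℂ) * h z with hH
  have hHd : ∀ y, HasDerivAt H ((Real.exp (a * y) : ℂ) * h y) y := fun y =>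
    hgc.integral_hasStrictDerivAt 0 y |>.hasDerivAt
  have hHsub : ∀ y, H y - H (y - P) = ∫ z in (y - P)..y, (Real.exp (a * z) : ℂ) * h z := fun y =>
    intervalIntegral.integral_interval_sub_left (hgc.intervalIntegrable _ _)
      (hgc.intervalIntegrable _ _)
  have hexp : ∀ y, Real.exp (a * (y - P)) = Real.exp (a * y) * (1 - E) := fun y => by
    rw [hE, sub_sub_cancel, ← Real.exp_add]
    ring_nf
  have hcancel : ∀ y, Real.exp (-(a * y)) * Real.exp (a * y) = 1 := fun y => by
    rw [← Real.exp_add, neg_add_cancel, Real.exp_zero]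
  refine ⟨fun y => ((Real.exp (-(a * y)) / E : ℝ) : ℂ) * (H y - H (y - P)), fun y => ?_,
    fun y => ?_, fun y => ?_⟩
  · have h1 : H (y + P) - H (y + P - P) = (Real.exp (a * P) : ℂ) * (H y - H (y - P)) := by
      rw [hHsub, hHsub, ← intervalIntegral.integral_const_mul]
      have := intervalIntegral.integral_comp_add_right (a := y - P) (b := y)
        (fun z : ℝ => (Real.exp (a * z) : ℂ) * h z) P
      rw [show y + P - P = y - P + P by ring, ← this]
      congr 1
      ext z
      rw [hper z, mul_add, Real.exp_add]
      push_cast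
      ring
    dsimp only
    rw [h1, ← mul_assoc, ← Complex.ofReal_mul]
    congr 2
    rw [show -(a * y) = -(a * (y + P)) + a * P by ring, Real.exp_add]
    ring
  · have hd1 : HasDerivAt (fun y : ℝ => ((Real.exp (-(a * y)) / E : ℝ) : ℂ))
        ((Real.exp (-(a * y)) * (-a) / E : ℝ) : ℂ) y := by
      have := (((hasDerivAt_id y).const_mul a).neg.exp.div_const E).ofReal_comp
      simpa using this
    have hd := hd1.fun_mul ((hHd y).fun_sub ((hHd (y - P)).comp_sub_const y P))
    refine hd.congr_deriv ?_
    rw [hper.sub_eq, hexp]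
    have h3 : ((Real.exp (-(a * y)) / E : ℝ) : ℂ) * ((Real.exp (a * y) : ℂ) * h y
        - ((Real.exp (a * y) * (1 - E) : ℝ) : ℂ) * h y) = h y := by
      have : ((Real.exp (-(a * y)) / E * (Real.exp (a * y) * E) : ℝ) : ℂ) = 1 := by
        rw [show Real.exp (-(a * y)) / E * (Real.exp (a * y) * E)
          = Real.exp (-(a * y)) * Real.exp (a * y) by field_simp, hcancel, Complex.ofReal_one]
      push_cast at this ⊢
      linear_combination h y * this
    rw [h3]
    push_cast
    ring
  · have hM0 : 0 ≤ M := (norm_nonneg _).trans (hM 0)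
    have hb : ‖H y - H (y - P)‖ ≤ M * (Real.exp (a * y) * (E / a)) := by
      rw [hHsub]
      have h_int : ∫ z in (y - P)..y, Real.exp (a * z) = Real.exp (a * y) * (E / a) := by
        have hd : ∀ z : ℝ, HasDerivAt (fun z => Real.exp (a * z) / a) (Real.exp (a * z)) z :=
          fun z => by
            have := ((hasDerivAt_id z).const_mul a).exp.div_const a
            refine this.congr_deriv ?_
            simp [ha]
        rw [intervalIntegral.integral_eq_sub_of_hasDerivAt (fun z _ => hd z)
          (Continuous.intervalIntegrable (by fun_prop) _ _), hexp]
        ring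
      rw [← h_int, ← intervalIntegral.integral_const_mul]
      refine intervalIntegral.norm_integral_le_of_norm_le (by linarith) ?_
        (Continuous.intervalIntegrable (by fun_prop) _ _)
      refine Filter.Eventually.of_forall fun z _ => ?_
      rw [norm_mul, Complex.norm_real, Real.norm_eq_abs, Real.abs_exp, mul_comm]
      exact mul_le_mul_of_nonneg_right (hM z) (Real.exp_pos _).le
    rw [norm_mul, Complex.norm_real, Real.norm_eq_abs, abs_div, Real.abs_exp]
    calc Real.exp (-(a * y)) / |E| * ‖H y - H (y - P)‖
        ≤ Real.exp (-(a * y)) / |E| * (M * (Real.exp (a * y) * (E / a))) := by gcongr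
      _ = M * ((Real.exp (-(a * y)) * Real.exp (a * y)) * |E / a|) / |E| := by
          rw [abs_of_pos hEa]; ring
      _ = M / |a| := by
          rw [hcancel, abs_div]
          have := abs_ne_zero.2 hE0
          field_simp

lemma exists_isPeriodicSol_const {a P M : ℝ} (ha : 0 < a) (hP : 0 < P) {h : ℝ → ℂ}
    (hh : Continuous h) (hper : Function.Periodic h P) (hM : ∀ y, ‖h y‖ ≤ M) :
    ∃ f : ℝ → ℂ, IsPeriodicSol P (fun _ => ((a ^ 2 : ℝ) : ℂ)) h f ∧ ∀ y, ‖f y‖ ≤ M / a ^ 2 := by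
  obtain ⟨F, hFp, hFd, hFb⟩ := exists_periodic_first_order ha.ne' hP hh hper hM
  have hFc : Continuous F := continuous_iff_continuousAt.2 fun t => (hFd t).continuousAt
  obtain ⟨f, hfp, hfd, hfb⟩ := exists_periodic_first_order (neg_ne_zero.2 ha.ne') hP hFc hFp hFb
  refine ⟨f, ⟨hfp, _, hfd, fun y => ?_⟩, fun y => (hfb y).trans_eq ?_⟩
  · refine ((hFd y).fun_sub ((hfd y).const_mul (((-a : ℝ)) : ℂ))).congr_deriv ?_
    push_cast
    ring
  · rw [abs_neg, abs_of_pos ha, div_div, sq]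

lemma exists_continuousMap_lift {P : ℝ} {f : ℝ → ℂ} (hf : Continuous f)
    (hper : Function.Periodic f P) :
    ∃ F : C(AddCircle P, ℂ), ∀ y : ℝ, F (y : AddCircle P) = f y :=
  ⟨⟨hper.lift, continuous_coinduced_dom.2 hf⟩, fun _ => rfl⟩

lemma ContinuousMap.norm_le_of_coe {P M : ℝ} [Fact (0 < P)] (F : C(AddCircle P, ℂ)) (hM : 0 ≤ M)
    (h : ∀ y : ℝ, ‖F (y : AddCircle P)‖ ≤ M) : ‖F‖ ≤ M :=
  (ContinuousMap.norm_le _ hM).2 fun x => by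
    induction x using QuotientAddGroup.induction_on with
    | H z => exact h z

lemma exists_isPeriodicSol {P : ℝ} (hP : 0 < P) {w : ℝ → ℝ} {c : ℝ} (hc : 0 < c)
    (hw : Continuous w) (hwper : Function.Periodic w P) {h : ℝ → ℂ} (hh : Continuous h)
    (hper : Function.Periodic h P) :
    ∃ f, IsPeriodicSol P (fun y => Complex.I * (w y : ℂ) + (c : ℂ)) h f := by
  have : Fact (0 < P) := ⟨hP⟩
  obtain ⟨W, hW⟩ : ∃ W : ℝ, ∀ y, |w y| ≤ W := by
    obtain ⟨x, -, hx⟩ := (isCompact_Icc (a := (0 : ℝ)) (b := P)).exists_isMaxOn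
      ⟨0, le_rfl, hP.le⟩ hw.abs.continuousOn
    refine ⟨|w x|, fun t => ?_⟩
    obtain ⟨y, hy, hyt⟩ := hwper.exists_mem_Ico₀ hP t
    rw [hyt]
    exact hx (Set.Ico_subset_Icc_self hy)
  set A : ℝ := (c ^ 2 + W ^ 2) / c with hA
  have hA0 : 0 < A := by positivity
  have hAc : A * c = c ^ 2 + W ^ 2 := by rw [hA]; field_simp
  set a : ℝ := Real.sqrt A with ha
  have ha0 : 0 < a := Real.sqrt_pos.2 hA0
  have haA : a ^ 2 = A := Real.sq_sqrt hA0.le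
  set θ : ℝ := Real.sqrt (1 - c / A) with hθ
  have hcA : 0 ≤ 1 - c / A := by
    rw [sub_nonneg, div_le_one hA0, hA, le_div_iff₀ hc]
    nlinarith [sq_nonneg W]
  have hθ0 : 0 ≤ θ := Real.sqrt_nonneg _
  have hθ1 : θ < 1 := by
    rw [hθ, Real.sqrt_lt' one_pos]
    have : 0 < c / A := by positivity
    linarith
  set q : ℝ → ℂ := fun y => Complex.I * (w y : ℂ) + (c : ℂ) with hq
  have hqb : ∀ y, ‖q y - ((a ^ 2 : ℝ) : ℂ)‖ ≤ θ * A := fun y => by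
    refine abs_le_of_sq_le_sq' ?_ (by positivity) |>.2
    rw [Complex.sq_norm, Complex.normSq_apply, mul_pow, hθ, Real.sq_sqrt hcA, haA]
    have h1 : (1 - c / A) * A ^ 2 = A ^ 2 - A * c := by field_simp
    have h2 : w y ^ 2 ≤ W ^ 2 := sq_le_sq' (by linarith [abs_le.1 (hW y)]) (abs_le.1 (hW y)).2
    rw [h1]
    simp [hq]
    nlinarith
  have hqc : Continuous q := by fun_prop
  have hqper : Function.Periodic q P := fun y => by simp [hq, hwper y]
  have hstep : ∀ F : C(AddCircle P, ℂ), ∃ G : C(AddCircle P, ℂ),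
      IsPeriodicSol P (fun _ => ((a ^ 2 : ℝ) : ℂ))
        (fun y => h y + (q y - ((a ^ 2 : ℝ) : ℂ)) * F (y : AddCircle P))
        (fun y => G (y : AddCircle P)) := fun F => by
    have hgc : Continuous (fun y : ℝ => h y + (q y - ((a ^ 2 : ℝ) : ℂ)) * F (y : AddCircle P)) := by
      have : Continuous (fun y : ℝ => F (y : AddCircle P)) :=
        F.continuous.comp (AddCircle.continuous_mk' P)
      fun_prop
    have hgp : Function.Periodic
        (fun y : ℝ => h y + (q y - ((a ^ 2 : ℝ) : ℂ)) * F (y : AddCircle P)) P := fun y => by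
      simp [hper y, hqper y]
    obtain ⟨g, hg⟩ := exists_continuousMap_lift hgc hgp
    obtain ⟨f, hf, -⟩ := exists_isPeriodicSol_const ha0 hP hgc hgp (M := ‖g‖)
      (fun y => hg y ▸ g.norm_coe_le_norm y)
    obtain ⟨G, hG⟩ := exists_continuousMap_lift hf.continuous hf.1
    exact ⟨G, by simpa only [hG] using hf⟩
  choose Φ hΦ using hstep
  have hcontr : ContractingWith ⟨θ, hθ0⟩ Φ := by
    refine ⟨by exact_mod_cast hθ1, LipschitzWith.of_dist_le_mul fun F G => ?_⟩
    rw [dist_eq_norm, dist_eq_norm]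
    have hsub := (hΦ F).sub (hΦ G)
    have hsrc : ((fun y : ℝ => h y + (q y - ((a ^ 2 : ℝ) : ℂ)) * F (y : AddCircle P))
        - fun y : ℝ => h y + (q y - ((a ^ 2 : ℝ) : ℂ)) * G (y : AddCircle P))
        = fun y : ℝ => (q y - ((a ^ 2 : ℝ) : ℂ)) * (F - G) (y : AddCircle P) := by
      ext y
      simp only [Pi.sub_apply, ContinuousMap.sub_apply]
      ring
    rw [hsrc] at hsub
    have hgc : Continuous
        (fun y : ℝ => (q y - ((a ^ 2 : ℝ) : ℂ)) * (F - G) (y : AddCircle P)) := by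
      have : Continuous (fun y : ℝ => (F - G) (y : AddCircle P)) :=
        (F - G).continuous.comp (AddCircle.continuous_mk' P)
      fun_prop
    obtain ⟨f, hf, hfb⟩ := exists_isPeriodicSol_const ha0 hP hgc
      (fun y => by simp [hqper y]) (M := θ * A * ‖F - G‖) fun y => by
        rw [norm_mul]
        exact mul_le_mul (hqb y) ((F - G).norm_coe_le_norm y) (norm_nonneg _) (by positivity)
    have hfeq := IsPeriodicSol.unique hP (w := fun _ => 0) (c := a ^ 2)
      (by positivity) (by simpa using hsub) (by simpa using hf)
    refine ContinuousMap.norm_le_of_coe _ (by positivity) fun y => ?_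
    have h1 : (Φ F - Φ G) (y : AddCircle P) = f y := congrFun hfeq y
    rw [h1]
    refine (hfb y).trans_eq ?_
    rw [haA]
    change _ = θ * ‖F - G‖
    field_simp
  obtain ⟨F, hF, -⟩ := hcontr.exists_fixedPoint 0 (edist_ne_top _ _)
  refine ⟨fun y => F (y : AddCircle P), ?_⟩
  have h1 := hΦ F
  rw [hF.eq] at h1
  convert h1.change_coeff q using 1
  ext y
  ring

open Filter Topology in
/-- A nonzero compact symmetric operator on a (possibly incomplete) inner product space attains
its norm at an eigenvector of its square. -/
lemma LinearMap.IsSymmetric.exists_sq_eigenvector {E : Type*} [NormedAddCommGroup E]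
    [InnerProductSpace ℝ E] {M : E →ₗ[ℝ] E} (hM : M.IsSymmetric) {K : ℝ}
    (hK : ∀ x, ‖M x‖ ≤ K * ‖x‖)
    (hcomp : ∀ x : ℕ → E, (∀ n, ‖x n‖ ≤ 1) →
      ∃ (v : E) (φ : ℕ → ℕ), StrictMono φ ∧ Tendsto (fun n => M (x (φ n))) atTop (𝓝 v))
    (hne : ∃ x, M x ≠ 0) :
    ∃ μ : ℝ, 0 < μ ∧ (∀ x, ‖M x‖ ≤ μ * ‖x‖) ∧ ∃ v, v ≠ 0 ∧ M (M v) = μ ^ 2 • v := by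
  set L : E →L[ℝ] E := M.mkContinuous K hK with hL
  have hLM : ∀ x, L x = M x := fun x => rfl
  have hμ : 0 < ‖L‖ := by
    rw [norm_pos_iff]
    obtain ⟨x, hx⟩ := hne
    exact fun h => hx (by rw [← hLM, h]; rfl)
  refine ⟨‖L‖, hμ, fun x => L.le_opNorm x, ?_⟩
  have hex : ∀ n : ℕ, ∃ x : E, ‖x‖ ≤ 1 ∧ ‖L‖ - 1 / ((n : ℝ) + 1) < ‖L x‖ := fun n => by
    obtain ⟨x, hx, hx'⟩ := L.exists_lt_apply_of_lt_opNorm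
      (r := ‖L‖ - 1 / ((n : ℝ) + 1)) (by linarith [Nat.one_div_pos_of_nat (α := ℝ) (n := n)])
    exact ⟨x, hx.le, hx'⟩
  choose x hx1 hx2 using hex
  obtain ⟨v, φ, hφ, hv⟩ := hcomp x hx1
  have hnorm0 : Tendsto (fun n => ‖L (x n)‖) atTop (𝓝 ‖L‖) := by
    refine tendsto_of_tendsto_of_tendsto_of_le_of_le (g := fun n : ℕ => ‖L‖ - 1 / ((n : ℝ) + 1))
      (h := fun _ => ‖L‖) ?_ tendsto_const_nhds (fun n => (hx2 n).le) fun n => ?_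
    · simpa using tendsto_const_nhds.sub (tendsto_one_div_add_atTop_nhds_zero_nat (𝕜 := ℝ))
    · calc ‖L (x n)‖ ≤ ‖L‖ * ‖x n‖ := L.le_opNorm _
        _ ≤ ‖L‖ * 1 := by gcongr; exact hx1 n
        _ = ‖L‖ := mul_one _
  have hnorm : Tendsto (fun n => ‖L (x (φ n))‖) atTop (𝓝 ‖L‖) := hnorm0.comp hφ.tendsto_atTop
  have hvnorm : ‖v‖ = ‖L‖ := tendsto_nhds_unique hv.norm hnorm
  refine ⟨v, norm_pos_iff.1 (hvnorm ▸ hμ), ?_⟩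
  have hdefect : ∀ n, ‖L (L (x n)) - ‖L‖ ^ 2 • x n‖ ^ 2 ≤ ‖L‖ ^ 2 * (‖L‖ ^ 2 - ‖L (x n)‖ ^ 2) :=
    fun n => by
    rw [norm_sub_sq_real, inner_smul_right, hLM (L (x n)), hM (L (x n)) (x n), ← hLM, ← hLM,
      real_inner_self_eq_norm_sq, norm_smul, Real.norm_of_nonneg (by positivity)]
    have h1 : ‖L (L (x n))‖ ^ 2 ≤ (‖L‖ * ‖L (x n)‖) ^ 2 := by gcongr; exact L.le_opNorm _
    have h2 : ‖x n‖ ^ 2 ≤ 1 := pow_le_one₀ (norm_nonneg _) (hx1 n)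
    have h3 : ‖L‖ ^ 4 * ‖x n‖ ^ 2 ≤ ‖L‖ ^ 4 * 1 := by gcongr
    nlinarith
  have hdef0 : Tendsto (fun n => L (L (x (φ n))) - ‖L‖ ^ 2 • x (φ n)) atTop (𝓝 0) := by
    rw [tendsto_zero_iff_norm_tendsto_zero]
    have h1 : Tendsto (fun n => ‖L (L (x (φ n))) - ‖L‖ ^ 2 • x (φ n)‖ ^ 2) atTop (𝓝 0) := by
      refine squeeze_zero (fun n => by positivity) (fun n => hdefect (φ n)) ?_
      have := ((tendsto_const_nhds (x := ‖L‖ ^ 2)).sub (hnorm.pow 2)).const_mul (‖L‖ ^ 2)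
      rwa [sub_self, mul_zero] at this
    have h2 := h1.sqrt
    simpa [Real.sqrt_sq (norm_nonneg _)] using h2
  have hlim1 : Tendsto (fun n => L (L (L (x (φ n)))) - ‖L‖ ^ 2 • L (x (φ n))) atTop (𝓝 0) := by
    have := (L.continuous.tendsto 0).comp hdef0
    simpa [Function.comp_def] using this
  have hlim2 : Tendsto (fun n => L (L (L (x (φ n)))) - ‖L‖ ^ 2 • L (x (φ n))) atTop
      (𝓝 (L (L v) - ‖L‖ ^ 2 • v)) :=
    (((L.continuous.comp L.continuous).tendsto v).comp hv).sub (hv.const_smul _)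
  exact sub_eq_zero.1 (tendsto_nhds_unique hlim2 hlim1)

section PeriodicFunctions

open ComplexConjugate

/-- Continuous `P`-periodic functions, to be equipped with the `L²` inner product. -/
def periodicSubmodule (P : ℝ) : Submodule ℝ (ℝ → ℂ) where
  carrier := {f | Continuous f ∧ Function.Periodic f P}
  add_mem' hf hg := ⟨hf.1.add hg.1, hf.2.add hg.2⟩
  zero_mem' := ⟨continuous_const, fun _ => rfl⟩
  smul_mem' a _ hf := ⟨hf.1.const_smul a, fun y => by simp [hf.2 y]⟩

/-- A copy of `periodicSubmodule P` without its pointwise topology. -/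
def ContPer (P : ℝ) : Type := periodicSubmodule P

namespace ContPer

variable {P : ℝ}

noncomputable instance : AddCommGroup (ContPer P) :=
  inferInstanceAs (AddCommGroup (periodicSubmodule P))

noncomputable instance : Module ℝ (ContPer P) :=
  inferInstanceAs (Module ℝ (periodicSubmodule P))

/-- The underlying function. -/
def fn (f : ContPer P) : ℝ → ℂ := f.1

/-- Bundle a continuous periodic function. -/
def mk (f : ℝ → ℂ) (hf : Continuous f) (hper : Function.Periodic f P) : ContPer P := ⟨f, hf, hper⟩

@[simp] lemma fn_mk (f : ℝ → ℂ) (hf : Continuous f) (hper : Function.Periodic f P) :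
    (mk f hf hper).fn = f := rfl

lemma continuous_fn (f : ContPer P) : Continuous f.fn := f.2.1

lemma periodic_fn (f : ContPer P) : Function.Periodic f.fn P := f.2.2

lemma ext' {f g : ContPer P} (h : f.fn = g.fn) : f = g := Subtype.ext h

@[simp] lemma fn_add (f g : ContPer P) : (f + g).fn = f.fn + g.fn := rfl

@[simp] lemma fn_sub (f g : ContPer P) : (f - g).fn = f.fn - g.fn := rfl

@[simp] lemma fn_smul (a : ℝ) (f : ContPer P) : (a • f).fn = a • f.fn := rfl

@[simp] lemma fn_zero : (0 : ContPer P).fn = 0 := rfl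

lemma intervalIntegrable_mul {f g : ℝ → ℂ} (hf : Continuous f) (hg : Continuous g) (a b : ℝ) :
    IntervalIntegrable (fun y => (conj (f y) * g y).re) MeasureTheory.volume a b :=
  Continuous.intervalIntegrable (by fun_prop) a b

/-- The real part of the `L²` inner product. -/
noncomputable instance core [hP : Fact (0 < P)] : InnerProductSpace.Core ℝ (ContPer P) where
  inner f g := ∫ y in (0 : ℝ)..P, (conj (f.fn y) * g.fn y).re
  conj_inner_symm f g := by
    simp only [conj_trivial]
    congr 1
    ext y
    simp
    ring
  re_inner_nonneg f := by
    refine intervalIntegral.integral_nonneg hP.out.le fun y _ => ?_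
    simp only [Complex.mul_re, Complex.conj_re, Complex.conj_im]
    nlinarith [sq_nonneg (f.fn y).re, sq_nonneg (f.fn y).im]
  add_left f g h := by
    rw [← intervalIntegral.integral_add (intervalIntegrable_mul f.continuous_fn h.continuous_fn _ _)
      (intervalIntegrable_mul g.continuous_fn h.continuous_fn _ _)]
    congr 1
    ext y
    simp
    ring
  smul_left f g r := by
    rw [← intervalIntegral.integral_const_mul]
    congr 1
    ext y
    simp
    ring
  definite f h := by
    refine ext' (eq_zero_of_integral_norm_sq_eq_zero hP.out f.continuous_fn f.periodic_fn ?_)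
    rw [← h]
    congr 1
    ext y
    rw [Complex.sq_norm, Complex.normSq_apply]
    simp

noncomputable instance [Fact (0 < P)] : NormedAddCommGroup (ContPer P) :=
  InnerProductSpace.Core.toNormedAddCommGroup (𝕜 := ℝ)

noncomputable instance [Fact (0 < P)] : InnerProductSpace ℝ (ContPer P) :=
  InnerProductSpace.ofCore core.toCore

lemma inner_def [Fact (0 < P)] (f g : ContPer P) :
    inner ℝ f g = ∫ y in (0 : ℝ)..P, (conj (f.fn y) * g.fn y).re := rfl

lemma norm_sq_def [Fact (0 < P)] (f : ContPer P) :
    ‖f‖ ^ 2 = ∫ y in (0 : ℝ)..P, ‖f.fn y‖ ^ 2 := by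
  rw [← real_inner_self_eq_norm_sq, inner_def]
  congr 1
  ext y
  rw [Complex.sq_norm, Complex.normSq_apply]
  simp

lemma norm_eq_l2norm [Fact (0 < 2 * Real.pi)] (f : ContPer (2 * Real.pi)) : ‖f‖ = l2norm f.fn := by
  rw [l2norm, ← norm_sq_def, Real.sqrt_sq (norm_nonneg _)]

/-- Complex conjugation. -/
noncomputable def conjFn (f : ContPer P) : ContPer P :=
  mk (fun y => conj (f.fn y)) (by have := f.continuous_fn; fun_prop) fun y => by
    simp only [f.periodic_fn y]

@[simp] lemma fn_conjFn (f : ContPer P) : f.conjFn.fn = fun y => conj (f.fn y) := rfl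

lemma norm_conjFn [Fact (0 < P)] (f : ContPer P) : ‖f.conjFn‖ = ‖f‖ := by
  rw [← sq_eq_sq₀ (norm_nonneg _) (norm_nonneg _), norm_sq_def, norm_sq_def]
  simp

end ContPer

section Resolvent

variable {P : ℝ} [hP : Fact (0 < P)] {w : ℝ → ℝ} {c : ℝ} {h f f1 : ℝ → ℂ}

lemma energy_bound (hc : 0 < c) (F H : ContPer P) (h1 : ∀ y, HasDerivAt F.fn (f1 y) y)
    (h2 : ∀ y, HasDerivAt f1 ((Complex.I * (w y : ℂ) + (c : ℂ)) * F.fn y + H.fn y) y) :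
    ‖F‖ ≤ c⁻¹ * ‖H‖ ∧ ∫ y in (0 : ℝ)..P, ‖f1 y‖ ^ 2 ≤ c⁻¹ * ‖H‖ ^ 2 := by
  have hE := energy_identity H.continuous_fn F.periodic_fn h1 h2
  rw [← ContPer.norm_sq_def, ← ContPer.inner_def] at hE
  have hi := abs_le.1 (abs_real_inner_le_norm F H)
  have hn1 : 0 ≤ ∫ y in (0 : ℝ)..P, ‖f1 y‖ ^ 2 :=
    intervalIntegral.integral_nonneg hP.out.le fun _ _ => by positivity
  have hF : ‖F‖ ≤ c⁻¹ * ‖H‖ := by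
    rcases (norm_nonneg F).eq_or_lt with h0 | h0
    · rw [← h0]; positivity
    · rw [le_inv_mul_iff₀ hc]
      refine le_of_mul_le_mul_left ?_ h0
      nlinarith
  refine ⟨hF, ?_⟩
  have h3 : ‖F‖ * ‖H‖ ≤ c⁻¹ * ‖H‖ * ‖H‖ := by gcongr
  nlinarith [mul_nonneg hc.le (sq_nonneg ‖F‖)]

lemma inner_symm_of_solutions {q : ℝ → ℂ} (F G F' G' : ContPer P)
    (hF : IsPeriodicSol P q (fun y => conj (F.fn y)) F'.fn)
    (hG : IsPeriodicSol P q (fun y => conj (G.fn y)) G'.fn) :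
    inner ℝ F' G = inner ℝ F G' := by
  obtain ⟨hp, f1, h1, h2⟩ := hF
  obtain ⟨hp', g1, h1', h2'⟩ := hG
  have hder : ∀ y, HasDerivAt (fun y => (F'.fn y * g1 y - f1 y * G'.fn y).re)
      ((conj (F'.fn y) * G.fn y).re - (conj (F.fn y) * G'.fn y).re) y := fun y => by
    have h4 := Complex.reCLM.hasFDerivAt.comp_hasDerivAt y
      (((h1 y).fun_mul (h2' y)).fun_sub ((h2 y).fun_mul (h1' y)))
    refine h4.congr_deriv ?_
    simp
    ring
  have h_int := intervalIntegral.integral_eq_sub_of_hasDerivAt (a := 0) (b := P)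
    (fun y _ => hder y)
    ((ContPer.intervalIntegrable_mul F'.continuous_fn G.continuous_fn _ _).sub
      (ContPer.intervalIntegrable_mul F.continuous_fn G'.continuous_fn _ _))
  rw [intervalIntegral.integral_sub
    (ContPer.intervalIntegrable_mul F'.continuous_fn G.continuous_fn _ _)
    (ContPer.intervalIntegrable_mul F.continuous_fn G'.continuous_fn _ _),
    ← ContPer.inner_def, ← ContPer.inner_def] at h_int
  have e1 : F'.fn P = F'.fn 0 := by simpa using hp 0
  have e2 : G'.fn P = G'.fn 0 := by simpa using hp' 0
  have e3 : f1 P = f1 0 := by simpa using periodic_of_hasDerivAt hp h1 0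
  have e4 : g1 P = g1 0 := by simpa using periodic_of_hasDerivAt hp' h1' 0
  rw [e1, e2, e3, e4, sub_self] at h_int
  linarith

end Resolvent

end PeriodicFunctions

section SingularValues

open ComplexConjugate

lemma norm_sub_le_sqrt_mul {P B : ℝ} {f f1 : ℝ → ℂ} (hper : Function.Periodic f P)
    (h1 : ∀ y, HasDerivAt f (f1 y) y) (hc1 : Continuous f1)
    (hB : ∫ y in (0 : ℝ)..P, ‖f1 y‖ ^ 2 ≤ B) {x y : ℝ} (hxy : |x - y| ≤ P) :
    ‖f x - f y‖ ≤ Real.sqrt |x - y| * ((1 + B) / 2) := by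
  wlog hlt : y < x generalizing x y
  · rcases (not_lt.1 hlt).eq_or_lt with h | h
    · simp [h]
    · rw [norm_sub_rev, abs_sub_comm]
      exact this (by rwa [abs_sub_comm]) h
  have hd : 0 < x - y := sub_pos.2 hlt
  rw [abs_of_pos hd] at hxy ⊢
  set η : ℝ := Real.sqrt (x - y) with hη
  have hη0 : 0 < η := Real.sqrt_pos.2 hd
  have hη2 : η * η = x - y := Real.mul_self_sqrt hd.le
  have h_int : ∀ a b, IntervalIntegrable (fun t => ‖f1 t‖ ^ 2) MeasureTheory.volume a b :=
    fun a b => (hc1.norm.pow 2).intervalIntegrable a b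
  have hsub : ∫ t in y..x, ‖f1 t‖ ^ 2 ≤ B := by
    have hp : Function.Periodic (fun t => ‖f1 t‖ ^ 2) P := fun t => by
      simp only [periodic_of_hasDerivAt hper h1 t]
    have h2 := hp.intervalIntegral_add_eq y 0
    rw [zero_add] at h2
    rw [← intervalIntegral.integral_add_adjacent_intervals (h_int y x) (h_int x (y + P))] at h2
    have h3 : 0 ≤ ∫ t in x..(y + P), ‖f1 t‖ ^ 2 :=
      intervalIntegral.integral_nonneg (by linarith) fun _ _ => by positivity
    linarith
  rw [← intervalIntegral.integral_eq_sub_of_hasDerivAt (fun t _ => h1 t)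
    (hc1.intervalIntegrable y x)]
  calc ‖∫ t in y..x, f1 t‖ ≤ ∫ t in y..x, (η / 2 * ‖f1 t‖ ^ 2 + 1 / (2 * η)) := by
        refine intervalIntegral.norm_integral_le_of_norm_le hlt.le
          (Filter.Eventually.of_forall fun t _ => ?_)
          (((h_int y x).const_mul _).add intervalIntegrable_const)
        have h4 : η / 2 * ‖f1 t‖ ^ 2 + 1 / (2 * η) - ‖f1 t‖ = (η * ‖f1 t‖ - 1) ^ 2 / (2 * η) := by
          field_simp
          ring
        have : 0 ≤ (η * ‖f1 t‖ - 1) ^ 2 / (2 * η) := by positivity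
        linarith
    _ = η / 2 * (∫ t in y..x, ‖f1 t‖ ^ 2) + (x - y) * (1 / (2 * η)) := by
        rw [intervalIntegral.integral_add ((h_int y x).const_mul _) intervalIntegrable_const,
          intervalIntegral.integral_const_mul, intervalIntegral.integral_const, smul_eq_mul]
    _ ≤ η / 2 * B + (x - y) * (1 / (2 * η)) := by gcongr
    _ = η * ((1 + B) / 2) := by
        rw [← hη2]
        field_simp
        ring

lemma AddCircle.exists_coe_abs_sub_eq_dist {P : ℝ} (hP : 0 < P) (X Y : AddCircle P) :
    ∃ x y : ℝ, (x : AddCircle P) = X ∧ (y : AddCircle P) = Y ∧ |x - y| = dist X Y ∧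
      |x - y| ≤ P := by
  induction Y using QuotientAddGroup.induction_on with
  | H y =>
    obtain ⟨z, hz⟩ := QuotientAddGroup.mk_surjective (X - (y : AddCircle P))
    have hzn : |z - round (P⁻¹ * z) * P| = ‖X - (y : AddCircle P)‖ := by
      rw [← hz, ← AddCircle.norm_eq]
    refine ⟨y + (z - round (P⁻¹ * z) * P), y, ?_, rfl, ?_, ?_⟩
    · have h1 : ((round (P⁻¹ * z) * P : ℝ) : AddCircle P) = 0 := by
        rw [AddCircle.coe_eq_zero_iff]
        exact ⟨round (P⁻¹ * z), by simp⟩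
      have hz' : (z : AddCircle P) = X - (y : AddCircle P) := hz
      rw [AddCircle.coe_add, AddCircle.coe_sub, h1, sub_zero, hz', add_sub_cancel]
    · rw [add_sub_cancel_left, hzn, dist_eq_norm]
    · rw [add_sub_cancel_left, hzn]
      refine (AddCircle.norm_le_half_period P hP.ne').trans ?_
      rw [abs_of_pos hP]
      linarith

open Filter Topology in
lemma ContPer.exists_tendsto_subseq {P : ℝ} [hP : Fact (0 < P)] {B : ℝ} (F : ℕ → ContPer P)
    (f1 : ℕ → ℝ → ℂ) (h1 : ∀ n y, HasDerivAt (F n).fn (f1 n y) y) (hc1 : ∀ n, Continuous (f1 n))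
    (hB : ∀ n, ‖F n‖ ^ 2 ≤ B) (hB1 : ∀ n, ∫ y in (0 : ℝ)..P, ‖f1 n y‖ ^ 2 ≤ B) :
    ∃ (v : ContPer P) (φ : ℕ → ℕ), StrictMono φ ∧ Tendsto (fun n => F (φ n)) atTop (𝓝 v) := by
  have hB0 : 0 ≤ B := (sq_nonneg _).trans (hB 0)
  have hmod : ∀ n (x y : ℝ), |x - y| ≤ P →
      ‖(F n).fn x - (F n).fn y‖ ≤ Real.sqrt |x - y| * ((1 + B) / 2) := fun n x y hxy =>
    norm_sub_le_sqrt_mul (F n).periodic_fn (h1 n) (hc1 n) (hB1 n) hxy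
  obtain ⟨R, hR⟩ : ∃ R : ℝ, ∀ n x, ‖(F n).fn x‖ ≤ R := by
    refine ⟨(P * (1 / 2 + Real.sqrt P * ((1 + B) / 2)) + B / 2) / P, fun n x => ?_⟩
    obtain ⟨x', hx', hxx⟩ := (F n).periodic_fn.exists_mem_Ico₀ hP.out x
    rw [hxx, le_div_iff₀ hP.out]
    have hpt : ∀ y ∈ Set.Icc 0 P, ‖(F n).fn x'‖
        ≤ (1 / 2 + Real.sqrt P * ((1 + B) / 2)) + 1 / 2 * ‖(F n).fn y‖ ^ 2 := fun y hy => by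
      have hxy : |x' - y| ≤ P := abs_le.2 ⟨by linarith [hx'.1, hy.2], by linarith [hx'.2, hy.1]⟩
      have h2 := hmod n x' y hxy
      have h3 : Real.sqrt |x' - y| * ((1 + B) / 2) ≤ Real.sqrt P * ((1 + B) / 2) := by gcongr
      have h4 := norm_le_norm_add_norm_sub' ((F n).fn x') ((F n).fn y)
      nlinarith [sq_nonneg (‖(F n).fn y‖ - 1)]
    have hsq : IntervalIntegrable (fun y => ‖(F n).fn y‖ ^ 2) MeasureTheory.volume 0 P :=
      ((F n).continuous_fn.norm.pow 2).intervalIntegrable _ _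
    have h5 := intervalIntegral.integral_mono_on hP.out.le
      (intervalIntegrable_const (μ := MeasureTheory.volume))
      (intervalIntegrable_const.add (hsq.const_mul (1 / 2))) hpt
    rw [intervalIntegral.integral_add intervalIntegrable_const (hsq.const_mul (1 / 2)),
      intervalIntegral.integral_const_mul, ← ContPer.norm_sq_def,
      intervalIntegral.integral_const, intervalIntegral.integral_const, sub_zero, smul_eq_mul,
      smul_eq_mul] at h5
    linarith [hB n]
  have hlift : ∀ n, ∃ G : C(AddCircle P, ℂ), ∀ y : ℝ, G (y : AddCircle P) = (F n).fn y := fun n =>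
    exists_continuousMap_lift (F n).continuous_fn (F n).periodic_fn
  choose G hG using hlift
  set A : Set (BoundedContinuousFunction (AddCircle P) ℂ) :=
    Set.range fun n => BoundedContinuousFunction.mkOfCompact (G n) with hA
  have hcpt : IsCompact (closure A) := by
    refine BoundedContinuousFunction.arzela_ascoli (Metric.closedBall 0 R)
      (isCompact_closedBall 0 R) A ?_ ?_
    · rintro _ x ⟨n, rfl⟩
      induction x using QuotientAddGroup.induction_on with
      | H y =>
        rw [mem_closedBall_zero_iff]
        change ‖G n (y : AddCircle P)‖ ≤ R
        rw [hG]
        exact hR n y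
    · refine Metric.equicontinuous_of_continuity_modulus
        (fun d => Real.sqrt d * ((1 + B) / 2)) ?_ _ ?_
      · have : Continuous fun d : ℝ => Real.sqrt d * ((1 + B) / 2) := by fun_prop
        simpa using this.tendsto 0
      · rintro X Y ⟨_, n, rfl⟩
        obtain ⟨x, y, rfl, rfl, hd, hle⟩ := AddCircle.exists_coe_abs_sub_eq_dist hP.out X Y
        change dist (G n (x : AddCircle P)) (G n (y : AddCircle P)) ≤ _
        rw [hG, hG, dist_eq_norm, ← hd]
        exact hmod n x y hle
  obtain ⟨V, -, φ, hφ, hlim⟩ := hcpt.tendsto_subseq (x := fun n =>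
    BoundedContinuousFunction.mkOfCompact (G n)) fun n => subset_closure ⟨n, rfl⟩
  refine ⟨ContPer.mk (fun y : ℝ => V (y : AddCircle P))
    (V.continuous.comp (AddCircle.continuous_mk' P)) fun y => by simp, φ, hφ, ?_⟩
  rw [tendsto_iff_norm_sub_tendsto_zero] at hlim ⊢
  have hle : ∀ n, ‖F (φ n) - ContPer.mk (fun y : ℝ => V (y : AddCircle P))
      (V.continuous.comp (AddCircle.continuous_mk' P)) (fun y => by simp)‖
      ≤ Real.sqrt P * ‖BoundedContinuousFunction.mkOfCompact (G (φ n)) - V‖ := fun n => by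
    refine abs_le_of_sq_le_sq' ?_ (by positivity) |>.2
    rw [ContPer.norm_sq_def, mul_pow, Real.sq_sqrt hP.out.le]
    have hbd : ∀ y ∈ Set.Icc 0 P, ‖(F (φ n) - ContPer.mk (fun y : ℝ => V (y : AddCircle P))
        (V.continuous.comp (AddCircle.continuous_mk' P)) (fun y => by simp)).fn y‖ ^ 2
        ≤ ‖BoundedContinuousFunction.mkOfCompact (G (φ n)) - V‖ ^ 2 := fun y _ => by
      gcongr
      have := (BoundedContinuousFunction.mkOfCompact (G (φ n)) - V).norm_coe_le_norm
        (y : AddCircle P)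
      change ‖(F (φ n)).fn y - V (y : AddCircle P)‖ ≤ _
      simpa [hG] using this
    have h6 := intervalIntegral.integral_mono_on hP.out.le
      (((ContPer.continuous_fn _).norm.pow 2).intervalIntegrable _ _)
      (intervalIntegrable_const (μ := MeasureTheory.volume)) hbd
    simpa using h6
  refine squeeze_zero (fun n => norm_nonneg _) hle ?_
  simpa [Function.comp_def] using hlim.const_mul (Real.sqrt P)

open Filter Topology in
/-- Lower bound for `∂² - (i w + c)` from a lower bound for its singular values. -/
lemma IsPeriodicSol.mul_norm_le_of_pos {P : ℝ} [hP : Fact (0 < P)] {w : ℝ → ℝ} (hw : Continuous w)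
    (hwper : Function.Periodic w P) {c s₀ : ℝ} (hc : 0 < c)
    (heig : ∀ (s : ℝ) (p : ℝ → ℂ), 0 < s → p ≠ 0 →
      IsPeriodicSol P (fun y => Complex.I * (w y : ℂ) + (c : ℂ))
        (fun y => -((s : ℂ) * conj (p y))) p → s₀ ≤ s)
    (F H : ContPer P)
    (hF : IsPeriodicSol P (fun y => Complex.I * (w y : ℂ) + (c : ℂ)) H.fn F.fn) :
    s₀ * ‖F‖ ≤ ‖H‖ := by
  set q : ℝ → ℂ := fun y => Complex.I * (w y : ℂ) + (c : ℂ) with hq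
  have hex : ∀ h : ContPer P, ∃ g : ContPer P, IsPeriodicSol P q (fun y => conj (h.fn y)) g.fn :=
    fun h => by
    obtain ⟨f, hf⟩ := exists_isPeriodicSol hP.out hc hw hwper h.conjFn.continuous_fn
      h.conjFn.periodic_fn
    exact ⟨ContPer.mk f hf.continuous hf.1, hf⟩
  choose S hS using hex
  have huniq : ∀ {h g g' : ContPer P}, IsPeriodicSol P q (fun y => conj (h.fn y)) g.fn →
      IsPeriodicSol P q (fun y => conj (h.fn y)) g'.fn → g = g' := fun h1 h2 =>
    ContPer.ext' (IsPeriodicSol.unique hP.out hc h1 h2)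
  let M : ContPer P →ₗ[ℝ] ContPer P :=
    { toFun := S
      map_add' := fun h h' => huniq (hS (h + h')) (by
        convert (hS h).add (hS h') using 1
        · ext y
          simp
        · rfl)
      map_smul' := fun a h => huniq (hS (a • h)) (by
        convert (hS h).const_smul (a : ℂ) using 1
        · ext y
          simp
        · ext y
          simp) }
  have hMS : ∀ h, M h = S h := fun _ => rfl
  have hsymm : M.IsSymmetric := fun h g => inner_symm_of_solutions h g (M h) (M g) (hS h) (hS g)
  have hbound : ∀ h, ‖M h‖ ≤ c⁻¹ * ‖h‖ := fun h => by
    obtain ⟨-, f1, h1, h2⟩ := hS h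
    have := (energy_bound hc (S h) h.conjFn h1 h2).1
    rwa [ContPer.norm_conjFn] at this
  have hcomp : ∀ x : ℕ → ContPer P, (∀ n, ‖x n‖ ≤ 1) →
      ∃ (v : ContPer P) (φ : ℕ → ℕ), StrictMono φ ∧
        Tendsto (fun n => M (x (φ n))) atTop (𝓝 v) := fun x hx => by
    choose f1 h1 h2 using fun n => (hS (x n)).2
    refine ContPer.exists_tendsto_subseq (B := max ((c⁻¹) ^ 2) (c⁻¹)) (fun n => M (x n)) f1 h1
      (fun n => continuous_iff_continuousAt.2 fun t => (h2 n t).continuousAt)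
      (fun n => le_max_of_le_left ?_) fun n => le_max_of_le_right ?_
    · have h3 : ‖M (x n)‖ ≤ c⁻¹ := (hbound (x n)).trans
        (mul_le_of_le_one_right (by positivity) (hx n))
      gcongr
    · have h3 := (energy_bound hc (S (x n)) (x n).conjFn (h1 n) (h2 n)).2
      rw [ContPer.norm_conjFn] at h3
      exact h3.trans (mul_le_of_le_one_right (by positivity)
        (pow_le_one₀ (norm_nonneg _) (hx n)))
  have hFM : F = M H.conjFn := huniq (h := H.conjFn) (by simpa using hF) (hS _)
  by_cases hne : ∃ x, M x ≠ 0
  · obtain ⟨μ, hμ, hμM, v, hv, hMMv⟩ := hsymm.exists_sq_eigenvector hbound hcomp hne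
    have hle : s₀ ≤ μ⁻¹ := by
      have hsol : ∀ (x : ContPer P) (a : ℝ) (b : ℂ), x ≠ 0 → a ≠ 0 → b ≠ 0 → M x = a • x →
          b * (a : ℂ)⁻¹ = -((μ⁻¹ : ℝ) : ℂ) * conj b → s₀ ≤ μ⁻¹ := fun x a b hx ha hb hMx hab => by
        refine heig μ⁻¹ (b • x.fn) (by positivity) ?_ ?_
        · intro h0
          exact hx (ContPer.ext' ((smul_eq_zero.1 h0).resolve_left hb))
        · have h1 := (hS x).const_smul (b * (a : ℂ)⁻¹)
          rw [← hMS, hMx] at h1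
          have ha' : (a : ℂ) ≠ 0 := by exact_mod_cast ha
          convert h1 using 1
          · ext y
            simp only [Pi.smul_apply, smul_eq_mul, map_mul, hab]
            ring
          · ext y
            simp only [Pi.smul_apply, smul_eq_mul, ContPer.fn_smul, Complex.real_smul]
            field_simp
      by_cases hp : M v + μ • v = 0
      · refine hsol v (-μ) 1 hv (neg_ne_zero.2 hμ.ne') one_ne_zero ?_ ?_
        · rw [neg_smul]
          exact eq_neg_of_add_eq_zero_left hp
        · push_cast
          simp [inv_neg]
      · refine hsol (M v + μ • v) μ Complex.I hp hμ.ne' Complex.I_ne_zero ?_ ?_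
        · rw [map_add, map_smul, hMMv, smul_add, smul_smul, add_comm, sq]
        · simp
          ring
    rw [hFM]
    calc s₀ * ‖M H.conjFn‖ ≤ μ⁻¹ * (μ * ‖H.conjFn‖) := by
          gcongr
          exact hμM _
      _ = ‖H‖ := by rw [ContPer.norm_conjFn, inv_mul_cancel_left₀ hμ.ne']
  · push Not at hne
    rw [hFM, hne, norm_zero, mul_zero]
    exact norm_nonneg _

lemma IsPeriodicSol.mul_norm_le {P : ℝ} [hP : Fact (0 < P)] {w : ℝ → ℝ} (hw : Continuous w)
    (hwper : Function.Periodic w P) {c s₀ : ℝ} (hc : 0 ≤ c)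
    (heig : ∀ (c' s : ℝ) (p : ℝ → ℂ), 0 < c' → 0 < s → p ≠ 0 →
      IsPeriodicSol P (fun y => Complex.I * (w y : ℂ) + (c' : ℂ))
        (fun y => -((s : ℂ) * conj (p y))) p → s₀ ≤ s)
    (F H : ContPer P)
    (hF : IsPeriodicSol P (fun y => Complex.I * (w y : ℂ) + (c : ℂ)) H.fn F.fn) :
    s₀ * ‖F‖ ≤ ‖H‖ := by
  have hη : ∀ η : ℝ, 0 < η → s₀ * ‖F‖ ≤ ‖H‖ + η * ‖F‖ := fun η hη => by
    have h1 := IsPeriodicSol.mul_norm_le_of_pos hw hwper (c := c + η) (by positivity)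
      (fun s p hs hp h => heig _ s p (by positivity) hs hp h) F (H - η • F) (by
        convert hF.change_coeff (fun y => Complex.I * (w y : ℂ) + ((c + η : ℝ) : ℂ)) using 1
        ext y
        simp
        ring)
    refine h1.trans ((norm_sub_le _ _).trans_eq ?_)
    rw [norm_smul, Real.norm_of_nonneg hη.le]
  by_contra! hlt
  have hpos : 0 < ‖F‖ := by
    rcases (norm_nonneg F).eq_or_lt with h | h
    · rw [← h, mul_zero] at hlt
      exact absurd hlt (norm_nonneg H).not_gt
    · exact h
  have h2 := hη ((s₀ * ‖F‖ - ‖H‖) / (2 * ‖F‖)) (div_pos (by linarith) (by positivity))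
  have h3 : (s₀ * ‖F‖ - ‖H‖) / (2 * ‖F‖) * ‖F‖ = (s₀ * ‖F‖ - ‖H‖) / 2 := by field_simp
  linarith

end SingularValues

section VectorFourier

variable {E F : Type*} [NormedAddCommGroup E] [NormedSpace ℂ E] [CompleteSpace E]
  [NormedAddCommGroup F] [NormedSpace ℂ F] [CompleteSpace F]

lemma ContinuousLinearMap.map_fourierCoeffOn (A : E →L[ℂ] F) {a b : ℝ} (hab : a < b) {φ : ℝ → E}
    (hφ : Continuous φ) (n : ℤ) :
    A (fourierCoeffOn hab φ n) = fourierCoeffOn hab (fun t => A (φ t)) n := by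
  rw [fourierCoeffOn_eq_integral, fourierCoeffOn_eq_integral]
  have hc : Continuous fun x : ℝ => fourier (-n) (x : AddCircle (b - a)) • φ x :=
    ((fourier (-n)).continuous.comp (AddCircle.continuous_mk' _)).smul hφ
  rw [show (1 / (b - a)) • (∫ x in a..b, fourier (-n) (x : AddCircle (b - a)) • φ x)
    = ((1 / (b - a) : ℝ) : ℂ) • ∫ x in a..b, fourier (-n) (x : AddCircle (b - a)) • φ x from
      (Complex.coe_smul _ _).symm, map_smul,
    ← A.intervalIntegral_comp_comm (hc.intervalIntegrable a b), Complex.coe_smul]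
  simp only [map_smul]

end VectorFourier

lemma Continuous.memLp_two_restrict_Ioc {E : Type*} [NormedAddCommGroup E] {f : ℝ → E}
    (hf : Continuous f) (a b : ℝ) :
    MeasureTheory.MemLp f 2 (MeasureTheory.volume.restrict (Set.Ioc a b)) := by
  obtain ⟨C, hC⟩ := (isCompact_Icc (a := a) (b := b)).exists_bound_of_continuousOn hf.continuousOn
  refine MeasureTheory.MemLp.of_bound
    (hf.aestronglyMeasurable) C ?_
  filter_upwards [MeasureTheory.ae_restrict_mem measurableSet_Ioc] with x hx
  exact hC x (Set.Ioc_subset_Icc_self hx)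

/-- Parseval's identity with values in a finite-dimensional space. -/
lemma hasSum_sq_norm_fourierCoeffOn {V : Type*} [NormedAddCommGroup V] [InnerProductSpace ℂ V]
    [FiniteDimensional ℂ V] {a b : ℝ} (hab : a < b) {φ : ℝ → V} (hφ : Continuous φ) :
    HasSum (fun n => ‖fourierCoeffOn hab φ n‖ ^ 2) ((b - a)⁻¹ • ∫ t in a..b, ‖φ t‖ ^ 2) := by
  have : CompleteSpace V := FiniteDimensional.complete ℂ V
  set e := stdOrthonormalBasis ℂ V with he
  have hcont : ∀ i, Continuous fun t => inner ℂ (e i) (φ t) := fun i =>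
    (innerSL ℂ (e i)).continuous.comp hφ
  have hi : ∀ i, HasSum (fun n => ‖inner ℂ (e i) (fourierCoeffOn hab φ n)‖ ^ 2)
      ((b - a)⁻¹ • ∫ t in a..b, ‖inner ℂ (e i) (φ t)‖ ^ 2) := fun i => by
    have h1 := hasSum_sq_fourierCoeffOn (f := fun t => inner ℂ (e i) (φ t)) hab
      ((hcont i).memLp_two_restrict_Ioc a b)
    convert h1 using 4 with n
    exact (innerSL ℂ (e i)).map_fourierCoeffOn hab hφ n
  have hsum := hasSum_sum fun (i : Fin (Module.finrank ℂ V)) (_ : i ∈ Finset.univ) => hi i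
  simp only [e.sum_sq_norm_inner_right] at hsum
  convert hsum using 1
  rw [← Finset.smul_sum, ← intervalIntegral.integral_finsetSum]
  · simp only [e.sum_sq_norm_inner_right]
  · exact fun i _ => ((hcont i).norm.pow 2).intervalIntegrable _ _

section Bessel

variable {X : Type*} [NormedAddCommGroup X] [InnerProductSpace ℂ X] [CompleteSpace X]

/-- Bessel's inequality for vector-valued Fourier coefficients. -/
lemma sum_sq_norm_fourierCoeffOn_le {a b : ℝ} (hab : a < b) {φ : ℝ → X} (hφ : Continuous φ)
    (s : Finset ℤ) :
    ∑ n ∈ s, ‖fourierCoeffOn hab φ n‖ ^ 2 ≤ (b - a)⁻¹ • ∫ t in a..b, ‖φ t‖ ^ 2 := by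
  set V : Submodule ℂ X := Submodule.span ℂ (fourierCoeffOn hab φ '' (s : Set ℤ)) with hV
  have : FiniteDimensional ℂ V :=
    FiniteDimensional.span_of_finite ℂ (s.finite_toSet.image _)
  have : CompleteSpace V := FiniteDimensional.complete ℂ V
  set A : X →L[ℂ] V := V.orthogonalProjectionOnto with hA
  have hAφ : Continuous fun t => A (φ t) := A.continuous.comp hφ
  have hpars := hasSum_sq_norm_fourierCoeffOn hab hAφ
  calc ∑ n ∈ s, ‖fourierCoeffOn hab φ n‖ ^ 2
      = ∑ n ∈ s, ‖fourierCoeffOn hab (fun t => A (φ t)) n‖ ^ 2 := by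
        refine Finset.sum_congr rfl fun n hn => ?_
        rw [← A.map_fourierCoeffOn hab hφ, hA, Submodule.norm_orthogonalProjectionOnto_apply]
        exact Submodule.subset_span (Set.mem_image_of_mem _ hn)
    _ ≤ (b - a)⁻¹ • ∫ t in a..b, ‖A (φ t)‖ ^ 2 :=
        sum_le_hasSum s (fun _ _ => by positivity) hpars
    _ ≤ (b - a)⁻¹ • ∫ t in a..b, ‖φ t‖ ^ 2 := by
        refine smul_le_smul_of_nonneg_left ?_ (inv_nonneg.2 (sub_nonneg.2 hab.le))
        refine intervalIntegral.integral_mono_on hab.le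
          ((hAφ.norm.pow 2).intervalIntegrable _ _) ((hφ.norm.pow 2).intervalIntegrable _ _)
          fun t _ => ?_
        gcongr
        exact V.norm_orthogonalProjectionOnto_apply_le _

/-- Comparing Fourier coefficients compares `L²` norms. -/
lemma integral_sq_norm_le_of_fourierCoeffOn {a b Ψ : ℝ} (hab : a < b) (hΨ : 0 ≤ Ψ) {φ η : ℝ → X}
    (hφ : Continuous φ) (hη : Continuous η)
    (h : ∀ n, Ψ * ‖fourierCoeffOn hab φ n‖ ≤ ‖fourierCoeffOn hab η n‖) :
    Ψ ^ 2 * ∫ t in a..b, ‖φ t‖ ^ 2 ≤ ∫ t in a..b, ‖η t‖ ^ 2 := by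
  have hfin : ∀ (V : Submodule ℂ X) [FiniteDimensional ℂ V] [V.HasOrthogonalProjection],
      Ψ ^ 2 * ∫ t in a..b, ‖V.orthogonalProjectionOnto (φ t)‖ ^ 2 ≤ ∫ t in a..b, ‖η t‖ ^ 2 := by
    intro V _ _
    have : CompleteSpace V := FiniteDimensional.complete ℂ V
    set A : X →L[ℂ] V := V.orthogonalProjectionOnto with hA
    have hpars := (hasSum_sq_norm_fourierCoeffOn hab (A.continuous.comp hφ)).mul_left (Ψ ^ 2)
    have hle : Ψ ^ 2 * ((b - a)⁻¹ • ∫ t in a..b, ‖A (φ t)‖ ^ 2)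
        ≤ (b - a)⁻¹ • ∫ t in a..b, ‖η t‖ ^ 2 := by
      refine hasSum_le_of_sum_le hpars fun s => ?_
      refine le_trans (Finset.sum_le_sum fun n _ => ?_) (sum_sq_norm_fourierCoeffOn_le hab hη s)
      have h1 : ‖fourierCoeffOn hab (A ∘ φ) n‖ ≤ ‖fourierCoeffOn hab φ n‖ := by
        have := A.map_fourierCoeffOn hab hφ n
        rw [Function.comp_def, ← this]
        exact V.norm_orthogonalProjectionOnto_apply_le _
      rw [← mul_pow]
      have h2 : Ψ * ‖fourierCoeffOn hab (A ∘ φ) n‖ ≤ Ψ * ‖fourierCoeffOn hab φ n‖ := by gcongr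
      gcongr
      exact h2.trans (h n)
    have hpos : 0 < (b - a)⁻¹ := inv_pos.2 (sub_pos.2 hab)
    rw [smul_eq_mul, smul_eq_mul] at hle
    refine le_of_mul_le_mul_left ?_ hpos
    linarith
  have happrox : ∀ ε : ℝ, 0 < ε → Ψ ^ 2 * ∫ t in a..b, ‖φ t‖ ^ 2
      ≤ (∫ t in a..b, ‖η t‖ ^ 2) + Ψ ^ 2 * ((b - a) * ε ^ 2) := fun ε hε => by
    obtain ⟨s, hs, hcov⟩ := Metric.totallyBounded_iff.1
      ((isCompact_Icc (a := a) (b := b)).image hφ).totallyBounded ε hε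
    set V : Submodule ℂ X := Submodule.span ℂ s with hV
    have : FiniteDimensional ℂ V := FiniteDimensional.span_of_finite ℂ hs
    have : CompleteSpace V := FiniteDimensional.complete ℂ V
    have hpt : ∀ t ∈ Set.Icc a b,
        ‖φ t‖ ^ 2 ≤ ‖V.orthogonalProjectionOnto (φ t)‖ ^ 2 + ε ^ 2 := fun t ht => by
      obtain ⟨y, hys, hy⟩ := Set.mem_iUnion₂.1 (hcov (Set.mem_image_of_mem φ ht))
      have hmin : ‖φ t - V.starProjection (φ t)‖ ≤ ‖φ t - y‖ := by
        rw [Submodule.starProjection_minimal]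
        exact ciInf_le ⟨0, by rintro _ ⟨z, rfl⟩; exact norm_nonneg _⟩
          (⟨y, Submodule.subset_span hys⟩ : V)
      have hyε : ‖φ t - y‖ ≤ ε := by
        rw [← dist_eq_norm]
        exact (Metric.mem_ball.1 hy).le
      rw [Submodule.norm_sq_eq_add_norm_sq_starProjection (φ t) V,
        Submodule.starProjection_orthogonal_val]
      have h3 := hmin.trans hyε
      gcongr
      exact le_rfl
    have hAc : Continuous fun t => V.orthogonalProjectionOnto (φ t) :=
      V.orthogonalProjectionOnto.continuous.comp hφ
    have h_int := intervalIntegral.integral_mono_on (μ := MeasureTheory.volume) hab.le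
      ((hφ.norm.pow 2).intervalIntegrable _ _)
      (((hAc.norm.pow 2).intervalIntegrable _ _).add intervalIntegrable_const) hpt
    rw [intervalIntegral.integral_add ((hAc.norm.pow 2).intervalIntegrable _ _)
      intervalIntegrable_const, intervalIntegral.integral_const, smul_eq_mul] at h_int
    calc Ψ ^ 2 * ∫ t in a..b, ‖φ t‖ ^ 2
        ≤ Ψ ^ 2 * ((∫ t in a..b, ‖V.orthogonalProjectionOnto (φ t)‖ ^ 2)
            + (b - a) * ε ^ 2) := mul_le_mul_of_nonneg_left h_int (sq_nonneg Ψ)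
      _ ≤ _ := by
        rw [mul_add]
        gcongr
        exact hfin V
  have hlim : Filter.Tendsto
      (fun ε : ℝ => (∫ t in a..b, ‖η t‖ ^ 2) + Ψ ^ 2 * ((b - a) * ε ^ 2))
      (nhdsWithin 0 (Set.Ioi 0)) (nhds (∫ t in a..b, ‖η t‖ ^ 2)) := by
    have : Continuous fun ε : ℝ => (∫ t in a..b, ‖η t‖ ^ 2) + Ψ ^ 2 * ((b - a) * ε ^ 2) := by
      fun_prop
    simpa using (this.tendsto 0).mono_left nhdsWithin_le_nhds
  exact ge_of_tendsto hlim (Filter.eventually_of_mem self_mem_nhdsWithin happrox)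

end Bessel

lemma hasDerivAt_ite_le {f g f' g' : ℝ → ℝ} {c : ℝ} (hf : ∀ x, HasDerivAt f (f' x) x)
    (hg : ∀ x, HasDerivAt g (g' x) x) (h0 : f c = g c) (h1 : f' c = g' c) (x : ℝ) :
    HasDerivAt (fun x => if x ≤ c then f x else g x) (if x ≤ c then f' x else g' x) x := by
  rcases lt_trichotomy x c with hx | rfl | hx
  · rw [if_pos hx.le]
    refine (hf x).congr_of_eventuallyEq ?_
    filter_upwards [Iio_mem_nhds hx] with y hy
    exact if_pos (le_of_lt hy)
  · rw [if_pos le_rfl]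
    have hl : HasDerivWithinAt (fun y => if y ≤ x then f y else g y) (f' x) (Set.Iic x) x :=
      (hf x).hasDerivWithinAt.congr (fun y hy => if_pos hy) (if_pos le_rfl)
    have hr : HasDerivWithinAt (fun y => if y ≤ x then f y else g y) (f' x) (Set.Ici x) x := by
      rw [h1]
      refine (hg x).hasDerivWithinAt.congr (fun y hy => ?_) (by simp [h0])
      rcases eq_or_lt_of_le (Set.mem_Ici.1 hy) with rfl | hlt
      · simp [h0]
      · exact if_neg (not_le.2 hlt)
    simpa using hl.union hr
  · rw [if_neg (not_le.2 hx)]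
    refine (hg x).congr_of_eventuallyEq ?_
    filter_upwards [Ioi_mem_nhds hx] with y hy
    exact if_neg (not_le.2 hy)

/-- A weighted energy inequality for all `C¹` weights vanishing at the ends of a window forces
exponential decay of a nonincreasing function. -/
lemma le_exp_mul_of_weighted_integral_le {N : ℝ → ℝ} {Ψ : ℝ} (hΨ : 0 < Ψ) (hN : Continuous N)
    (hN0 : ∀ t, 0 ≤ N t) (hanti : AntitoneOn N (Set.Ici 0))
    (hw : ∀ (L : ℝ) (χ χ' : ℝ → ℝ), 0 < L → (∀ t, HasDerivAt χ (χ' t) t) → Continuous χ' →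
      χ 0 = 0 → χ L = 0 →
      Ψ ^ 2 * (∫ t in (0 : ℝ)..L, χ t ^ 2 * N t) ≤ ∫ t in (0 : ℝ)..L, χ' t ^ 2 * N t)
    {t : ℝ} (ht : 0 ≤ t) : N t ≤ Real.exp (Real.pi - 2 * Ψ * t) * N 0 := by
  have hπ := Real.pi_pos
  by_cases hsmall : 2 * Ψ * t < Real.pi
  · calc N t ≤ 1 * N 0 := by
          rw [one_mul]
          exact hanti (Set.mem_Ici.2 le_rfl) ht ht
      _ ≤ _ := by
          gcongr
          · exact hN0 0
          · exact Real.one_le_exp (by linarith)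
  push Not at hsmall
  set a : ℝ := Real.pi / (4 * Ψ) with ha
  set b : ℝ := t - Real.pi / (4 * Ψ) with hb
  set L : ℝ := t + Real.pi / (2 * Ψ) with hL
  set A : ℝ := Real.exp (Ψ * (b - a)) with hA
  have hΨa : Ψ * a = Real.pi / 4 := by rw [ha]; field_simp
  have hΨb : Ψ * b = Ψ * t - Real.pi / 4 := by rw [hb]; field_simp
  have hΨL : Ψ * L = Ψ * t + Real.pi / 2 := by rw [hL]; field_simp
  have ha0 : 0 < a := by positivity
  have hab : a ≤ b := by
    refine le_of_mul_le_mul_left ?_ hΨ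
    rw [hΨa, hΨb]
    linarith
  have hbt : b < t := by
    rw [hb]
    have : 0 < Real.pi / (4 * Ψ) := by positivity
    linarith
  have htL : t < L := by
    rw [hL]
    have : 0 < Real.pi / (2 * Ψ) := by positivity
    linarith
  set f₁ : ℝ → ℝ := fun τ => Real.sin (Ψ * τ) with hf₁
  set f₁' : ℝ → ℝ := fun τ => Ψ * Real.cos (Ψ * τ) with hf₁'
  set f₂ : ℝ → ℝ := fun τ => √2 / 2 * Real.exp (Ψ * (τ - a)) with hf₂
  set f₂' : ℝ → ℝ := fun τ => Ψ * f₂ τ with hf₂'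
  set f₃ : ℝ → ℝ := fun τ => A * Real.sin (Ψ * (τ - b) + Real.pi / 4) with hf₃
  set f₃' : ℝ → ℝ := fun τ => Ψ * (A * Real.cos (Ψ * (τ - b) + Real.pi / 4)) with hf₃'
  have d₁ : ∀ τ, HasDerivAt f₁ (f₁' τ) τ := fun τ => by
    refine (((hasDerivAt_id τ).const_mul Ψ).sin).congr_deriv ?_
    simp only [hf₁', id]
    ring
  have d₂ : ∀ τ, HasDerivAt f₂ (f₂' τ) τ := fun τ => by
    refine (((((hasDerivAt_id τ).sub_const a).const_mul Ψ).exp).const_mul (√2 / 2)).congr_deriv ?_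
    simp only [hf₂', hf₂, id]
    ring
  have d₃ : ∀ τ, HasDerivAt f₃ (f₃' τ) τ := fun τ => by
    refine ((((((hasDerivAt_id τ).sub_const b).const_mul Ψ).add_const
      (Real.pi / 4)).sin).const_mul A).congr_deriv ?_
    simp only [hf₃', id]
    ring
  have d₂₃ := hasDerivAt_ite_le (c := b) d₂ d₃ (by simp [hf₂, hf₃, hA, mul_comm])
    (by simp [hf₂, hf₂', hf₃', hA, mul_comm])
  have d := hasDerivAt_ite_le (c := a) d₁ d₂₃ (by simp [hf₁, hf₂, hab, hΨa])
    (by simp [hf₁', hf₂', hf₂, hab, hΨa])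
  set χ : ℝ → ℝ := fun τ => if τ ≤ a then f₁ τ else if τ ≤ b then f₂ τ else f₃ τ with hχ
  set χ' : ℝ → ℝ := fun τ => if τ ≤ a then f₁' τ else if τ ≤ b then f₂' τ else f₃' τ with hχ'
  have c₁ : Continuous f₁' := by fun_prop
  have c₂ : Continuous f₂' := by fun_prop
  have c₃ : Continuous f₃' := by fun_prop
  have hχ'c : Continuous χ' := by
    refine Continuous.if_le c₁ (Continuous.if_le c₂ c₃ continuous_id continuous_const ?_)
      continuous_id continuous_const ?_
    · rintro τ rfl
      simp [hf₂, hf₂', hf₃', hA, mul_comm]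
    · rintro τ rfl
      simp [hf₁', hf₂', hf₂, hab, hΨa]
  have hχc : Continuous χ := continuous_iff_continuousAt.2 fun τ => (d τ).continuousAt
  have hmain := hw L χ χ' (by linarith) d hχ'c (by simp [hχ, hf₁, ha0.le]) (by
    have h1 : ¬ L ≤ a := by linarith
    have h2 : ¬ L ≤ b := by linarith
    have h3 : Ψ * (L - b) + Real.pi / 4 = Real.pi := by rw [mul_sub, hΨL, hΨb]; ring
    simp [hχ, h1, h2, hf₃, h3])
  set w : ℝ → ℝ := fun τ => (χ' τ ^ 2 - Ψ ^ 2 * χ τ ^ 2) * N τ with hw_def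
  have hwc : Continuous w := by fun_prop
  have hwint : ∀ p q, IntervalIntegrable w MeasureTheory.volume p q := fun p q =>
    hwc.intervalIntegrable p q
  have hw0 : 0 ≤ ∫ τ in (0 : ℝ)..L, w τ := by
    have : ∫ τ in (0 : ℝ)..L, w τ = (∫ τ in (0 : ℝ)..L, χ' τ ^ 2 * N τ)
        - Ψ ^ 2 * ∫ τ in (0 : ℝ)..L, χ τ ^ 2 * N τ := by
      rw [← intervalIntegral.integral_const_mul, ← intervalIntegral.integral_sub]
      · congr 1
        funext τ
        simp only [hw_def]
        ring
      · exact Continuous.intervalIntegrable (by fun_prop) _ _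
      · exact Continuous.intervalIntegrable (by fun_prop) _ _
    rw [this]
    linarith
  have hsplit : ∫ τ in (0 : ℝ)..L, w τ = (∫ τ in (0 : ℝ)..a, w τ) + (∫ τ in a..b, w τ)
      + (∫ τ in b..t, w τ) + ∫ τ in t..L, w τ := by
    rw [intervalIntegral.integral_add_adjacent_intervals (hwint _ _) (hwint _ _),
      intervalIntegral.integral_add_adjacent_intervals (hwint _ _) (hwint _ _),
      intervalIntegral.integral_add_adjacent_intervals (hwint _ _) (hwint _ _)]
  have i₁ : ∫ τ in (0 : ℝ)..a, w τ ≤ Ψ / 2 * N 0 := by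
    have hF : ∀ τ, HasDerivAt (fun τ => Ψ / 2 * Real.sin (2 * (Ψ * τ)) * N 0)
        (Ψ ^ 2 * Real.cos (2 * (Ψ * τ)) * N 0) τ := fun τ => by
      refine (((((hasDerivAt_id τ).const_mul Ψ).const_mul 2).sin.const_mul
        (Ψ / 2)).mul_const (N 0)).congr_deriv ?_
      simp only [id]
      ring
    calc ∫ τ in (0 : ℝ)..a, w τ
        ≤ ∫ τ in (0 : ℝ)..a, Ψ ^ 2 * Real.cos (2 * (Ψ * τ)) * N 0 := by
          refine intervalIntegral.integral_mono_on ha0.le (hwint _ _)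
            (Continuous.intervalIntegrable (by fun_prop) _ _) fun τ hτ => ?_
          have hcos : 0 ≤ Real.cos (2 * (Ψ * τ)) := by
            have h1 : Ψ * τ ≤ Ψ * a := by gcongr; exact hτ.2
            have h2 : 0 ≤ Ψ * τ := mul_nonneg hΨ.le hτ.1
            exact Real.cos_nonneg_of_neg_pi_div_two_le_of_le (by linarith) (by linarith)
          have hwτ : w τ = Ψ ^ 2 * Real.cos (2 * (Ψ * τ)) * N τ := by
            simp only [hw_def, hχ, hχ', if_pos hτ.2, hf₁, hf₁', Real.cos_two_mul']
            ring
          rw [hwτ]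
          gcongr
          exact hanti (Set.mem_Ici.2 le_rfl) hτ.1 hτ.1
      _ = Ψ / 2 * N 0 := by
          rw [intervalIntegral.integral_eq_sub_of_hasDerivAt (fun τ _ => hF τ)
            (Continuous.intervalIntegrable (by fun_prop) _ _), hΨa,
            show 2 * (Real.pi / 4) = Real.pi / 2 by ring]
          simp
  have i₂ : ∫ τ in a..b, w τ ≤ 0 := by
    rw [show (0 : ℝ) = ∫ τ in a..b, (0 : ℝ) by simp]
    refine intervalIntegral.integral_mono_on hab (hwint _ _)
      intervalIntegrable_const fun τ hτ => le_of_eq ?_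
    rcases eq_or_lt_of_le hτ.1 with rfl | hlt
    · simp only [hw_def, hχ, hχ', if_pos le_rfl, hf₁, hf₁', hΨa, Real.cos_pi_div_four,
        Real.sin_pi_div_four]
      ring
    · simp only [hw_def, hχ, hχ', if_neg (not_le.2 hlt), if_pos hτ.2, hf₂']
      ring
  have hw3 : ∀ τ, b ≤ τ → w τ = -(A ^ 2 * Ψ ^ 2 * Real.sin (2 * (Ψ * (τ - b)))) * N τ := by
    intro τ hτ
    have key : (f₃' τ ^ 2 - Ψ ^ 2 * f₃ τ ^ 2) =
        -(A ^ 2 * Ψ ^ 2 * Real.sin (2 * (Ψ * (τ - b)))) := by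
      have hsin : -Real.sin (2 * (Ψ * (τ - b)))
          = Real.cos (Ψ * (τ - b) + Real.pi / 4) ^ 2 - Real.sin (Ψ * (τ - b) + Real.pi / 4) ^ 2 := by
        rw [← Real.cos_two_mul', ← Real.cos_add_pi_div_two]
        congr 1
        ring
      rw [← mul_neg, hsin]
      simp only [hf₃, hf₃']
      ring
    have hχ₃ : χ τ = f₃ τ ∧ χ' τ = f₃' τ := by
      rcases eq_or_lt_of_le hτ with rfl | hlt
      · rcases eq_or_lt_of_le hab with heq | hlt'
        · rw [← heq] at hA
          simp [hχ, hχ', ← heq, hf₁, hf₁', hf₃, hf₃', hA, hΨa]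
        · simp [hχ, hχ', not_le.2 hlt', hf₂, hf₂', hf₃, hf₃', hA, mul_comm]
      · simp [hχ, hχ', not_le.2 hlt, not_le.2 (hab.trans_lt hlt)]
    rw [← key, ← hχ₃.1, ← hχ₃.2]
  have hG : ∀ C τ, HasDerivAt (fun τ => A ^ 2 * Ψ / 2 * Real.cos (2 * (Ψ * (τ - b))) * C)
      (-(A ^ 2 * Ψ ^ 2 * Real.sin (2 * (Ψ * (τ - b)))) * C) τ := fun C τ => by
    refine ((((((hasDerivAt_id τ).sub_const b).const_mul Ψ).const_mul 2).cos.const_mul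
      (A ^ 2 * Ψ / 2)).mul_const C).congr_deriv ?_
    simp only [id]
    ring
  have i₃ : ∫ τ in b..t, w τ ≤ -(A ^ 2 * Ψ / 2 * N t) := by
    calc ∫ τ in b..t, w τ
        ≤ ∫ τ in b..t, -(A ^ 2 * Ψ ^ 2 * Real.sin (2 * (Ψ * (τ - b)))) * N t := by
          refine intervalIntegral.integral_mono_on hbt.le (hwint _ _)
            (Continuous.intervalIntegrable (by fun_prop) _ _) fun τ hτ => ?_
          rw [hw3 τ hτ.1, neg_mul, neg_mul, neg_le_neg_iff]
          have h1 : Ψ * (τ - b) ≤ Ψ * (t - b) := by gcongr; exact hτ.2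
          have h2 : 0 ≤ Ψ * (τ - b) := mul_nonneg hΨ.le (sub_nonneg.2 hτ.1)
          have hsin : 0 ≤ Real.sin (2 * (Ψ * (τ - b))) :=
            Real.sin_nonneg_of_nonneg_of_le_pi (by linarith) (by linarith)
          gcongr
          exact hanti (Set.mem_Ici.2 (ha0.le.trans (hab.trans hτ.1))) ht hτ.2
      _ = -(A ^ 2 * Ψ / 2 * N t) := by
          rw [intervalIntegral.integral_eq_sub_of_hasDerivAt (fun τ _ => hG (N t) τ)
            (Continuous.intervalIntegrable (by fun_prop) _ _), mul_sub, hΨb,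
            show 2 * (Ψ * t - (Ψ * t - Real.pi / 4)) = Real.pi / 2 by ring]
          simp
  have i₄ : ∫ τ in t..L, w τ ≤ 0 := by
    set m : ℝ := t + Real.pi / (4 * Ψ) with hm
    have hΨm : Ψ * m = Ψ * t + Real.pi / 4 := by rw [hm]; field_simp
    have hm0 : 0 ≤ m := by positivity
    calc ∫ τ in t..L, w τ
        ≤ ∫ τ in t..L, -(A ^ 2 * Ψ ^ 2 * Real.sin (2 * (Ψ * (τ - b)))) * N m := by
          refine intervalIntegral.integral_mono_on htL.le (hwint _ _)
            (Continuous.intervalIntegrable (by fun_prop) _ _) fun τ hτ => ?_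
          have hτ0 : 0 ≤ τ := ht.trans hτ.1
          rw [hw3 τ (hbt.le.trans hτ.1), neg_mul, neg_mul, neg_le_neg_iff,
            mul_assoc (A ^ 2 * Ψ ^ 2), mul_assoc (A ^ 2 * Ψ ^ 2)]
          refine mul_le_mul_of_nonneg_left ?_ (by positivity)
          have h1 : Ψ * t ≤ Ψ * τ := by gcongr; exact hτ.1
          have h2 : Ψ * τ ≤ Ψ * L := by gcongr; exact hτ.2
          rcases le_total τ m with hle | hle
          · have h3 : Ψ * τ ≤ Ψ * m := by gcongr
            have hsin : 0 ≤ Real.sin (2 * (Ψ * (τ - b))) :=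
              Real.sin_nonneg_of_nonneg_of_le_pi (by linarith) (by linarith)
            gcongr
            exact hanti hτ0 hm0 hle
          · have h3 : Ψ * m ≤ Ψ * τ := by gcongr
            have hsin : Real.sin (2 * (Ψ * (τ - b))) ≤ 0 := by
              rw [← neg_nonneg, ← Real.sin_sub_pi]
              exact Real.sin_nonneg_of_nonneg_of_le_pi (by linarith) (by linarith)
            exact mul_le_mul_of_nonpos_left (hanti hm0 hτ0 hle) hsin
      _ = 0 := by
          rw [intervalIntegral.integral_eq_sub_of_hasDerivAt (fun τ _ => hG (N m) τ)
            (Continuous.intervalIntegrable (by fun_prop) _ _), mul_sub Ψ L b, mul_sub Ψ t b,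
            hΨb, hΨL, show 2 * (Ψ * t - (Ψ * t - Real.pi / 4)) = Real.pi / 2 by ring,
            show 2 * (Ψ * t + Real.pi / 2 - (Ψ * t - Real.pi / 4))
              = Real.pi / 2 + Real.pi by ring, Real.cos_add_pi]
          simp
  have hfin : A ^ 2 * N t ≤ N 0 := by
    have h1 : A ^ 2 * Ψ / 2 * N t ≤ Ψ / 2 * N 0 := by linarith
    refine le_of_mul_le_mul_left ?_ (half_pos hΨ)
    linarith
  have hA2 : A ^ 2 = Real.exp (-(Real.pi - 2 * Ψ * t)) := by
    rw [hA, ← Real.exp_nat_mul, mul_sub, hΨa, hΨb]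
    congr 1
    push_cast
    ring
  rw [hA2, Real.exp_neg] at hfin
  rwa [inv_mul_le_iff₀ (Real.exp_pos _)] at hfin

/-- A strongly continuous semigroup of contractions, indexed by nonnegative times. -/
structure IsContractionSemigroup {X : Type*} [NormedAddCommGroup X] [NormedSpace ℂ X]
    (T : ℝ → X →L[ℂ] X) : Prop where
  zero : T 0 = ContinuousLinearMap.id ℂ X
  add : ∀ s t : ℝ, 0 ≤ s → 0 ≤ t → T (s + t) = (T s).comp (T t)
  norm_le : ∀ t : ℝ, 0 ≤ t → ‖T t‖ ≤ 1
  continuousOn : ∀ x, ContinuousOn (fun t => T t x) (Set.Ici 0)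

/-- `y` is the derivative at time `0` of the orbit of `x`. -/
def IsGeneratorPair {X : Type*} [NormedAddCommGroup X] [NormedSpace ℂ X]
    (T : ℝ → X →L[ℂ] X) (x y : X) : Prop :=
  HasDerivWithinAt (fun t => T t x) y (Set.Ici 0) 0

namespace IsContractionSemigroup

section Banach

variable {X : Type*} [NormedAddCommGroup X] [NormedSpace ℂ X] {T : ℝ → X →L[ℂ] X}

lemma apply_zero (hT : IsContractionSemigroup T) (x : X) : T 0 x = x := by
  rw [hT.zero, ContinuousLinearMap.id_apply]

lemma apply_add (hT : IsContractionSemigroup T) {s t : ℝ} (hs : 0 ≤ s) (ht : 0 ≤ t) (x : X) :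
    T (s + t) x = T s (T t x) := by
  rw [hT.add s t hs ht, ContinuousLinearMap.comp_apply]

lemma apply_comm (hT : IsContractionSemigroup T) {s t : ℝ} (hs : 0 ≤ s) (ht : 0 ≤ t) (x : X) :
    T s (T t x) = T t (T s x) := by
  rw [← hT.apply_add hs ht, add_comm, hT.apply_add ht hs]

lemma norm_apply_le (hT : IsContractionSemigroup T) {t : ℝ} (ht : 0 ≤ t) (x : X) :
    ‖T t x‖ ≤ ‖x‖ := by
  simpa using (T t).le_of_opNorm_le (hT.norm_le t ht) x

lemma antitoneOn_norm (hT : IsContractionSemigroup T) (x : X) :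
    AntitoneOn (fun t => ‖T t x‖) (Set.Ici 0) := fun s hs t _ hst => by
  have h := hT.norm_apply_le (sub_nonneg.2 hst) (T s x)
  rwa [← hT.apply_add (sub_nonneg.2 hst) hs, sub_add_cancel] at h

lemma continuous_orbit (hT : IsContractionSemigroup T) (x : X) :
    Continuous fun t => T (max t 0) x :=
  (hT.continuousOn x).comp_continuous (by fun_prop) fun _ => Set.mem_Ici.2 (le_max_right _ _)

lemma hasDerivWithinAt (hT : IsContractionSemigroup T) {x y : X} (h : IsGeneratorPair T x y)
    {t : ℝ} (ht : 0 ≤ t) : HasDerivWithinAt (fun s => T s x) (T t y) (Set.Ici t) t := by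
  have h0 : HasDerivWithinAt (fun s => T s x) y (Set.Ici 0) (t - t) := by
    rw [sub_self]
    exact h
  have h1 : HasDerivWithinAt (fun s => T (s - t) x) y (Set.Ici t) t := by
    have := h0.scomp_of_eq t ((hasDerivWithinAt_id t (Set.Ici t)).sub_const t)
      (fun s hs => sub_nonneg.2 (Set.mem_Ici.1 hs)) rfl
    simpa [Function.comp_def] using this
  have h2 := ((T t).restrictScalars ℝ).hasFDerivAt.comp_hasDerivWithinAt t h1
  refine h2.congr (fun s hs => ?_) ?_
  · simpa using hT.apply_add ht (sub_nonneg.2 (Set.mem_Ici.1 hs)) x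
  · simpa using hT.apply_add ht (sub_nonneg.2 (le_refl t)) x

lemma _root_.IsGeneratorPair.map {x y : X} (h : IsGeneratorPair T x y) (B : X →L[ℂ] X)
    (hB : ∀ t, 0 ≤ t → ∀ z, B (T t z) = T t (B z)) :
    IsGeneratorPair T (B x) (B y) := by
  have h2 := (B.restrictScalars ℝ).hasFDerivAt.comp_hasDerivWithinAt 0 h
  refine h2.congr (fun s hs => ?_) ?_
  · simpa using (hB s hs x).symm
  · simpa using (hB 0 le_rfl x).symm

variable [CompleteSpace X]

/-- The operator `x ↦ ∫₀ᴸ c(t) T(t) x dt`. -/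
lemma exists_integral_operator (hT : IsContractionSemigroup T) {c : ℝ → ℂ} (hc : Continuous c)
    {L : ℝ} (hL : 0 ≤ L) : ∃ B : X →L[ℂ] X, (∀ x, B x = ∫ t in (0 : ℝ)..L, c t • T (max t 0) x) ∧
      ∀ t, 0 ≤ t → ∀ z, B (T t z) = T t (B z) := by
  have h_int : ∀ x, IntervalIntegrable (fun t => c t • T (max t 0) x) MeasureTheory.volume 0 L :=
    fun x => (hc.smul (hT.continuous_orbit x)).intervalIntegrable _ _
  let B₀ : X →ₗ[ℂ] X :=
    { toFun := fun x => ∫ t in (0 : ℝ)..L, c t • T (max t 0) x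
      map_add' := fun x y => by
        rw [← intervalIntegral.integral_add (h_int x) (h_int y)]
        simp only [map_add, smul_add]
      map_smul' := fun a x => by
        rw [RingHom.id_apply, ← intervalIntegral.integral_smul]
        simp only [map_smul, smul_comm a] }
  have hbound : ∀ x, ‖B₀ x‖ ≤ (∫ t in (0 : ℝ)..L, ‖c t‖) * ‖x‖ := fun x => by
    rw [← intervalIntegral.integral_mul_const]
    refine (intervalIntegral.norm_integral_le_integral_norm hL).trans
      (intervalIntegral.integral_mono_on hL (h_int x).norm
        (Continuous.intervalIntegrable (by fun_prop) _ _) fun t _ => ?_)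
    rw [norm_smul]
    gcongr
    exact hT.norm_apply_le (le_max_right _ _) x
  refine ⟨B₀.mkContinuous _ hbound, fun x => rfl, fun t ht z => ?_⟩
  change (∫ s in (0 : ℝ)..L, c s • T (max s 0) (T t z)) = T t (∫ s in (0 : ℝ)..L, c s • T (max s 0) z)
  rw [← (T t).intervalIntegral_comp_comm (h_int z)]
  simp only [map_smul]
  congr 1
  funext s
  rw [hT.apply_comm (le_max_right _ _) ht]

/-- A resolvent bound on the imaginary axis compares the Fourier transforms of `χ T x` and
`χ' T x`. -/
lemma norm_integral_le_of_resolvent (hT : IsContractionSemigroup T) {Ψ lam : ℝ}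
    (hres : ∀ x y, IsGeneratorPair T x y → Ψ * ‖x‖ ≤ ‖y - (Complex.I * (lam : ℂ)) • x‖)
    {x₀ y₀ : X} (h₀ : IsGeneratorPair T x₀ y₀) {L : ℝ} (hL : 0 ≤ L) {χ χ' : ℝ → ℝ}
    (hχ : ∀ t, HasDerivAt χ (χ' t) t) (hχ' : Continuous χ') (hχ0 : χ 0 = 0) (hχL : χ L = 0) :
    Ψ * ‖∫ t in (0 : ℝ)..L, Complex.exp (-(Complex.I * lam * t)) • (χ t : ℂ) • T (max t 0) x₀‖
      ≤ ‖∫ t in (0 : ℝ)..L, Complex.exp (-(Complex.I * lam * t)) • (χ' t : ℂ) • T (max t 0) x₀‖ := by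
  have hχc : Continuous χ := continuous_iff_continuousAt.2 fun t => (hχ t).continuousAt
  set e : ℝ → ℂ := fun t => Complex.exp (-(Complex.I * lam * t)) with he
  have hec : Continuous e := by fun_prop
  have hed : ∀ t : ℝ, HasDerivAt e (-(Complex.I * lam) * e t) t := fun t => by
    have h1 : HasDerivAt (fun t : ℝ => -(Complex.I * lam * (t : ℂ))) (-(Complex.I * lam)) t := by
      simpa using ((Complex.ofRealCLM.hasDerivAt (x := t)).const_mul (Complex.I * lam)).fun_neg
    refine h1.cexp.congr_deriv ?_
    simp only [he]
    ring
  have hwc : Continuous fun t => e t * (χ t : ℂ) := by fun_prop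
  obtain ⟨B, hB, hBcomm⟩ := hT.exists_integral_operator hwc hL
  have hpair := h₀.map B hBcomm
  have hwd : ∀ t : ℝ, HasDerivAt (fun t => e t * (χ t : ℂ))
      (e t * (χ' t : ℂ) - Complex.I * lam * (e t * (χ t : ℂ))) t := fun t => by
    refine ((hed t).fun_mul (hχ t).ofReal_comp).congr_deriv ?_
    ring
  have hparts : ∫ t in (0 : ℝ)..L, ((e t * (χ t : ℂ)) • T (max t 0) y₀
      + (e t * (χ' t : ℂ) - Complex.I * lam * (e t * (χ t : ℂ))) • T (max t 0) x₀) = 0 := by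
    rw [intervalIntegral.integral_eq_sub_of_hasDeriv_right
      (f := fun t => (e t * (χ t : ℂ)) • T (max t 0) x₀)]
    · simp [hχ0, hχL]
    · exact (hwc.smul (hT.continuous_orbit x₀)).continuousOn
    · intro t ht
      have ht0 : 0 ≤ t := by
        have := ht.1
        rw [min_eq_left hL] at this
        exact this.le
      have hd : HasDerivWithinAt (fun s => T (max s 0) x₀) (T (max t 0) y₀) (Set.Ioi t) t := by
        rw [max_eq_left ht0]
        refine ((hT.hasDerivWithinAt h₀ ht0).congr (fun s hs => ?_) ?_).mono Set.Ioi_subset_Ici_self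
        · rw [max_eq_left (ht0.trans hs)]
        · rw [max_eq_left ht0]
      exact (hwd t).hasDerivWithinAt.fun_smul hd
    · refine Continuous.intervalIntegrable ?_ _ _
      exact (hwc.smul (hT.continuous_orbit y₀)).add
        (Continuous.smul (by fun_prop) (hT.continuous_orbit x₀))
  have hsplit : B y₀ - (Complex.I * (lam : ℂ)) • B x₀
      = -∫ t in (0 : ℝ)..L, e t • (χ' t : ℂ) • T (max t 0) x₀ := by
    have h1 := hwc.smul (hT.continuous_orbit x₀)
    have h2 := hwc.smul (hT.continuous_orbit y₀)
    have h3 := h1.const_smul (Complex.I * (lam : ℂ))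
    have h4 : Continuous fun t => e t • (χ' t : ℂ) • T (max t 0) x₀ :=
      hec.smul ((Complex.continuous_ofReal.comp hχ').smul (hT.continuous_orbit x₀))
    rw [eq_neg_iff_add_eq_zero, ← hparts, hB, hB, ← intervalIntegral.integral_smul,
      ← intervalIntegral.integral_sub, ← intervalIntegral.integral_add]
    · congr 1
      funext t
      simp only [sub_smul, mul_smul]
      abel
    · exact (h2.sub h3).intervalIntegrable _ _
    · exact h4.intervalIntegrable _ _
    · exact h2.intervalIntegrable _ _
    · exact h3.intervalIntegrable _ _
  have h := hres _ _ hpair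
  rw [hsplit, norm_neg, hB] at h
  simpa only [mul_smul] using h

end Banach

section Hilbert

variable {X : Type*} [NormedAddCommGroup X] [InnerProductSpace ℂ X] [CompleteSpace X]
  {T : ℝ → X →L[ℂ] X}

/-- Quantitative Gearhart–Prüss bound for orbits of vectors in the domain of the generator. -/
lemma norm_apply_le_exp (hT : IsContractionSemigroup T) {Ψ : ℝ} (hΨ : 0 < Ψ)
    (hres : ∀ x y, IsGeneratorPair T x y →
      ∀ lam : ℝ, Ψ * ‖x‖ ≤ ‖y - (Complex.I * (lam : ℂ)) • x‖)
    {x₀ y₀ : X} (h₀ : IsGeneratorPair T x₀ y₀) {t : ℝ} (ht : 0 ≤ t) :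
    ‖T t x₀‖ ≤ Real.exp (Real.pi / 2) * Real.exp (-Ψ * t) * ‖x₀‖ := by
  have horb := hT.continuous_orbit x₀
  have hsq := le_exp_mul_of_weighted_integral_le (N := fun t => ‖T (max t 0) x₀‖ ^ 2) hΨ
    (horb.norm.pow 2) (fun _ => by positivity) (fun s hs t ht hst => ?_)
    (fun L χ χ' hL hχ hχ' hχ0 hχL => ?_) ht
  · simp only [max_eq_left ht, max_self, hT.apply_zero] at hsq
    refine (sq_le_sq₀ (norm_nonneg _) (by positivity)).1 (hsq.trans (le_of_eq ?_))
    rw [mul_pow, mul_pow, ← Real.exp_nat_mul, ← Real.exp_nat_mul, ← Real.exp_add]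
    congr 2
    push_cast
    ring
  · have h := hT.antitoneOn_norm x₀ hs ht hst
    simp only [max_eq_left (Set.mem_Ici.1 hs), max_eq_left (Set.mem_Ici.1 ht)]
    gcongr
  · have hχc : Continuous χ := continuous_iff_continuousAt.2 fun t => (hχ t).continuousAt
    have h := integral_sq_norm_le_of_fourierCoeffOn hL hΨ.le
      (φ := fun t => (χ t : ℂ) • T (max t 0) x₀) (η := fun t => (χ' t : ℂ) • T (max t 0) x₀)
      ((Complex.continuous_ofReal.comp hχc).smul horb)
      ((Complex.continuous_ofReal.comp hχ').smul horb) fun n => by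
        have hn := hT.norm_integral_le_of_resolvent (lam := 2 * Real.pi * n / L)
          (fun x y hxy => hres x y hxy _) h₀ hL.le hχ hχ' hχ0 hχL
        have hker : ∀ t : ℝ, fourier (-n) (t : AddCircle (L - 0))
            = Complex.exp (-(Complex.I * ((2 * Real.pi * n / L : ℝ) : ℂ) * t)) := fun t => by
          rw [fourier_coe_apply]
          congr 1
          push_cast
          ring
        rw [fourierCoeffOn_eq_integral, fourierCoeffOn_eq_integral, norm_smul, norm_smul]
        simp only [hker]
        calc _ = ‖1 / (L - 0)‖ * (Ψ * _) := by ring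
          _ ≤ _ := mul_le_mul_of_nonneg_left hn (norm_nonneg _)
    simpa only [norm_smul, Complex.norm_real, mul_pow, Real.norm_eq_abs, sq_abs] using h

end Hilbert

end IsContractionSemigroup

namespace IsGeneratorPair

variable {X : Type*} [NormedAddCommGroup X] [NormedSpace ℂ X] {T : ℝ → X →L[ℂ] X}

lemma mul_norm_le (hT : IsContractionSemigroup T) {x y : X} (h : IsGeneratorPair T x y) {a : ℝ}
    (ha : 0 < a) : a * ‖x‖ ≤ ‖(a : ℂ) • x - y‖ := by
  have hslope := (hasDerivWithinAt_iff_tendsto_slope' (by simp)).1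
    (HasDerivWithinAt.mono h (Set.Ioi_subset_Ici_self))
  have hlim := (tendsto_const_nhds (x := (a : ℂ) • x)).sub hslope |>.norm
  refine ge_of_tendsto hlim ?_
  filter_upwards [self_mem_nhdsWithin] with t ht
  have ht0 : (0 : ℝ) < t := ht
  have hcalc : (a : ℂ) • x - slope (fun t => T t x) 0 t = (a + t⁻¹) • x - t⁻¹ • T t x := by
    rw [slope_def_module, hT.apply_zero, sub_zero, Complex.coe_smul]
    module
  rw [hcalc]
  have h1 := norm_sub_norm_le ((a + t⁻¹) • x) (t⁻¹ • T t x)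
  have h2 := mul_le_mul_of_nonneg_left (hT.norm_apply_le ht0.le x) (inv_pos.2 ht0).le
  rw [norm_smul, norm_smul, Real.norm_of_nonneg (by positivity),
    Real.norm_of_nonneg (by positivity)] at h1
  linarith

lemma sub {x y x' y' : X} (h : IsGeneratorPair T x y) (h' : IsGeneratorPair T x' y') :
    IsGeneratorPair T (x - x') (y - y') := by
  refine (HasDerivWithinAt.fun_sub h h').congr_of_mem (fun t _ => ?_) (Set.mem_Ici.2 le_rfl)
  exact map_sub _ _ _

/-- A lower bound on the imaginary axis extends from a core to the whole generator. -/
lemma resolvent_bound_of_core (hT : IsContractionSemigroup T) {D : X → X → Prop} {a Ψ lam : ℝ}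
    (ha : 0 < a) (hΨ : 0 ≤ Ψ) (hD : ∀ x y, D x y → IsGeneratorPair T x y)
    (hdense : Dense {z : X | ∃ x y, D x y ∧ (a : ℂ) • x - y = z})
    (hbound : ∀ x y, D x y → Ψ * ‖x‖ ≤ ‖y - (Complex.I * (lam : ℂ)) • x‖)
    {x y : X} (h : IsGeneratorPair T x y) :
    Ψ * ‖x‖ ≤ ‖y - (Complex.I * (lam : ℂ)) • x‖ := by
  have happrox : ∀ ε : ℝ, 0 < ε →
      Ψ * ‖x‖ ≤ ‖y - (Complex.I * (lam : ℂ)) • x‖ + (2 + |lam| / a + Ψ / a) * ε := fun ε hε => by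
    obtain ⟨_, ⟨x', y', hxy, rfl⟩, hdist⟩ := hdense.exists_dist_lt ((a : ℂ) • x - y) hε
    have hpair := h.sub (hD x' y' hxy)
    have hz : (a : ℂ) • (x - x') - (y - y') = (a : ℂ) • x - y - ((a : ℂ) • x' - y') := by
      module
    have h1 : a * ‖x - x'‖ ≤ ε := by
      refine (hpair.mul_norm_le hT ha).trans ?_
      rw [hz, ← dist_eq_norm]
      exact hdist.le
    have h2 : ‖y - y'‖ ≤ 2 * ε := by
      have h3 : y - y' = (a : ℂ) • (x - x') - ((a : ℂ) • x - y - ((a : ℂ) • x' - y')) := by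
        module
      rw [h3]
      refine (norm_sub_le _ _).trans ?_
      rw [norm_smul, Complex.norm_real, Real.norm_of_nonneg ha.le]
      rw [dist_eq_norm] at hdist
      linarith
    have h1' : ‖x - x'‖ ≤ ε / a := by
      rw [le_div_iff₀ ha, mul_comm]
      exact h1
    have h4 : ‖x‖ ≤ ‖x'‖ + ‖x - x'‖ := by
      have := norm_add_le x' (x - x')
      rwa [add_sub_cancel] at this
    have h5 : ‖y' - (Complex.I * (lam : ℂ)) • x'‖
        ≤ ‖y - (Complex.I * (lam : ℂ)) • x‖ + (‖y - y'‖ + |lam| * ‖x - x'‖) := by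
      have h6 : y' - (Complex.I * (lam : ℂ)) • x' = y - (Complex.I * (lam : ℂ)) • x
          - ((y - y') - (Complex.I * (lam : ℂ)) • (x - x')) := by module
      have h7 : ‖(Complex.I * (lam : ℂ)) • (x - x')‖ = |lam| * ‖x - x'‖ := by
        rw [norm_smul, norm_mul, Complex.norm_I, one_mul, Complex.norm_real, Real.norm_eq_abs]
      rw [h6]
      refine (norm_sub_le _ _).trans ?_
      have h8 := norm_sub_le (y - y') ((Complex.I * (lam : ℂ)) • (x - x'))
      rw [h7] at h8
      linarith
    calc Ψ * ‖x‖ ≤ Ψ * (‖x'‖ + ‖x - x'‖) := by gcongr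
      _ = Ψ * ‖x'‖ + Ψ * ‖x - x'‖ := by ring
      _ ≤ ‖y - (Complex.I * (lam : ℂ)) • x‖ + (2 * ε + |lam| * (ε / a)) + Ψ * (ε / a) := by
        have h9 := (hbound x' y' hxy).trans h5
        have h10 : |lam| * ‖x - x'‖ ≤ |lam| * (ε / a) := by gcongr
        have h11 : Ψ * ‖x - x'‖ ≤ Ψ * (ε / a) := by gcongr
        linarith
      _ = _ := by ring
  have hlim : Filter.Tendsto
      (fun ε : ℝ => ‖y - (Complex.I * (lam : ℂ)) • x‖ + (2 + |lam| / a + Ψ / a) * ε)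
      (nhdsWithin 0 (Set.Ioi 0)) (nhds ‖y - (Complex.I * (lam : ℂ)) • x‖) := by
    have : Continuous fun ε : ℝ =>
        ‖y - (Complex.I * (lam : ℂ)) • x‖ + (2 + |lam| / a + Ψ / a) * ε := by fun_prop
    simpa using (this.tendsto 0).mono_left nhdsWithin_le_nhds
  exact ge_of_tendsto hlim (Filter.eventually_of_mem self_mem_nhdsWithin happrox)

end IsGeneratorPair

/-- Contractions depending continuously on time on a dense set do so everywhere. -/
lemma continuousOn_apply_of_dense {X : Type*} [NormedAddCommGroup X] [NormedSpace ℂ X]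
    {T : ℝ → X →L[ℂ] X} {S : Set ℝ} (hT : ∀ t ∈ S, ‖T t‖ ≤ 1) {D : Set X} (hD : Dense D)
    (hcont : ∀ x ∈ D, ContinuousOn (fun t => T t x) S) (x : X) :
    ContinuousOn (fun t => T t x) S := by
  refine continuousOn_of_uniform_approx_of_continuousOn fun U hU => ?_
  obtain ⟨ε, hε, hεU⟩ := Metric.mem_uniformity_dist.1 hU
  obtain ⟨x', hx', hdist⟩ := hD.exists_dist_lt x hε
  refine ⟨fun t => T t x', hcont x' hx', fun t ht => hεU ?_⟩
  rw [dist_eq_norm, ← map_sub]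
  refine lt_of_le_of_lt ?_ hdist
  rw [dist_eq_norm]
  simpa using (T t).le_of_opNorm_le (hT t ht) (x - x')

section Embedding

variable {X : Type*} [NormedAddCommGroup X] [InnerProductSpace ℂ X] {J : (ℝ → ℂ) → X}

lemma map_sub_of_embedding
    (hJadd : ∀ f g : ℝ → ℂ, ContDiff ℝ 2 f → Function.Periodic f (2 * Real.pi) →
      ContDiff ℝ 2 g → Function.Periodic g (2 * Real.pi) → J (f + g) = J f + J g)
    (hJsmul : ∀ (c : ℂ) (f : ℝ → ℂ), ContDiff ℝ 2 f → Function.Periodic f (2 * Real.pi) →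
      J (c • f) = c • J f)
    {f g : ℝ → ℂ} (hf : ContDiff ℝ 2 f) (hfper : Function.Periodic f (2 * Real.pi))
    (hg : ContDiff ℝ 2 g) (hgper : Function.Periodic g (2 * Real.pi)) :
    J (f - g) = J f - J g := by
  have h := hJadd f ((-1 : ℂ) • g) hf hfper (contDiff_const.smul hg) fun y => by simp [hgper y]
  rw [hJsmul _ _ hg hgper, neg_one_smul, neg_one_smul, ← sub_eq_add_neg, ← sub_eq_add_neg] at h
  exact h

lemma injective_of_embedding
    (hJnorm : ∀ f : ℝ → ℂ, ContDiff ℝ 2 f → Function.Periodic f (2 * Real.pi) →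
      ‖J f‖ = l2norm f)
    (hJadd : ∀ f g : ℝ → ℂ, ContDiff ℝ 2 f → Function.Periodic f (2 * Real.pi) →
      ContDiff ℝ 2 g → Function.Periodic g (2 * Real.pi) → J (f + g) = J f + J g)
    (hJsmul : ∀ (c : ℂ) (f : ℝ → ℂ), ContDiff ℝ 2 f → Function.Periodic f (2 * Real.pi) →
      J (c • f) = c • J f)
    {f g : ℝ → ℂ} (hf : ContDiff ℝ 2 f) (hfper : Function.Periodic f (2 * Real.pi))
    (hg : ContDiff ℝ 2 g) (hgper : Function.Periodic g (2 * Real.pi)) (h : J f = J g) : f = g := by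
  have : Fact (0 < 2 * Real.pi) := ⟨Real.two_pi_pos⟩
  have hn := hJnorm (f - g) (hf.sub hg) (hfper.sub hgper)
  rw [map_sub_of_embedding hJadd hJsmul hf hfper hg hgper, h, sub_self, norm_zero] at hn
  have hz := ContPer.norm_eq_l2norm
    (ContPer.mk (f - g) (hf.sub hg).continuous (hfper.sub hgper))
  rw [ContPer.fn_mk, ← hn, norm_eq_zero] at hz
  exact sub_eq_zero.1 (congrArg ContPer.fn hz)

end Embedding

open ComplexConjugate in
/-- Decay of the semigroup generated by `ν ∂² - (c + i k u)`. -/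
lemma norm_apply_le_exp_of_shear {α C₁ : ℝ} (hα : 0 < α) (hC₁ : 0 < C₁)
    {u : ℝ → ℝ} (hu : Continuous u) (huper : Function.Periodic u (2 * Real.pi))
    {ψ : ℝ → ℝ} (hψ : ∀ y, HasDerivAt ψ (u y) y)
    (hlow : ∀ δ : ℝ, δ ∈ Set.Ioo (0 : ℝ) 1 → C₁ * δ ^ (2 * α + 3) ≤ omega1 δ ψ)
    {ν : ℝ} (hν : 0 < ν) {k : ℝ} (hk : k ≠ 0) (hνk : ν / |k| ≤ 1 / 2) {c : ℝ} (hc : 0 ≤ c)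
    {X : Type*} [NormedAddCommGroup X] [InnerProductSpace ℂ X] [CompleteSpace X]
    {J : (ℝ → ℂ) → X}
    (hJnorm : ∀ f : ℝ → ℂ, ContDiff ℝ 2 f → Function.Periodic f (2 * Real.pi) →
      ‖J f‖ = l2norm f)
    (hJadd : ∀ f g : ℝ → ℂ, ContDiff ℝ 2 f → Function.Periodic f (2 * Real.pi) →
      ContDiff ℝ 2 g → Function.Periodic g (2 * Real.pi) → J (f + g) = J f + J g)
    (hJsmul : ∀ (c : ℂ) (f : ℝ → ℂ), ContDiff ℝ 2 f → Function.Periodic f (2 * Real.pi) →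
      J (c • f) = c • J f)
    (hJdense : Dense {x : X | ∃ f : ℝ → ℂ, ContDiff ℝ 2 f ∧
      Function.Periodic f (2 * Real.pi) ∧ J f = x})
    {T : ℝ → X →L[ℂ] X}
    (hT0 : T 0 = ContinuousLinearMap.id ℂ X)
    (hTadd : ∀ s t : ℝ, 0 ≤ s → 0 ≤ t → T (s + t) = (T s).comp (T t))
    (hTcontr : ∀ t : ℝ, 0 ≤ t → ‖T t‖ ≤ 1)
    (hTode : ∀ f : ℝ → ℂ, ContDiff ℝ 2 f → Function.Periodic f (2 * Real.pi) →
      ∀ t : ℝ, 0 ≤ t → ∃ g : ℝ → ℂ, ContDiff ℝ 2 g ∧ Function.Periodic g (2 * Real.pi) ∧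
        T t (J f) = J g ∧
        HasDerivWithinAt (fun s => T s (J f))
          (J fun y => (ν : ℂ) * deriv (deriv g) y - ((c : ℂ) + Complex.I * (k : ℂ) * (u y : ℂ)) * g y)
          (Set.Ici 0) t)
    {t : ℝ} (ht : 0 ≤ t) (x : X) :
    ‖T t x‖ ≤ Real.exp (Real.pi / 2) *
      Real.exp (-((phiInv C₁) ^ 2 * ν ^ (α / (α + 2)) * |k| ^ (2 / (α + 2))) * t) * ‖x‖ := by
  have : Fact (0 < 2 * Real.pi) := ⟨Real.two_pi_pos⟩
  set Ψ : ℝ := (phiInv C₁) ^ 2 * ν ^ (α / (α + 2)) * |k| ^ (2 / (α + 2)) with hΨ_def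
  have hΨ : 0 < Ψ := by
    have h1 := phiInv_pos hC₁
    have h2 : 0 < |k| := abs_pos.2 hk
    positivity
  have hT : IsContractionSemigroup T := by
    refine ⟨hT0, hTadd, hTcontr, fun x => continuousOn_apply_of_dense hTcontr hJdense ?_ x⟩
    rintro _ ⟨f, hf, hfper, rfl⟩ s hs
    obtain ⟨g, -, -, -, hd⟩ := hTode f hf hfper s hs
    exact hd.continuousWithinAt
  have hgen : ∀ f : ℝ → ℂ, ContDiff ℝ 2 f → Function.Periodic f (2 * Real.pi) →
      IsGeneratorPair T (J f) (J fun y => (ν : ℂ) * deriv (deriv f) y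
        - ((c : ℂ) + Complex.I * (k : ℂ) * (u y : ℂ)) * f y) := fun f hf hfper => by
    obtain ⟨g, hg, hgper, hfg, hd⟩ := hTode f hf hfper 0 le_rfl
    rw [hT.apply_zero] at hfg
    rw [injective_of_embedding hJnorm hJadd hJsmul hf hfper hg hgper hfg] at hd ⊢
    exact hd
  set D : X → X → Prop := fun x y => ∃ f h : ℝ → ℂ, ContDiff ℝ 2 f ∧
    Function.Periodic f (2 * Real.pi) ∧ ContDiff ℝ 2 h ∧ Function.Periodic h (2 * Real.pi) ∧
    (∀ z, h z = (ν : ℂ) * deriv (deriv f) z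
      - ((c : ℂ) + Complex.I * (k : ℂ) * (u z : ℂ)) * f z) ∧ x = J f ∧ y = J h with hD_def
  have hD : ∀ x y, D x y → IsGeneratorPair T x y := by
    rintro _ _ ⟨f, h, hf, hfper, -, -, hfh, rfl, rfl⟩
    rw [funext hfh]
    exact hgen f hf hfper
  have hνC : (ν : ℂ) ≠ 0 := Complex.ofReal_ne_zero.2 hν.ne'
  have hrange : Dense {z : X | ∃ x y, D x y ∧ ((1 : ℝ) : ℂ) • x - y = z} := by
    refine hJdense.mono ?_
    rintro _ ⟨h, hh, hhper, rfl⟩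
    have hwc : Continuous fun y => k * u y / ν := by fun_prop
    obtain ⟨f, hsol⟩ := exists_isPeriodicSol Real.two_pi_pos (c := (c + 1) / ν) (by positivity)
      (w := fun y => k * u y / ν) hwc (fun y => by simp only [huper y])
      (h := fun y => -(h y / ν)) (by have := hh.continuous; fun_prop)
      (fun y => by simp only [hhper y])
    have hf : ContDiff ℝ 2 f := hsol.contDiff (by fun_prop) (by have := hh.continuous; fun_prop)
    obtain ⟨hfper, f1, h1, h2⟩ := hsol
    have hderiv : deriv (deriv f) = fun y => (Complex.I * ((k * u y / ν : ℝ) : ℂ)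
        + (((c + 1) / ν : ℝ) : ℂ)) * f y + -(h y / ν) := by
      rw [show deriv f = f1 from funext fun y => (h1 y).deriv]
      exact funext fun y => (h2 y).deriv
    refine ⟨J f, J (f - h), ⟨f, f - h, hf, hfper, hf.sub hh, hfper.sub hhper, fun z => ?_,
      rfl, rfl⟩, ?_⟩
    · rw [hderiv]
      simp only [Pi.sub_apply]
      push_cast
      field_simp
      ring
    · rw [map_sub_of_embedding hJadd hJsmul hf hfper hh hhper]
      simp
  have hbound : ∀ (lam : ℝ) (x y : X), D x y →
      Ψ * ‖x‖ ≤ ‖y - (Complex.I * (lam : ℂ)) • x‖ := by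
    rintro lam _ _ ⟨f, h, hf, hfper, hh, hhper, hfh, rfl, rfl⟩
    have hs : ContDiff ℝ 2 ((Complex.I * (lam : ℂ)) • f) := contDiff_const.smul hf
    have hsper : Function.Periodic ((Complex.I * (lam : ℂ)) • f) (2 * Real.pi) := fun y => by
      simp [hfper y]
    have hd : ContDiff ℝ 2 (h - (Complex.I * (lam : ℂ)) • f) := hh.sub hs
    have hdper := hhper.sub hsper
    have hr : ContDiff ℝ 2 ((ν : ℂ)⁻¹ • (h - (Complex.I * (lam : ℂ)) • f)) :=
      contDiff_const.smul hd
    have hrper : Function.Periodic ((ν : ℂ)⁻¹ • (h - (Complex.I * (lam : ℂ)) • f)) (2 * Real.pi) :=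
      fun y => by simp [hfper y, hhper y]
    have hmain := IsPeriodicSol.mul_norm_le (w := fun y => (k * u y + lam) / ν) (c := c / ν)
      (s₀ := Ψ / ν) (by fun_prop) (fun y => by simp only [huper y]) (by positivity)
      (fun c' s p hc' hs hp hsol => by
        obtain ⟨hpper, p1, hp1, hp2⟩ := hsol
        rw [div_le_iff₀' hν]
        exact phiInv_sq_div_le_of_eigenfunction hα hC₁ hψ hlow hν hk hνk hc'.le hs hp1
          (fun y => (hp2 y).congr_deriv (by ring)) hpper (Function.ne_iff.1 hp))
      (ContPer.mk f hf.continuous hfper) (ContPer.mk _ hr.continuous hrper) (by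
        obtain ⟨-, f1, h1, h2⟩ := isPeriodicSol_of_contDiff (fun _ => 0) hf hfper
        refine ⟨hfper, f1, h1, fun y => (h2 y).congr_deriv ?_⟩
        simp only [ContPer.fn_mk, Pi.smul_apply, Pi.sub_apply, smul_eq_mul, hfh]
        push_cast
        field_simp
        ring)
    rw [ContPer.norm_eq_l2norm, ContPer.norm_eq_l2norm, ContPer.fn_mk, ContPer.fn_mk,
      ← hJnorm _ hf hfper, ← hJnorm _ hr hrper, hJsmul _ _ hd hdper,
      map_sub_of_embedding hJadd hJsmul hh hhper hs hsper, hJsmul _ _ hf hfper, norm_smul,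
      norm_inv, Complex.norm_real, Real.norm_of_nonneg hν.le, div_mul_eq_mul_div,
      ← div_eq_inv_mul] at hmain
    exact (div_le_div_iff_of_pos_right hν).1 hmain
  have hres : ∀ x y, IsGeneratorPair T x y →
      ∀ lam : ℝ, Ψ * ‖x‖ ≤ ‖y - (Complex.I * (lam : ℂ)) • x‖ := fun x y hxy lam =>
    IsGeneratorPair.resolvent_bound_of_core hT one_pos hΨ.le hD hrange (hbound lam) hxy
  have hclosed : IsClosed {x : X | ‖T t x‖ ≤
      Real.exp (Real.pi / 2) * Real.exp (-Ψ * t) * ‖x‖} :=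
    isClosed_le (by fun_prop) (by fun_prop)
  refine hclosed.closure_subset_iff.2 ?_ (hJdense x)
  rintro _ ⟨f, hf, hfper, rfl⟩
  exact hT.norm_apply_le_exp hΨ hres (hgen f hf hfper) ht

/-- Enhanced dissipation for shear flows with `ω₁(δ,u) ≥ C₁ δ^{2α+3}`:
the contraction semigroups `T t = e^{-t R_{k,ν}}` (with
`R_{k,ν} = iku - ν∂_y²`) and `T' t = e^{-t L_{k,ν}}` (with
`L_{k,ν} = iku - ν(∂_y² - |k|²)`) on `L²(𝕋)` — encoded on an abstract Hilbert
space `X` via an embedding `J` of C² `2π`-periodic functions with dense range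
preserving the `L²` norm and the linear structure — satisfy
`‖T t‖ ≤ e^{π/2} e^{-ε ν^{α/(α+2)} |k|^{2/(α+2)} t}` with `ε = (φ⁻¹(C₁))²`,
provided `ν > 0`, `k ≠ 0`, `ν|k|⁻¹ ≤ 1/2`. -/
theorem stmt_13 (α C₁ : ℝ) (hα : 0 < α) (hC₁ : 0 < C₁)
    (u : ℝ → ℝ) (hu : Continuous u) (huper : Function.Periodic u (2 * Real.pi))
    (ψ : ℝ → ℝ) (hψ : ∀ y, HasDerivAt ψ (u y) y)
    (hlow : ∀ δ : ℝ, δ ∈ Set.Ioo (0 : ℝ) 1 → C₁ * δ ^ (2 * α + 3) ≤ omega1 δ ψ)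
    (ν : ℝ) (hν : 0 < ν) (k : ℤ) (hk : k ≠ 0) (hνk : ν / |(k : ℝ)| ≤ 1 / 2)
    {X : Type*} [NormedAddCommGroup X] [InnerProductSpace ℂ X] [CompleteSpace X]
    (J : (ℝ → ℂ) → X)
    (hJnorm : ∀ f : ℝ → ℂ, ContDiff ℝ 2 f → Function.Periodic f (2 * Real.pi) →
      ‖J f‖ = l2norm f)
    (hJadd : ∀ f g : ℝ → ℂ, ContDiff ℝ 2 f → Function.Periodic f (2 * Real.pi) →
      ContDiff ℝ 2 g → Function.Periodic g (2 * Real.pi) → J (f + g) = J f + J g)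
    (hJsmul : ∀ (c : ℂ) (f : ℝ → ℂ), ContDiff ℝ 2 f → Function.Periodic f (2 * Real.pi) →
      J (c • f) = c • J f)
    (hJdense : Dense {x : X | ∃ f : ℝ → ℂ, ContDiff ℝ 2 f ∧
      Function.Periodic f (2 * Real.pi) ∧ J f = x})
    (T T' : ℝ → X →L[ℂ] X)
    (hT0 : T 0 = ContinuousLinearMap.id ℂ X)
    (hTadd : ∀ s t : ℝ, 0 ≤ s → 0 ≤ t → T (s + t) = (T s).comp (T t))
    (hTcontr : ∀ t : ℝ, 0 ≤ t → ‖T t‖ ≤ 1)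
    (hTode : ∀ f : ℝ → ℂ, ContDiff ℝ 2 f → Function.Periodic f (2 * Real.pi) →
      ∀ t : ℝ, 0 ≤ t → ∃ g : ℝ → ℂ, ContDiff ℝ 2 g ∧ Function.Periodic g (2 * Real.pi) ∧
        T t (J f) = J g ∧
        HasDerivWithinAt (fun s => T s (J f))
          (J fun y => (ν : ℂ) * deriv (deriv g) y - Complex.I * (k : ℂ) * (u y : ℂ) * g y)
          (Set.Ici 0) t)
    (hT'0 : T' 0 = ContinuousLinearMap.id ℂ X)
    (hT'add : ∀ s t : ℝ, 0 ≤ s → 0 ≤ t → T' (s + t) = (T' s).comp (T' t))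
    (hT'contr : ∀ t : ℝ, 0 ≤ t → ‖T' t‖ ≤ 1)
    (hT'ode : ∀ f : ℝ → ℂ, ContDiff ℝ 2 f → Function.Periodic f (2 * Real.pi) →
      ∀ t : ℝ, 0 ≤ t → ∃ g : ℝ → ℂ, ContDiff ℝ 2 g ∧ Function.Periodic g (2 * Real.pi) ∧
        T' t (J f) = J g ∧
        HasDerivWithinAt (fun s => T' s (J f))
          (J fun y => (ν : ℂ) * (deriv (deriv g) y - (k : ℂ) ^ 2 * g y)
            - Complex.I * (k : ℂ) * (u y : ℂ) * g y)
          (Set.Ici 0) t) :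
    ∀ t : ℝ, 0 ≤ t → ∀ x : X,
      ‖T t x‖ ≤ Real.exp (Real.pi / 2) *
        Real.exp (-((phiInv C₁) ^ 2 * ν ^ (α / (α + 2)) * |(k : ℝ)| ^ (2 / (α + 2))) * t)
          * ‖x‖ ∧
      ‖T' t x‖ ≤ Real.exp (Real.pi / 2) *
        Real.exp (-((phiInv C₁) ^ 2 * ν ^ (α / (α + 2)) * |(k : ℝ)| ^ (2 / (α + 2))) * t)
          * ‖x‖ := by
  have hkR : (k : ℝ) ≠ 0 := Int.cast_ne_zero.2 hk
  have hk2 : 0 ≤ ν * (k : ℝ) ^ 2 := by positivity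
  refine fun t ht x => ⟨?_, ?_⟩
  · refine norm_apply_le_exp_of_shear hα hC₁ hu huper hψ hlow hν hkR hνk le_rfl hJnorm hJadd hJsmul
      hJdense hT0 hTadd hTcontr (fun f hf hfper s hs => ?_) ht x
    obtain ⟨g, hg, hgper, hfg, hd⟩ := hTode f hf hfper s hs
    refine ⟨g, hg, hgper, hfg, hd.congr_deriv (congrArg J (funext fun y => ?_))⟩
    push_cast
    ring
  · refine norm_apply_le_exp_of_shear hα hC₁ hu huper hψ hlow hν hkR hνk hk2 hJnorm hJadd hJsmul
      hJdense hT'0 hT'add hT'contr (fun f hf hfper s hs => ?_) ht x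
    obtain ⟨g, hg, hgper, hfg, hd⟩ := hT'ode f hf hfper s hs
    refine ⟨g, hg, hgper, hfg, hd.congr_deriv (congrArg J (funext fun y => ?_))⟩
    push_cast
    ring
end

section
/- Let (a_n)_{n≥1} be real numbers with a_n ≠ 0 and 1 ≤ |a_n|/|a_{n+1}| ≤ 3 for all n, and set ψ(y) = −Σ_{n=1}^∞ (a_n/3^n) cos(3^n y) (the series converges absolutely and uniformly). Let m be a positive integer and h = 3^{−m−1} π, and define Δ_h³ψ(y) = ψ(y) − 3ψ(y+h) + 3ψ(y+2h) − ψ(y+3h). Then for every x ∈ ℝ: ∫_{x−3h}^{x} (Δ_h³ψ(y))² dy ≥ (3/10)² · (|a_m|/3^m)² · 3h = (9π/100) · 3^{−3m} a_m². -/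
open MeasureTheory

theorem third_difference_cos (k y h : ℝ) :
    Real.cos (k * y) - 3 * Real.cos (k * (y + h)) + 3 * Real.cos (k * (y + 2 * h))
      - Real.cos (k * (y + 3 * h))
      = -8 * Real.sin (k * h / 2) ^ 3 * Real.sin (k * (y + 3 * h / 2)) := by
  set u := k * (y + 3 * h / 2) with hu
  set v := k * h / 2 with hv
  have h0 : k * y = u - 3 * v := by rw [hu, hv]; ring
  have h1 : k * (y + h) = u - v := by rw [hu, hv]; ring
  have h2 : k * (y + 2 * h) = u + v := by rw [hu, hv]; ring
  have h3 : k * (y + 3 * h) = u + 3 * v := by rw [hu, hv]; ring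
  rw [h0, h1, h2, h3, Real.cos_sub, Real.cos_sub, Real.cos_add, Real.cos_add,
    Real.sin_three_mul]
  ring

theorem abs_third_difference_cos_le (k y h : ℝ) :
    |Real.cos (k * y) - 3 * Real.cos (k * (y + h)) + 3 * Real.cos (k * (y + 2 * h))
      - Real.cos (k * (y + 3 * h))| ≤ |k * h| ^ 3 := by
  rw [third_difference_cos, abs_mul, abs_mul, abs_pow]
  have h1 : |Real.sin (k * h / 2)| ≤ |k * h| / 2 := by
    refine Real.abs_sin_le_abs.trans_eq ?_
    rw [abs_div, abs_two]
  have h2 : |Real.sin (k * h / 2)| ^ 3 ≤ (|k * h| / 2) ^ 3 := by gcongr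
  have h3 := Real.abs_sin_le_one (k * (y + 3 * h / 2))
  have h4 : |(-8 : ℝ)| = 8 := by norm_num
  rw [h4]
  calc 8 * |Real.sin (k * h / 2)| ^ 3 * |Real.sin (k * (y + 3 * h / 2))|
      ≤ 8 * |Real.sin (k * h / 2)| ^ 3 * 1 := by gcongr
    _ ≤ 8 * (|k * h| / 2) ^ 3 * 1 := by gcongr
    _ = |k * h| ^ 3 := by ring

theorem cos_add_three_pow_mul_pi (t : ℝ) (j : ℕ) :
    Real.cos (t + 3 ^ j * Real.pi) = -Real.cos t := by
  induction j with
  | zero => simp [Real.cos_add_pi]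
  | succ j ih =>
    have h1 : t + 3 ^ (j + 1) * Real.pi
        = t + 3 ^ j * Real.pi + ((3 ^ j : ℕ) : ℝ) * (2 * Real.pi) := by
      push_cast; ring
    rw [h1, Real.cos_add_nat_mul_two_pi, ih]

theorem integral_cos_even_mul {ω : ℝ} (hω : 0 < ω) {k : ℤ} (hk : k ≠ 0) (x : ℝ) :
    ∫ y in (x - Real.pi / ω)..x, Real.cos (2 * k * ω * y) = 0 := by
  have hk' : (k : ℝ) ≠ 0 := by exact_mod_cast hk
  have hc : 2 * (k : ℝ) * ω ≠ 0 := by positivity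
  rw [intervalIntegral.integral_comp_mul_left (fun t => Real.cos t) hc, integral_cos]
  have h1 : 2 * (k : ℝ) * ω * (x - Real.pi / ω)
      = 2 * k * ω * x - k * (2 * Real.pi) := by
    field_simp
  rw [h1, Real.sin_sub_int_mul_two_pi]
  simp

theorem integral_cos_three_pow_mul_cos {ω : ℝ} (hω : 0 < ω) {i j : ℕ} (hij : i ≠ j) (x : ℝ) :
    ∫ y in (x - Real.pi / ω)..x,
      Real.cos (3 ^ i * ω * y) * Real.cos (3 ^ j * ω * y) = 0 := by
  obtain ⟨p, hp⟩ : Odd ((3 : ℤ) ^ i) := Odd.pow (by decide)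
  obtain ⟨q, hq⟩ : Odd ((3 : ℤ) ^ j) := Odd.pow (by decide)
  have hne : (3 : ℤ) ^ i ≠ 3 ^ j := fun h => hij (Int.pow_right_injective (by norm_num) h)
  have hpi : 0 < (3 : ℤ) ^ i := by positivity
  have hqi : 0 < (3 : ℤ) ^ j := by positivity
  have hp' : (3 : ℝ) ^ i = 2 * p + 1 := by exact_mod_cast hp
  have hq' : (3 : ℝ) ^ j = 2 * q + 1 := by exact_mod_cast hq
  have h1 : ∀ y : ℝ, Real.cos (3 ^ i * ω * y) * Real.cos (3 ^ j * ω * y)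
      = (Real.cos (2 * ((p - q : ℤ) : ℝ) * ω * y)
        + Real.cos (2 * ((p + q + 1 : ℤ) : ℝ) * ω * y)) / 2 := by
    intro y
    have e1 : 2 * ((p - q : ℤ) : ℝ) * ω * y = 3 ^ i * ω * y - 3 ^ j * ω * y := by
      rw [hp', hq']; push_cast; ring
    have e2 : 2 * ((p + q + 1 : ℤ) : ℝ) * ω * y = 3 ^ i * ω * y + 3 ^ j * ω * y := by
      rw [hp', hq']; push_cast; ring
    rw [e1, e2, Real.cos_sub, Real.cos_add]
    ring
  simp_rw [h1]
  rw [intervalIntegral.integral_div, intervalIntegral.integral_add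
    (Continuous.intervalIntegrable (by fun_prop) _ _)
    (Continuous.intervalIntegrable (by fun_prop) _ _),
    integral_cos_even_mul hω (by omega), integral_cos_even_mul hω (by omega)]
  simp

theorem integral_cos_three_pow_sq {ω : ℝ} (hω : 0 < ω) (i : ℕ) (x : ℝ) :
    ∫ y in (x - Real.pi / ω)..x, Real.cos (3 ^ i * ω * y) ^ 2 = Real.pi / ω / 2 := by
  have h1 : ∀ y : ℝ, Real.cos (3 ^ i * ω * y) ^ 2
      = 1 / 2 + Real.cos (2 * ((3 ^ i : ℤ) : ℝ) * ω * y) / 2 := by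
    intro y
    rw [Real.cos_sq]
    push_cast
    ring_nf
  simp_rw [h1]
  rw [intervalIntegral.integral_add
    (Continuous.intervalIntegrable (by fun_prop) _ _)
    (Continuous.intervalIntegrable (by fun_prop) _ _), intervalIntegral.integral_div,
    intervalIntegral.integral_div, integral_cos_even_mul hω (by positivity)]
  simp

theorem continuous_tsum_mul_cos {c : ℕ → ℝ} (hc : Summable fun n => |c n|) (f : ℕ → ℝ) :
    Continuous fun y : ℝ => ∑' n, c n * Real.cos (f n * y) := by
  refine continuous_tsum (fun n => by fun_prop) hc fun n y => ?_
  rw [Real.norm_eq_abs, abs_mul]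
  exact mul_le_of_le_one_right (abs_nonneg _) (Real.abs_cos_le_one _)

theorem summable_mul_cos {c : ℕ → ℝ} (hc : Summable fun n => |c n|) (f : ℕ → ℝ) (y : ℝ) :
    Summable fun n => c n * Real.cos (f n * y) := by
  refine Summable.of_norm_bounded hc fun n => ?_
  rw [Real.norm_eq_abs, abs_mul]
  exact mul_le_of_le_one_right (abs_nonneg _) (Real.abs_cos_le_one _)

theorem integral_cos_mul_tsum {ω : ℝ} (hω : 0 < ω) {c : ℕ → ℝ}
    (hc : Summable fun n => |c n|) {j N : ℕ} (hj : j < N) (x : ℝ) :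
    ∫ y in (x - Real.pi / ω)..x, Real.cos (3 ^ j * ω * y) *
      ∑' n, c n * Real.cos (3 ^ (n + N) * ω * y) = 0 := by
  have key := intervalIntegral.hasSum_integral_of_dominated_convergence
    (μ := volume) (a := x - Real.pi / ω) (b := x)
    (F := fun n y => Real.cos (3 ^ j * ω * y) * (c n * Real.cos (3 ^ (n + N) * ω * y)))
    (f := fun y => Real.cos (3 ^ j * ω * y) * ∑' n, c n * Real.cos (3 ^ (n + N) * ω * y))
    (fun n _ => |c n|)
    (fun n => Continuous.aestronglyMeasurable (by fun_prop))
    (fun n => Filter.Eventually.of_forall fun y _ => by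
      rw [Real.norm_eq_abs, abs_mul, abs_mul]
      calc _ ≤ 1 * (|c n| * 1) := by
            gcongr <;> exact Real.abs_cos_le_one _
        _ = |c n| := by ring)
    (Filter.Eventually.of_forall fun y _ => hc)
    (by simp)
    (Filter.Eventually.of_forall fun y _ =>
      (summable_mul_cos hc (fun n => 3 ^ (n + N) * ω) y).hasSum.mul_left _)
  have hz : ∀ n, ∫ y in (x - Real.pi / ω)..x,
      Real.cos (3 ^ j * ω * y) * (c n * Real.cos (3 ^ (n + N) * ω * y)) = 0 := by
    intro n
    have h1 : ∀ y : ℝ, Real.cos (3 ^ j * ω * y) * (c n * Real.cos (3 ^ (n + N) * ω * y))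
        = c n * (Real.cos (3 ^ j * ω * y) * Real.cos (3 ^ (n + N) * ω * y)) := by
      intro y; ring
    simp_rw [h1]
    rw [intervalIntegral.integral_const_mul, integral_cos_three_pow_mul_cos hω (by omega),
      mul_zero]
  simp_rw [hz] at key
  exact key.unique hasSum_zero

theorem integral_two_mode_lower {ω : ℝ} (hω : 0 < ω) {c : ℕ → ℝ}
    (hc : Summable fun n => |c n|) (B C K x : ℝ) :
    ∫ y in (x - Real.pi / ω)..x,
      (2 / 5 * (B * Real.cos (3 ^ 0 * ω * y) + C * Real.cos (3 ^ 1 * ω * y)) ^ 2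
        + 4 / 5 * (B * Real.cos (3 ^ 0 * ω * y) + C * Real.cos (3 ^ 1 * ω * y))
          * (∑' n, c n * Real.cos (3 ^ (n + 2) * ω * y)) - K)
      = Real.pi / ω * ((B ^ 2 + C ^ 2) / 5 - K) := by
  have hT : Continuous fun y : ℝ => ∑' n, c n * Real.cos (3 ^ (n + 2) * ω * y) :=
    continuous_tsum_mul_cos hc fun n => 3 ^ (n + 2) * ω
  have i0 := integral_cos_three_pow_sq hω 0 x
  have i1 := integral_cos_three_pow_sq hω 1 x
  have i2 := integral_cos_three_pow_mul_cos hω (i := 0) (j := 1) (by norm_num) x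
  have i3 := integral_cos_mul_tsum hω hc (j := 0) (N := 2) (by norm_num) x
  have i4 := integral_cos_mul_tsum hω hc (j := 1) (N := 2) (by norm_num) x
  set T : ℝ → ℝ := fun y => ∑' n, c n * Real.cos (3 ^ (n + 2) * ω * y) with hTdef
  set u : ℝ → ℝ := fun y => Real.cos (3 ^ 0 * ω * y) with hu
  set v : ℝ → ℝ := fun y => Real.cos (3 ^ 1 * ω * y) with hv
  have hcu : Continuous u := by fun_prop
  have hcv : Continuous v := by fun_prop
  change ∫ y in (x - Real.pi / ω)..x, u y ^ 2 = _ at i0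
  change ∫ y in (x - Real.pi / ω)..x, v y ^ 2 = _ at i1
  change ∫ y in (x - Real.pi / ω)..x, u y * v y = _ at i2
  change ∫ y in (x - Real.pi / ω)..x, u y * T y = _ at i3
  change ∫ y in (x - Real.pi / ω)..x, v y * T y = _ at i4
  change ∫ y in (x - Real.pi / ω)..x,
    (2 / 5 * (B * u y + C * v y) ^ 2 + 4 / 5 * (B * u y + C * v y) * T y - K) = _
  have h1 : ∀ y, 2 / 5 * (B * u y + C * v y) ^ 2 + 4 / 5 * (B * u y + C * v y) * T y - K
      = (2 / 5 * B ^ 2) * u y ^ 2 + (2 / 5 * C ^ 2) * v y ^ 2 + (4 / 5 * B * C) * (u y * v y)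
        + (4 / 5 * B) * (u y * T y) + (4 / 5 * C) * (v y * T y) - K := by
    intro y; ring
  simp_rw [h1]
  clear_value T u v
  rw [intervalIntegral.integral_sub, intervalIntegral.integral_add, intervalIntegral.integral_add,
    intervalIntegral.integral_add, intervalIntegral.integral_add]
  · simp only [intervalIntegral.integral_const_mul, i0, i1, i2, i3, i4,
      intervalIntegral.integral_const, smul_eq_mul]
    ring
  all_goals exact Continuous.intervalIntegrable (by fun_prop) _ _

theorem abs_le_three_pow_mul {a : ℕ → ℝ} (h : ∀ n, 1 ≤ n → |a n| ≤ 3 * |a (n + 1)|)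
    {n : ℕ} (hn : 1 ≤ n) (k : ℕ) : |a n| ≤ 3 ^ k * |a (n + k)| := by
  induction k with
  | zero => simp
  | succ k ih =>
    calc |a n| ≤ 3 ^ k * |a (n + k)| := ih
      _ ≤ 3 ^ k * (3 * |a (n + k + 1)|) := by gcongr; exact h _ (by omega)
      _ = 3 ^ (k + 1) * |a (n + (k + 1))| := by rw [add_assoc]; ring

theorem abs_sum_low_third_difference_le {a : ℕ → ℝ}
    (h : ∀ n, 1 ≤ n → |a n| ≤ 3 * |a (n + 1)|) (p : ℕ) (y : ℝ) {s : ℝ}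
    (hs : s = Real.pi / 3 ^ (p + 2)) :
    |∑ i ∈ Finset.range p, a (i + 1) / 3 ^ (i + 1) *
      (Real.cos (3 ^ (i + 1) * y) - 3 * Real.cos (3 ^ (i + 1) * (y + s))
        + 3 * Real.cos (3 ^ (i + 1) * (y + 2 * s)) - Real.cos (3 ^ (i + 1) * (y + 3 * s)))|
      ≤ 3 / 5 * (|a (p + 1)| / 3 ^ (p + 1)) := by
  have hs0 : 0 < s := by rw [hs]; positivity
  have hterm : ∀ i ∈ Finset.range p, |a (i + 1) / 3 ^ (i + 1) *
      (Real.cos (3 ^ (i + 1) * y) - 3 * Real.cos (3 ^ (i + 1) * (y + s))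
        + 3 * Real.cos (3 ^ (i + 1) * (y + 2 * s)) - Real.cos (3 ^ (i + 1) * (y + 3 * s)))|
      ≤ |a (p + 1)| * 3 ^ (p + 2) * s ^ 3 * 3 ^ i := by
    intro i hi
    obtain ⟨k, rfl⟩ := Nat.exists_eq_add_of_lt (Finset.mem_range.mp hi)
    have h1 := abs_le_three_pow_mul h (n := i + 1) (by omega) (k + 1)
    have h2 := abs_third_difference_cos_le (3 ^ (i + 1)) y s
    rw [abs_of_pos (show (0 : ℝ) < 3 ^ (i + 1) * s by positivity)] at h2
    rw [abs_mul, abs_div, abs_of_pos (show (0 : ℝ) < 3 ^ (i + 1) by positivity)]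
    rw [show i + 1 + (k + 1) = i + k + 1 + 1 by ring] at h1
    calc _ ≤ (3 ^ (k + 1) * |a (i + k + 1 + 1)|) / 3 ^ (i + 1) * (3 ^ (i + 1) * s) ^ 3 := by
          gcongr
      _ = _ := by
          field_simp
          ring
  refine (Finset.abs_sum_le_sum_abs _ _).trans ((Finset.sum_le_sum hterm).trans ?_)
  rw [← Finset.mul_sum, geom_sum_eq (by norm_num)]
  have hpi : Real.pi ^ 3 ≤ 3.15 ^ 3 := by
    gcongr
    exact Real.pi_lt_d2.le
  have hpos : (0 : ℝ) < 3 ^ p := by positivity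
  calc |a (p + 1)| * 3 ^ (p + 2) * s ^ 3 * ((3 ^ p - 1) / (3 - 1))
      ≤ |a (p + 1)| * 3 ^ (p + 2) * s ^ 3 * (3 ^ p / 2) := by
        gcongr
        · linarith
        · norm_num
    _ = Real.pi ^ 3 / 54 * (|a (p + 1)| / 3 ^ (p + 1)) := by
        rw [hs]
        field_simp
        ring
    _ ≤ 3 / 5 * (|a (p + 1)| / 3 ^ (p + 1)) := by
        refine mul_le_mul_of_nonneg_right ?_ (by positivity)
        norm_num at hpi
        linarith

theorem summable_abs_div_three_pow {a : ℕ → ℝ} (h : ∀ n, 1 ≤ n → |a (n + 1)| ≤ |a n|) :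
    Summable fun n : ℕ => |a (n + 1) / 3 ^ (n + 1)| := by
  have hb : ∀ n, |a (n + 1)| ≤ |a 1| := by
    intro n
    induction n with
    | zero => simp
    | succ n ih => exact (h (n + 1) (by omega)).trans ih
  have hg : Summable fun n : ℕ => |a 1| * (1 / 3 : ℝ) ^ n :=
    (summable_geometric_of_lt_one (by norm_num) (by norm_num)).mul_left _
  refine Summable.of_nonneg_of_le (fun n => abs_nonneg _) (fun n => ?_) hg
  rw [abs_div, abs_of_pos (show (0 : ℝ) < 3 ^ (n + 1) by positivity), one_div, inv_pow,
    ← div_eq_mul_inv]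
  refine div_le_div₀ (abs_nonneg _) (hb n) (by positivity) ?_
  exact pow_le_pow_right₀ (by norm_num) n.le_succ

/-- Lower bound for the third difference of the antiderivative
`ψ(y) = -Σ_{n≥1} (a_n/3^n) cos(3^n y)` of a Weierstrass-type shear profile:
if `a_n ≠ 0` and `1 ≤ |a_n|/|a_{n+1}| ≤ 3`, then for `h = 3^{-m-1}π`,
`∫_{x-3h}^x (Δ_h³ψ)² dy ≥ (3/10)² (|a_m|/3^m)² (3h) = (9π/100) 3^{-3m} a_m²`
for every `x`. -/
theorem stmt_15 (a : ℕ → ℝ) (ha : ∀ n : ℕ, 1 ≤ n → a n ≠ 0)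
    (hrat : ∀ n : ℕ, 1 ≤ n → 1 ≤ |a n| / |a (n + 1)| ∧ |a n| / |a (n + 1)| ≤ 3)
    (ψ : ℝ → ℝ)
    (hψ : ∀ y, ψ y = -∑' n : ℕ, (a (n + 1) / 3 ^ (n + 1)) * Real.cos (3 ^ (n + 1) * y))
    (m : ℕ) (hm : 1 ≤ m) (h : ℝ) (hh : h = Real.pi / 3 ^ (m + 1)) :
    ∀ x : ℝ, (9 * Real.pi / 100) * (a m) ^ 2 / 3 ^ (3 * m) ≤
      ∫ y in (x - 3 * h)..x,
        (ψ y - 3 * ψ (y + h) + 3 * ψ (y + 2 * h) - ψ (y + 3 * h)) ^ 2 := by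
  intro x
  obtain ⟨p, rfl⟩ : ∃ p, m = p + 1 := ⟨m - 1, by omega⟩
  have hpos : ∀ n, 0 < |a (n + 1)| := fun n => abs_pos.mpr (ha _ (by omega))
  have hdec : ∀ n, 1 ≤ n → |a (n + 1)| ≤ |a n| := fun n hn => by
    have h1 := (hrat n hn).1
    rwa [le_div_iff₀ (hpos n), one_mul] at h1
  have hgrow : ∀ n, 1 ≤ n → |a n| ≤ 3 * |a (n + 1)| := fun n hn => by
    have h1 := (hrat n hn).2
    rwa [div_le_iff₀ (hpos n)] at h1
  have hsum := summable_abs_div_three_pow hdec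
  have hψc : Continuous ψ := by
    rw [funext hψ]
    exact (continuous_tsum_mul_cos hsum fun n => 3 ^ (n + 1)).neg
  set ω : ℝ := 3 ^ (p + 1) with hω_def
  have hω : 0 < ω := by positivity
  have h3h : 3 * h = Real.pi / ω := by
    rw [hh, hω_def]; field_simp; ring
  set B : ℝ := a (p + 1) / 3 ^ (p + 1) with hB
  set C : ℝ := a (p + 2) / 3 ^ (p + 2) with hC
  set c : ℕ → ℝ := fun n => -8 * (a (n + p + 3) / 3 ^ (n + p + 3)) with hc_def
  have hc : Summable fun n => |c n| := by
    have h1 := ((summable_nat_add_iff (p + 2)).mpr hsum).mul_left 8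
    refine h1.congr fun n => ?_
    simp only [hc_def, abs_mul]
    norm_num
    rfl
  set P : ℝ → ℝ := fun y =>
    ∑ i ∈ Finset.range p, a (i + 1) / 3 ^ (i + 1) * Real.cos (3 ^ (i + 1) * y) with hP
  set T : ℝ → ℝ := fun y => ∑' n, c n * Real.cos (3 ^ (n + 2) * ω * y) with hT
  have hdecomp : ∀ y, ψ y = -P y - B * Real.cos (ω * y) - C * Real.cos (3 * ω * y)
      + T y / 8 := by
    intro y
    have h1 := (summable_mul_cos hsum (fun n => 3 ^ (n + 1)) y).sum_add_tsum_nat_add (p + 2)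
    rw [hψ, ← h1, Finset.sum_range_succ, Finset.sum_range_succ]
    have h2 : T y = -8 * ∑' n, a (n + (p + 2) + 1) / 3 ^ (n + (p + 2) + 1)
        * Real.cos (3 ^ (n + (p + 2) + 1) * y) := by
      rw [hT, ← tsum_mul_left]
      refine tsum_congr fun n => ?_
      simp only [hc_def, hω_def]
      rw [show (3 : ℝ) ^ (n + 2) * 3 ^ (p + 1) = 3 ^ (n + (p + 2) + 1) by ring,
        show n + p + 3 = n + (p + 2) + 1 by ring]
      ring
    have h3 : (3 : ℝ) ^ (p + 1 + 1) = 3 * ω := by rw [hω_def]; ring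
    rw [h2, hC, show p + 2 = p + 1 + 1 by ring, h3]
    simp only [hP, hB, hω_def]
    ring
  have hTh : ∀ y, T (y + h) = -T y := by
    intro y
    simp only [hT]
    rw [← tsum_neg]
    refine tsum_congr fun n => ?_
    have h1 : 3 ^ (n + 2) * ω * (y + h) = 3 ^ (n + 2) * ω * y + 3 ^ (n + 1) * Real.pi := by
      rw [hh, hω_def]; field_simp; ring
    rw [h1, cos_add_three_pow_mul_pi]
    ring
  have hCh : ∀ y, Real.cos (3 * ω * (y + h)) = -Real.cos (3 * ω * y) := by
    intro y
    have h1 : 3 * ω * (y + h) = 3 * ω * y + 3 ^ 0 * Real.pi := by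
      rw [hh, hω_def]; field_simp; ring
    rw [h1, cos_add_three_pow_mul_pi]
  have hBh : ∀ y, Real.cos (ω * y) - 3 * Real.cos (ω * (y + h)) + 3 * Real.cos (ω * (y + 2 * h))
      - Real.cos (ω * (y + 3 * h)) = -Real.cos (ω * y) := by
    intro y
    have h1 : ω * h / 2 = Real.pi / 6 := by
      rw [hh, hω_def]; field_simp; ring
    have h2 : ω * (y + 3 * h / 2) = ω * y + Real.pi / 2 := by
      rw [h3h]; field_simp
    rw [third_difference_cos, h1, h2, Real.sin_pi_div_six, Real.sin_add_pi_div_two]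
    ring
  have hlow : ∀ y, |P y - 3 * P (y + h) + 3 * P (y + 2 * h) - P (y + 3 * h)| ≤ 3 / 5 * |B| := by
    intro y
    have h1 := abs_sum_low_third_difference_le hgrow p y hh
    rw [hB, abs_div, abs_of_pos (show (0 : ℝ) < 3 ^ (p + 1) by positivity)]
    convert h1 using 2
    simp only [hP, Finset.mul_sum, ← Finset.sum_sub_distrib, ← Finset.sum_add_distrib]
    exact Finset.sum_congr rfl fun i _ => by ring
  have hpt : ∀ y, 2 / 5 * (B * Real.cos (3 ^ 0 * ω * y) + -8 * C * Real.cos (3 ^ 1 * ω * y)) ^ 2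
        + 4 / 5 * (B * Real.cos (3 ^ 0 * ω * y) + -8 * C * Real.cos (3 ^ 1 * ω * y))
          * T y - 6 / 25 * B ^ 2
      ≤ (ψ y - 3 * ψ (y + h) + 3 * ψ (y + 2 * h) - ψ (y + 3 * h)) ^ 2 := by
    intro y
    set L := P y - 3 * P (y + h) + 3 * P (y + 2 * h) - P (y + 3 * h) with hL
    set g := B * Real.cos (3 ^ 0 * ω * y) + -8 * C * Real.cos (3 ^ 1 * ω * y) with hg
    have e2 : y + 2 * h = y + h + h := by ring
    have e3 : y + 3 * h = y + h + h + h := by ring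
    have hD : ψ y - 3 * ψ (y + h) + 3 * ψ (y + 2 * h) - ψ (y + 3 * h) = g + T y - L := by
      have c2 : Real.cos (3 * ω * (y + 2 * h)) = Real.cos (3 * ω * y) := by
        rw [e2, hCh, hCh, neg_neg]
      have c3 : Real.cos (3 * ω * (y + 3 * h)) = -Real.cos (3 * ω * y) := by
        rw [e3, hCh, hCh, hCh, neg_neg]
      have t2 : T (y + 2 * h) = T y := by rw [e2, hTh, hTh, neg_neg]
      have t3 : T (y + 3 * h) = -T y := by rw [e3, hTh, hTh, hTh, neg_neg]
      rw [hdecomp, hdecomp, hdecomp, hdecomp, hCh, c2, c3, hTh, t2, t3, hL, hg, pow_zero, pow_one,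
        one_mul]
      linear_combination -B * hBh y
    have hL2 : L ^ 2 ≤ 9 / 25 * B ^ 2 := by
      have h1 := pow_le_pow_left₀ (abs_nonneg L) (hlow y) 2
      rw [sq_abs, mul_pow, sq_abs] at h1
      linarith
    rw [hD]
    nlinarith [sq_nonneg (3 * (g + T y) - 5 * L), sq_nonneg (T y)]
  have hint := integral_two_mode_lower hω hc B (-8 * C) (6 / 25 * B ^ 2) x
  have hTc : Continuous T := continuous_tsum_mul_cos hc fun n => 3 ^ (n + 2) * ω
  have hmono := intervalIntegral.integral_mono_on (μ := volume) (a := x - Real.pi / ω) (b := x)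
    (by have : 0 < Real.pi / ω := by positivity
        linarith)
    (Continuous.intervalIntegrable (by fun_prop) _ _)
    (Continuous.intervalIntegrable (by fun_prop) _ _) (fun y _ => hpt y)
  rw [h3h] at hmono ⊢
  refine le_trans ?_ (hint.symm.le.trans hmono)
  have hCB : B ^ 2 / 81 ≤ C ^ 2 := by
    have h1 := pow_le_pow_left₀ (abs_nonneg _) (hgrow (p + 1) (by omega)) 2
    rw [mul_pow, sq_abs, sq_abs] at h1
    rw [hB, hC, div_pow, div_pow, div_div, div_le_div_iff₀ (by positivity) (by positivity)]
    have h2 : ((3 : ℝ) ^ (p + 2)) ^ 2 = 9 * (3 ^ (p + 1)) ^ 2 := by ring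
    rw [h2]
    have h3 : (0 : ℝ) < (3 ^ (p + 1)) ^ 2 := by positivity
    nlinarith
  have hlhs : 9 * Real.pi / 100 * a (p + 1) ^ 2 / 3 ^ (3 * (p + 1))
      = Real.pi / ω * (9 / 100 * B ^ 2) := by
    rw [hB, hω_def]
    field_simp
    ring
  rw [hlhs]
  gcongr
  nlinarith [sq_nonneg B]
end

section
/- There exists a constant C > 0 such that the following holds. Let (a_n)_{n≥1} be real numbers with a_n ≠ 0 and 1 ≤ |a_n|/|a_{n+1}| ≤ 3 for all n, and let u(y) = Σ_{n=1}^∞ a_n sin(3^n y). Then for every positive integer m: ω₁(3^{−m} π, u) ≥ C^{−1} 3^{−3m} a_m². -/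
open Real intervalIntegral in
lemma integral_cos_add_mul (c : ℝ) {k : ℝ} (hk : k ≠ 0) :
    ∫ s in -π..π, cos (c + k * s) = 2 * cos c * sin (k * π) / k := by
  have h : ∀ s ∈ Set.uIcc (-π) π,
      HasDerivAt (fun s => sin (c + k * s) / k) (cos (c + k * s)) s := fun s _ => by
    have := ((((hasDerivAt_id s).const_mul k).const_add c).sin).div_const k
    refine this.congr_deriv ?_
    simp only [id]
    field_simp
  rw [integral_eq_sub_of_hasDerivAt h (by apply Continuous.intervalIntegrable; fun_prop)]
  rw [mul_neg, sin_add, sin_add, sin_neg, cos_neg]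
  ring

open Real intervalIntegral in
lemma integral_id_mul_cos_add_mul (c : ℝ) {k : ℝ} (hk : k ≠ 0) :
    ∫ s in -π..π, s * cos (c + k * s) =
      2 * π * sin c * cos (k * π) / k - 2 * sin c * sin (k * π) / k ^ 2 := by
  have h : ∀ s ∈ Set.uIcc (-π) π,
      HasDerivAt (fun s => s * sin (c + k * s) / k + cos (c + k * s) / k ^ 2)
        (s * cos (c + k * s)) s := fun s _ => by
    have h₀ := ((hasDerivAt_id s).const_mul k).const_add c
    have := (((hasDerivAt_id s).mul h₀.sin).div_const k).add (h₀.cos.div_const (k ^ 2))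
    refine this.congr_deriv ?_
    simp only [id]
    field_simp
    ring
  rw [integral_eq_sub_of_hasDerivAt h (by apply Continuous.intervalIntegrable; fun_prop)]
  rw [mul_neg, sin_add, sin_add, cos_add, cos_add, sin_neg, cos_neg]
  ring

open Real intervalIntegral in
lemma integral_cos_mul_cos (α β r p : ℝ) :
    ∫ s in -π..π, cos (α + r * s) * cos (β + p * s) =
      ((∫ s in -π..π, cos ((α + β) + (r + p) * s)) +
        ∫ s in -π..π, cos ((α - β) + (r - p) * s)) / 2 := by
  rw [← integral_add (by apply Continuous.intervalIntegrable; fun_prop)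
    (by apply Continuous.intervalIntegrable; fun_prop), ← integral_div]
  refine integral_congr fun s _ => ?_
  rw [show α + β + (r + p) * s = (α + r * s) + (β + p * s) by ring,
    show α - β + (r - p) * s = (α + r * s) - (β + p * s) by ring, cos_add (α + r * s),
    cos_sub (α + r * s)]
  ring

/-- A trigonometric polynomial with frequencies `1` and `2` which is orthogonal on `[-π, π]`
to affine functions. -/
noncomputable def testFn (θ s : ℝ) : ℝ :=
  Real.cos (θ + 1 * s) + 3 * Real.cos (θ + 2 * s) + Real.cos (-θ + 2 * s)

lemma continuous_testFn (θ : ℝ) : Continuous (testFn θ) := by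
  unfold testFn
  fun_prop

lemma abs_testFn_le (θ s : ℝ) : |testFn θ s| ≤ 5 := by
  unfold testFn
  rw [abs_le]
  constructor <;>
  linarith [Real.cos_le_one (θ + 1 * s), Real.cos_le_one (θ + 2 * s),
    Real.cos_le_one (-θ + 2 * s), Real.neg_one_le_cos (θ + 1 * s),
    Real.neg_one_le_cos (θ + 2 * s), Real.neg_one_le_cos (-θ + 2 * s)]

open Real intervalIntegral in
lemma integral_mul_testFn {f : ℝ → ℝ} (hf : Continuous f) (θ : ℝ) :
    ∫ s in -π..π, f s * testFn θ s =
      (∫ s in -π..π, f s * cos (θ + 1 * s)) + 3 * (∫ s in -π..π, f s * cos (θ + 2 * s)) +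
        ∫ s in -π..π, f s * cos (-θ + 2 * s) := by
  rw [← integral_const_mul, ← integral_add, ← integral_add]
  · refine integral_congr fun s _ => ?_
    simp only [testFn]
    ring
  all_goals apply Continuous.intervalIntegrable; fun_prop

open Real intervalIntegral in
lemma integral_testFn (θ : ℝ) : ∫ s in -π..π, testFn θ s = 0 := by
  have := integral_mul_testFn (f := fun _ => 1) continuous_const θ
  simp only [one_mul] at this
  rw [this]
  have h₁ := integral_cos_add_mul θ one_ne_zero
  simp only [one_mul] at h₁
  rw [h₁, integral_cos_add_mul _ two_ne_zero, integral_cos_add_mul _ two_ne_zero]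
  simp

open Real intervalIntegral in
lemma integral_id_mul_testFn (θ : ℝ) : ∫ s in -π..π, s * testFn θ s = 0 := by
  rw [integral_mul_testFn continuous_id' θ, integral_id_mul_cos_add_mul _ one_ne_zero,
    integral_id_mul_cos_add_mul _ two_ne_zero, integral_id_mul_cos_add_mul _ two_ne_zero]
  simp
  ring

open Real intervalIntegral in
lemma integral_cos_mul_testFn_self (θ : ℝ) :
    ∫ s in -π..π, cos (θ + 1 * s) * testFn θ s = π := by
  rw [integral_mul_testFn (by fun_prop)]
  simp only [integral_cos_mul_cos]
  rw [integral_cos_add_mul _ (by norm_num : (1 + 1 : ℝ) ≠ 0),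
    integral_cos_add_mul _ (by norm_num : (1 + 2 : ℝ) ≠ 0),
    integral_cos_add_mul _ (by norm_num : (1 + 2 : ℝ) ≠ 0),
    integral_cos_add_mul _ (by norm_num : (1 - 2 : ℝ) ≠ 0),
    integral_cos_add_mul _ (by norm_num : (1 - 2 : ℝ) ≠ 0)]
  have h₁ : sin ((1 + 1) * π) = 0 := by norm_num
  have h₂ : sin ((1 + 2) * π) = 0 := by
    have := sin_nat_mul_pi 3
    norm_num at this ⊢
    exact this
  have h₃ : sin ((1 - 2) * π) = 0 := by norm_num
  rw [h₁, h₂, h₃]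
  simp

open Real intervalIntegral in
lemma integral_cos_mul_testFn (α θ : ℝ) {r : ℝ} (h0 : 0 < r) (h1 : r ≠ 1) (h2 : r ≠ 2) :
    ∫ s in -π..π, cos (α + r * s) * testFn θ s =
      6 * r ^ 2 * sin (r * π) / ((1 - r ^ 2) * (4 - r ^ 2)) *
        (r * (cos α * cos θ) + sin α * sin θ) := by
  rw [integral_mul_testFn (by fun_prop)]
  have e1 : r + 1 ≠ 0 := by positivity
  have e2 : r + 2 ≠ 0 := by positivity
  have e3 : r - 1 ≠ 0 := sub_ne_zero.2 h1
  have e4 : r - 2 ≠ 0 := sub_ne_zero.2 h2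
  simp only [integral_cos_mul_cos]
  rw [integral_cos_add_mul _ e1, integral_cos_add_mul _ e2, integral_cos_add_mul _ e2,
    integral_cos_add_mul _ e3, integral_cos_add_mul _ e4, integral_cos_add_mul _ e4]
  have s1 : sin ((r + 1) * π) = -sin (r * π) := by
    rw [add_mul, one_mul, sin_add_pi]
  have s2 : sin ((r + 2) * π) = sin (r * π) := by
    rw [add_mul, sin_add_two_pi]
  have s3 : sin ((r - 1) * π) = -sin (r * π) := by
    rw [sub_mul, one_mul, sin_sub_pi]
  have s4 : sin ((r - 2) * π) = sin (r * π) := by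
    rw [sub_mul, sin_sub_two_pi]
  rw [s1, s2, s3, s4, show (1 - r ^ 2) * (4 - r ^ 2) = (r + 1) * (r + 2) * (r - 1) * (r - 2) by
    ring]
  simp only [sub_neg_eq_add, cos_add, cos_sub, cos_neg, sin_neg]
  field_simp
  ring

open Real in
lemma integral_cos_mul_testFn_eq_zero (α θ : ℝ) {k : ℕ} (hk : k ≠ 0) :
    ∫ s in -π..π, cos (α + 3 ^ k * s) * testFn θ s = 0 := by
  have h3 : (3 : ℝ) ≤ 3 ^ k := by
    simpa using pow_le_pow_right₀ (by norm_num : (1 : ℝ) ≤ 3) (Nat.one_le_iff_ne_zero.2 hk)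
  rw [integral_cos_mul_testFn α θ (by positivity) (by linarith) (by linarith)]
  have := sin_nat_mul_pi (3 ^ k)
  push_cast at this
  simp [this]

open Real in
lemma abs_integral_cos_mul_testFn_le (α θ : ℝ) {r : ℝ} (h0 : 0 < r) (h1 : r ≤ 1 / 3) :
    |∫ s in -π..π, cos (α + r * s) * testFn θ s| ≤ 1.8 * π * r ^ 3 := by
  rw [integral_cos_mul_testFn α θ h0 (by linarith) (by linarith), abs_mul, abs_div]
  have hr2 : r ^ 2 ≤ 1 / 9 := by nlinarith
  have hden : 280 / 81 ≤ (1 - r ^ 2) * (4 - r ^ 2) := by nlinarith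
  have hs : |sin (r * π)| ≤ r * π := by
    have := abs_sin_le_abs (x := r * π)
    rwa [abs_of_pos (by positivity : 0 < r * π)] at this
  have hA : |6 * r ^ 2 * sin (r * π)| / |(1 - r ^ 2) * (4 - r ^ 2)| ≤ 486 / 280 * π * r ^ 3 := by
    rw [abs_of_pos (by linarith : 0 < (1 - r ^ 2) * (4 - r ^ 2)),
      div_le_iff₀ (by linarith), abs_mul, abs_of_pos (by positivity : 0 < 6 * r ^ 2)]
    calc 6 * r ^ 2 * |sin (r * π)| ≤ 6 * r ^ 2 * (r * π) := by gcongr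
      _ = 486 / 280 * π * r ^ 3 * (280 / 81) := by ring
      _ ≤ _ := by gcongr
  have hB : |r * (cos α * cos θ) + sin α * sin θ| ≤ 1 := by
    apply abs_le_of_sq_le_sq _ (by norm_num)
    have hα := sin_sq_add_cos_sq α
    have hθ := sin_sq_add_cos_sq θ
    have key : (r * (cos α * cos θ) + sin α * sin θ) ^ 2 ≤
        (r ^ 2 * cos α ^ 2 + sin α ^ 2) * (cos θ ^ 2 + sin θ ^ 2) := by
      nlinarith [sq_nonneg (r * cos α * sin θ - sin α * cos θ)]
    rw [add_comm (cos θ ^ 2), hθ, mul_one] at key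
    nlinarith [sq_nonneg (cos α)]
  calc _ ≤ 486 / 280 * π * r ^ 3 * 1 := by gcongr
    _ = 486 / 280 * (π * r ^ 3) := by ring
    _ ≤ 1.8 * (π * r ^ 3) := by gcongr; norm_num
    _ = _ := by ring

open Real intervalIntegral in
lemma sq_integral_mul_testFn_le {F : ℝ → ℝ} (hF : Continuous F) (θ : ℝ) :
    (∫ s in -π..π, F s * testFn θ s) ^ 2 ≤ 50 * π * ∫ s in -π..π, F s ^ 2 := by
  have hg := continuous_testFn θ
  set Q := ∫ s in -π..π, F s * testFn θ s with hQ
  have hpi := pi_pos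
  have hsq : ∫ s in -π..π, testFn θ s ^ 2 ≤ 50 * π := by
    calc ∫ s in -π..π, testFn θ s ^ 2 ≤ ∫ s in -π..π, (5 : ℝ) ^ 2 := by
          refine integral_mono (by linarith) ?_ ?_ fun s => ?_
          · apply Continuous.intervalIntegrable; fun_prop
          · apply Continuous.intervalIntegrable; fun_prop
          · exact sq_le_sq.2 ((abs_testFn_le θ s).trans (by norm_num))
      _ = 50 * π := by rw [integral_const, smul_eq_mul]; ring
  set l := Q / (50 * π) with hl
  have hpos : 0 ≤ ∫ s in -π..π, (F s - l * testFn θ s) ^ 2 :=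
    integral_nonneg (by linarith) fun s _ => sq_nonneg _
  have hexp : ∫ s in -π..π, (F s - l * testFn θ s) ^ 2 =
      (∫ s in -π..π, F s ^ 2) - 2 * l * Q + l ^ 2 * ∫ s in -π..π, testFn θ s ^ 2 := by
    rw [hQ, ← integral_const_mul, ← integral_const_mul, ← integral_sub, ← integral_add]
    · refine integral_congr fun s _ => ?_
      ring
    all_goals apply Continuous.intervalIntegrable; fun_prop
  have hQl : Q = 50 * π * l := by rw [hl]; field_simp
  have h5 : l ^ 2 * ∫ s in -π..π, testFn θ s ^ 2 ≤ l ^ 2 * (50 * π) := by gcongr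
  have h6 : 50 * π * l ^ 2 ≤ ∫ s in -π..π, F s ^ 2 := by
    rw [hexp, hQl] at hpos
    linarith
  calc Q ^ 2 = 50 * π * (50 * π * l ^ 2) := by rw [hQl]; ring
    _ ≤ _ := by gcongr

open Real intervalIntegral in
lemma hasSum_integral_cos_mul_testFn {b : ℕ → ℝ} (hb : Summable fun n => |b n|)
    (t k : ℕ → ℝ) (θ : ℝ) :
    HasSum (fun n => b n * ∫ s in -π..π, cos (t n + k n * s) * testFn θ s)
      (∫ s in -π..π, (∑' n, b n * cos (t n + k n * s)) * testFn θ s) := by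
  have hg := continuous_testFn θ
  have hle : ∀ n s, |b n * cos (t n + k n * s)| ≤ |b n| := fun n s => by
    rw [abs_mul]
    exact mul_le_of_le_one_right (abs_nonneg _) (abs_cos_le_one _)
  simp only [← integral_const_mul]
  refine hasSum_integral_of_dominated_convergence (fun n _ => |b n| * 5) (fun n => ?_)
    (fun n => ?_) ?_ ?_ ?_
  · apply Continuous.aestronglyMeasurable
    fun_prop
  · refine Filter.Eventually.of_forall fun s _ => ?_
    rw [← mul_assoc, norm_mul, norm_eq_abs, norm_eq_abs]
    exact mul_le_mul (hle n s) (abs_testFn_le θ s) (abs_nonneg _) (abs_nonneg _)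
  · exact Filter.Eventually.of_forall fun s _ => hb.mul_right 5
  · exact intervalIntegrable_const
  · refine Filter.Eventually.of_forall fun s _ => ?_
    have h : Summable fun n => b n * cos (t n + k n * s) :=
      Summable.of_norm_bounded hb fun n => hle n s
    simpa only [mul_assoc] using h.hasSum.mul_right (testFn θ s)

open Real intervalIntegral in
/-- The quadratic deviation of a lacunary cosine series with coefficients `b n` and phases `t n`
from an affine function, in the variable where the frequency with index `M` equals `1`. -/
lemma sq_le_integral_lacunary {b : ℕ → ℝ} (hb : Summable fun n => |b n|) (M : ℕ)
    (hlow : ∀ n < M, |b n| * (3 ^ n / 3 ^ M) ^ 2 ≤ |b M|) (t : ℕ → ℝ) (c₁ c₂ : ℝ) :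
    b M ^ 2 ≤ 10000 * ∫ s in -π..π,
      (-(∑' n, b n * cos (t n + 3 ^ n / 3 ^ M * s)) - c₁ - c₂ * s) ^ 2 := by
  set θ := t M
  set k : ℕ → ℝ := fun n => 3 ^ n / 3 ^ M with hk
  set P : ℕ → ℝ := fun n => ∫ s in -π..π, cos (t n + k n * s) * testFn θ s with hP
  have hg := continuous_testFn θ
  have hW : Continuous fun s : ℝ => ∑' n, b n * cos (t n + k n * s) := by
    refine continuous_tsum (fun n => by fun_prop) hb fun n s => ?_
    rw [norm_mul, norm_eq_abs, norm_eq_abs]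
    exact mul_le_of_le_one_right (abs_nonneg _) (abs_cos_le_one _)
  have hPM : b M * P M = b M * π := by
    congr 1
    have : k M = 1 := by simp [hk]
    simp only [hP, this]
    exact integral_cos_mul_testFn_self θ
  have hPhigh : ∀ n, M < n → P n = 0 := fun n hn => by
    have : k n = 3 ^ (n - M) := by
      simp only [hk]
      rw [pow_sub₀ _ (by norm_num) hn.le, div_eq_mul_inv]
    simp only [hP, this]
    exact integral_cos_mul_testFn_eq_zero _ _ (by omega)
  have hPlow : ∀ n < M, |b n * P n| ≤ 1.8 * π * |b M| * k n := fun n hn => by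
    have hkpos : 0 < k n := by simp only [hk]; positivity
    have hk3 : k n ≤ 1 / 3 := by
      simp only [hk]
      rw [div_le_div_iff₀ (by positivity) (by norm_num), one_mul, ← pow_succ]
      exact pow_le_pow_right₀ (by norm_num) hn
    rw [abs_mul]
    calc |b n| * |P n| ≤ |b n| * (1.8 * π * k n ^ 3) := by
          gcongr
          exact abs_integral_cos_mul_testFn_le _ _ hkpos hk3
      _ = 1.8 * π * (|b n| * k n ^ 2) * k n := by ring
      _ ≤ _ := by
          gcongr
          exact hlow n hn
  have hsum : ∫ s in -π..π, (∑' n, b n * cos (t n + k n * s)) * testFn θ s =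
      ∑ n ∈ Finset.range M, b n * P n + b M * π := by
    rw [← hPM, ← Finset.sum_range_succ (fun n => b n * P n)]
    refine (hasSum_integral_cos_mul_testFn hb t k θ).unique (hasSum_sum_of_ne_finset_zero (s := Finset.range (M + 1)) ?_)
    intro n hn
    rw [Finset.mem_range, not_lt] at hn
    have := hPhigh n hn
    simp only [hP] at this
    rw [this, mul_zero]
  have hgeom : ∑ n ∈ Finset.range M, k n ≤ 1 / 2 := by
    simp only [hk]
    rw [← Finset.sum_div, geom_sum_eq (by norm_num), div_le_iff₀ (by positivity)]
    linarith
  have hlowsum : |∑ n ∈ Finset.range M, b n * P n| ≤ 0.9 * π * |b M| := by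
    calc |∑ n ∈ Finset.range M, b n * P n| ≤ ∑ n ∈ Finset.range M, |b n * P n| :=
          Finset.abs_sum_le_sum_abs _ _
      _ ≤ ∑ n ∈ Finset.range M, 1.8 * π * |b M| * k n :=
          Finset.sum_le_sum fun n hn => hPlow n (Finset.mem_range.1 hn)
      _ = 1.8 * π * |b M| * ∑ n ∈ Finset.range M, k n := by rw [Finset.mul_sum]
      _ ≤ 1.8 * π * |b M| * (1 / 2) := by gcongr
      _ = _ := by ring
  set F : ℝ → ℝ := fun s => -(∑' n, b n * cos (t n + k n * s)) - c₁ - c₂ * s with hF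
  have hFc : Continuous F := by simp only [hF]; fun_prop
  have hFg : ∫ s in -π..π, F s * testFn θ s =
      -(∑ n ∈ Finset.range M, b n * P n + b M * π) := by
    have : ∫ s in -π..π, F s * testFn θ s =
        -(∫ s in -π..π, (∑' n, b n * cos (t n + k n * s)) * testFn θ s)
          - c₁ * (∫ s in -π..π, testFn θ s) - c₂ * ∫ s in -π..π, s * testFn θ s := by
      rw [← integral_const_mul, ← integral_const_mul, ← integral_neg, ← integral_sub,
        ← integral_sub]
      · refine integral_congr fun s _ => ?_
        simp only [hF]
        ring
      all_goals apply Continuous.intervalIntegrable; fun_prop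
    rw [this, hsum, integral_testFn, integral_id_mul_testFn]
    ring
  have hmain := sq_integral_mul_testFn_le hFc θ
  rw [hFg, neg_sq] at hmain
  have hpi := pi_gt_three
  have hQ : 0.1 * π * |b M| ≤ |∑ n ∈ Finset.range M, b n * P n + b M * π| := by
    have h1 := abs_sub_abs_le_abs_add (b M * π) (∑ n ∈ Finset.range M, b n * P n)
    rw [abs_mul, abs_of_pos pi_pos, add_comm (b M * π)] at h1
    linarith
  have hQ2 : (0.1 * π * |b M|) ^ 2 ≤ 50 * π * ∫ s in -π..π, F s ^ 2 := by
    refine le_trans ?_ hmain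
    rw [← sq_abs (_ + _)]
    gcongr
  rw [mul_pow, sq_abs] at hQ2
  have h7 : π * (0.01 * π * b M ^ 2) ≤ π * (50 * ∫ s in -π..π, F s ^ 2) := by linarith
  have h8 := le_of_mul_le_mul_left h7 pi_pos
  nlinarith [mul_le_mul_of_nonneg_right hpi.le (sq_nonneg (b M))]

/-- There is an absolute constant `C > 0` such that for every Weierstrass-type
shear profile `u(y) = Σ_{n≥1} a_n sin(3^n y)` with `a_n ≠ 0` and
`1 ≤ |a_n|/|a_{n+1}| ≤ 3`, and every positive integer `m`,
`ω₁(3^{-m}π, u) ≥ C⁻¹ 3^{-3m} a_m²`. -/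
theorem stmt_16 : ∃ C : ℝ, 0 < C ∧
    ∀ a : ℕ → ℝ, (∀ n : ℕ, 1 ≤ n → a n ≠ 0) →
    (∀ n : ℕ, 1 ≤ n → 1 ≤ |a n| / |a (n + 1)| ∧ |a n| / |a (n + 1)| ≤ 3) →
    ∀ m : ℕ, 1 ≤ m →
      C⁻¹ * (a m) ^ 2 / 3 ^ (3 * m) ≤
        omega1 (Real.pi / 3 ^ m)
          (fun y => -∑' n : ℕ, (a (n + 1) / 3 ^ (n + 1)) * Real.cos (3 ^ (n + 1) * y)) := by
  refine ⟨10000, by norm_num, fun a ha hr m hm => ?_⟩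
  obtain ⟨M, rfl⟩ : ∃ M, m = M + 1 := ⟨m - 1, by omega⟩
  have hpos : ∀ n, 0 < |a (n + 1)| := fun n => abs_pos.2 (ha _ (by omega))
  have hanti : Antitone fun n => |a (n + 1)| := antitone_nat_of_succ_le fun n => by
    have := (hr (n + 1) (by omega)).1
    rwa [le_div_iff₀ (hpos _), one_mul] at this
  have hmono : Monotone fun n => 3 ^ n * |a (n + 1)| := monotone_nat_of_le_succ fun n => by
    have := (hr (n + 1) (by omega)).2
    rw [div_le_iff₀ (hpos _)] at this
    calc (3 : ℝ) ^ n * |a (n + 1)| ≤ 3 ^ n * (3 * |a (n + 1 + 1)|) := by gcongr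
      _ = _ := by ring
  set b : ℕ → ℝ := fun n => a (n + 1) / 3 ^ (n + 1) with hb
  have hbabs : ∀ n, |b n| = |a (n + 1)| / 3 ^ (n + 1) := fun n => by
    simp only [hb]
    rw [abs_div, abs_of_pos (by positivity : (0 : ℝ) < 3 ^ (n + 1))]
  have hbs : Summable fun n => |b n| := by
    refine Summable.of_nonneg_of_le (fun n => abs_nonneg _) (fun n => ?_)
      ((summable_geometric_of_lt_one (by norm_num : (0 : ℝ) ≤ 1 / 3) (by norm_num)).mul_left |a 1|)
    rw [hbabs, div_eq_mul_inv, one_div, inv_pow]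
    have h1 : |a (n + 1)| ≤ |a 1| := hanti (Nat.zero_le n)
    gcongr
    · norm_num
    · omega
  have hlow : ∀ n < M, |b n| * (3 ^ n / 3 ^ M) ^ 2 ≤ |b M| := fun n hn => by
    have h1 : 3 ^ n * |a (n + 1)| ≤ 3 ^ M * |a (M + 1)| := hmono hn.le
    rw [hbabs, hbabs]
    calc |a (n + 1)| / 3 ^ (n + 1) * (3 ^ n / 3 ^ M) ^ 2
        = 3 ^ n * |a (n + 1)| / (3 * (3 ^ M) ^ 2) := by
          field_simp
          ring
      _ ≤ 3 ^ M * |a (M + 1)| / (3 * (3 ^ M) ^ 2) := by gcongr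
      _ = _ := by field_simp; ring
  refine le_csInf ⟨_, 0, 0, 0, rfl⟩ ?_
  rintro _ ⟨x, c₁, c₂, rfl⟩
  have key := sq_le_integral_lacunary hbs M hlow (fun n => 3 ^ (n + 1) * x) (c₁ + c₂ * x)
    (c₂ / 3 ^ (M + 1))
  have hN : (0 : ℝ) < 3 ^ (M + 1) := by positivity
  have hsub := intervalIntegral.integral_comp_add_div
    (fun y => (-∑' n, b n * Real.cos (3 ^ (n + 1) * y) - c₁ - c₂ * y) ^ 2)
    hN.ne' x (a := -Real.pi) (b := Real.pi)
  rw [neg_div, ← sub_eq_add_neg, smul_eq_mul] at hsub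
  have hcongr : ∫ s in -Real.pi..Real.pi,
      (-(∑' n, b n * Real.cos (3 ^ (n + 1) * x + 3 ^ n / 3 ^ M * s)) - (c₁ + c₂ * x) -
        c₂ / 3 ^ (M + 1) * s) ^ 2 = ∫ s in -Real.pi..Real.pi,
      (-∑' n, b n * Real.cos (3 ^ (n + 1) * (x + s / 3 ^ (M + 1))) - c₁ -
        c₂ * (x + s / 3 ^ (M + 1))) ^ 2 := by
    refine intervalIntegral.integral_congr fun s _ => ?_
    have : ∀ n : ℕ, (3 : ℝ) ^ (n + 1) * x + 3 ^ n / 3 ^ M * s =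
        3 ^ (n + 1) * (x + s / 3 ^ (M + 1)) := fun n => by
      rw [pow_succ, pow_succ]; field_simp
    simp only [this]
    ring
  rw [hcongr, hsub] at key
  have hfin : (10000 : ℝ)⁻¹ * a (M + 1) ^ 2 / 3 ^ (3 * (M + 1)) =
      (10000 * 3 ^ (M + 1))⁻¹ * b M ^ 2 := by
    simp only [hb]
    rw [mul_comm 3 (M + 1), pow_mul]
    field_simp
  rw [hfin, inv_mul_le_iff₀ (by positivity)]
  simpa only [mul_assoc] using key
end
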